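/- Let T and U be computable consistent extensions of PA and n ≥ 1. The following are equivalent: (1) there is a Σ_n sentence in HDCons(Π_n,T) ∩ HDCons(Π_n,U); (2) all three of the following hold: T and U are both Σ_n↓Π_n-conservative over PA; there is a Σ_n sentence φ with φ ∈ HCons(Π_n,T) and ¬φ ∈ HCons(Σ_n,U); and there is a Σ_n sentence ψ with ψ ∈ HCons(Π_n,U) and ¬ψ ∈ HCons(Σ_n,T). -/

import Mathlib

open FirstOrder Language
open scoped FirstOrder

namespace Guaspari

/-- The first-order language of arithmetic: a constant `0`, a unary function `S`,
binary functions `+` (coded `false`) and `·` (coded `true`), and a binary relation `≤`. -/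
def LA : FirstOrder.Language :=
  ⟨fun n => match n with | 0 => Unit | 1 => Unit | 2 => Bool | _ => Empty,
   fun n => match n with | 2 => Unit | _ => Empty⟩

/-- Sentences of the language of arithmetic. -/
abbrev Snt : Type := LA.Sentence

/-- Theories (sets of sentences) in the language of arithmetic. -/
abbrev Thy : Type := LA.Theory

/-- The term `0`. -/
def zeroT {α : Type} {n : ℕ} : LA.Term (α ⊕ Fin n) :=
  Constants.term (show LA.Constants from Unit.unit)

/-- The term `S t`. -/
def succT {α : Type} {n : ℕ} (t : LA.Term (α ⊕ Fin n)) : LA.Term (α ⊕ Fin n) :=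
  Functions.apply₁ (show LA.Functions 1 from Unit.unit) t

/-- The term `t + u`. -/
def addT {α : Type} {n : ℕ} (t u : LA.Term (α ⊕ Fin n)) : LA.Term (α ⊕ Fin n) :=
  Functions.apply₂ (show LA.Functions 2 from false) t u

/-- The term `t * u`. -/
def mulT {α : Type} {n : ℕ} (t u : LA.Term (α ⊕ Fin n)) : LA.Term (α ⊕ Fin n) :=
  Functions.apply₂ (show LA.Functions 2 from true) t u

/-- The atomic formula `t ≤ u`. -/
def leF {α : Type} {n : ℕ} (t u : LA.Term (α ⊕ Fin n)) : LA.BoundedFormula α n :=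
  Relations.boundedFormula₂ (show LA.Relations 2 from Unit.unit) t u

/-- The `i`-th (de Bruijn-indexed) bound variable as a term. -/
def vT {m : ℕ} (i : Fin m) : LA.Term (Empty ⊕ Fin m) := Term.var (Sum.inr i)

/-- The induction axiom for the formula `φ(x₀,…,x_{k-1}, x_k)` with induction on `x_k`,
universally closed over the parameters `x₀,…,x_{k-1}`. -/
def indAxiom {k : ℕ} (φ : LA.BoundedFormula Empty (k + 1)) : Snt :=
  let base := ∀' ((vT (Fin.last k) =' zeroT) ⟹ φ)
  let step := ∀' (φ ⟹
    ∀' ((vT (Fin.last (k + 1)) =' succT (vT (Fin.castSucc (Fin.last k)))) ⟹ φ.liftAt 1 k))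
  ((base ⊓ step) ⟹ ∀' φ).alls

/-- The axioms of Peano arithmetic `PA`: the basic axioms for `0`, `S`, `+`, `·`, `≤`,
together with the full induction scheme. -/
def PAAx : Thy :=
  {∀' ∼(succT (vT 0) =' zeroT),
   ∀' ∀' ((succT (vT 0) =' succT (vT 1)) ⟹ (vT 0 =' vT 1)),
   ∀' (addT (vT 0) zeroT =' vT 0),
   ∀' ∀' (addT (vT 0) (succT (vT 1)) =' succT (addT (vT 0) (vT 1))),
   ∀' (mulT (vT 0) zeroT =' zeroT),
   ∀' ∀' (mulT (vT 0) (succT (vT 1)) =' addT (mulT (vT 0) (vT 1)) (vT 0)),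
   ∀' ∀' (leF (vT 0) (vT 1) ⇔ ∃' (addT (vT 2) (vT 0) =' vT 1))} ∪
  {φ | ∃ (k : ℕ) (ψ : LA.BoundedFormula Empty (k + 1)), φ = indAxiom ψ}

/-- `Prv T φ`: the sentence `φ` is provable from the theory `T` (equivalently, by the
Gödel completeness theorem, `φ` holds in every model of `T`). -/
def Prv (T : Thy) (φ : Snt) : Prop := T ⊨ᵇ φ

/-- `Th T`: the set of sentences provable from `T`. -/
def Th (T : Thy) : Set Snt := {φ | Prv T φ}

/-- `Con T`: the theory `T` is consistent. -/
def Con (T : Thy) : Prop := ¬ Prv T ⊥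

/-- The theory `T + φ`. -/
def add (T : Thy) (φ : Snt) : Thy := insert φ T

/-- `T` is an extension of `PA`. -/
def ExtPA (T : Thy) : Prop := ∀ φ ∈ PAAx, Prv T φ

/-- `V` is a subtheory of `T` (containing `PA`, as assumed throughout the paper). -/
def SubThy (V T : Thy) : Prop := ExtPA V ∧ ∀ φ, Prv V φ → Prv T φ

/-- Δ₀ (bounded) formulas. -/
inductive IsDelta0 : ∀ {m : ℕ}, LA.BoundedFormula Empty m → Prop
  | falsum {m : ℕ} : IsDelta0 (⊥ : LA.BoundedFormula Empty m)
  | equal {m : ℕ} (t u : LA.Term (Empty ⊕ Fin m)) : IsDelta0 (t =' u)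
  | le {m : ℕ} (t u : LA.Term (Empty ⊕ Fin m)) : IsDelta0 (leF t u)
  | imp {m : ℕ} {φ ψ : LA.BoundedFormula Empty m} :
      IsDelta0 φ → IsDelta0 ψ → IsDelta0 (φ ⟹ ψ)
  | ball {m : ℕ} (t : LA.Term (Empty ⊕ Fin m)) {φ : LA.BoundedFormula Empty (m + 1)} :
      IsDelta0 φ →
      IsDelta0 (∀' (leF (vT (Fin.last m)) (t.relabel (Sum.map id Fin.castSucc)) ⟹ φ))
  | bex {m : ℕ} (t : LA.Term (Empty ⊕ Fin m)) {φ : LA.BoundedFormula Empty (m + 1)} :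
      IsDelta0 φ →
      IsDelta0 (∃' (leF (vT (Fin.last m)) (t.relabel (Sum.map id Fin.castSucc)) ⊓ φ))

mutual
  /-- `Σ_k` formulas (cumulatively: every `Π_k` formula is `Σ_{k+1}`). -/
  inductive IsSigmaFml : ℕ → ∀ {m : ℕ}, LA.BoundedFormula Empty m → Prop
    | ofDelta0 {m : ℕ} {φ : LA.BoundedFormula Empty m} : IsDelta0 φ → IsSigmaFml 0 φ
    | ofPi {k : ℕ} {m : ℕ} {φ : LA.BoundedFormula Empty m} :
        IsPiFml k φ → IsSigmaFml (k + 1) φ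
    | ex {k : ℕ} {m : ℕ} {φ : LA.BoundedFormula Empty (m + 1)} :
        IsSigmaFml (k + 1) φ → IsSigmaFml (k + 1) (∃' φ)
  /-- `Π_k` formulas (cumulatively: every `Σ_k` formula is `Π_{k+1}`). -/
  inductive IsPiFml : ℕ → ∀ {m : ℕ}, LA.BoundedFormula Empty m → Prop
    | ofDelta0 {m : ℕ} {φ : LA.BoundedFormula Empty m} : IsDelta0 φ → IsPiFml 0 φ
    | ofSigma {k : ℕ} {m : ℕ} {φ : LA.BoundedFormula Empty m} :
        IsSigmaFml k φ → IsPiFml (k + 1) φ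
    | all {k : ℕ} {m : ℕ} {φ : LA.BoundedFormula Empty (m + 1)} :
        IsPiFml (k + 1) φ → IsPiFml (k + 1) (∀' φ)
end

/-- The set of `Σ_k` sentences. -/
def SigmaS (k : ℕ) : Set Snt := {φ | IsSigmaFml k φ}

/-- The set of `Π_k` sentences. -/
def PiS (k : ℕ) : Set Snt := {φ | IsPiFml k φ}

/-- The set of `Σ_k ∧ Π_k` sentences, i.e. sentences of the form `σ ∧ π` with
`σ` a `Σ_k` sentence and `π` a `Π_k` sentence. -/
def SigAndPiS (k : ℕ) : Set Snt :=
  {φ | ∃ σ ∈ SigmaS k, ∃ π ∈ PiS k, φ = σ ⊓ π}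

/-- `B(Σ_k)` sentences: Boolean combinations of `Σ_k` sentences. -/
inductive IsBoolSigma (k : ℕ) : Snt → Prop
  | base {φ : Snt} : φ ∈ SigmaS k → IsBoolSigma k φ
  | not {φ : Snt} : IsBoolSigma k φ → IsBoolSigma k (∼φ)
  | imp {φ ψ : Snt} : IsBoolSigma k φ → IsBoolSigma k ψ → IsBoolSigma k (φ ⟹ ψ)
  | inf {φ ψ : Snt} : IsBoolSigma k φ → IsBoolSigma k ψ → IsBoolSigma k (φ ⊓ ψ)
  | sup {φ ψ : Snt} : IsBoolSigma k φ → IsBoolSigma k ψ → IsBoolSigma k (φ ⊔ ψ)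

/-- The set of `B(Σ_k)` sentences. -/
def BSigmaS (k : ℕ) : Set Snt := {φ | IsBoolSigma k φ}

/-- The set of `Γ` sentences provable in `T`, `Th_Γ(T)`. -/
def ThIn (Γ : Set Snt) (T : Thy) : Set Snt := Γ ∩ Th T

instance (i : ℕ) : Encodable (LA.Functions i) :=
  match i with
  | 0 => inferInstanceAs (Encodable Unit)
  | 1 => inferInstanceAs (Encodable Unit)
  | 2 => inferInstanceAs (Encodable Bool)
  | (_ + 3) => inferInstanceAs (Encodable Empty)

instance (i : ℕ) : Encodable (LA.Relations i) :=
  match i with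
  | 0 => inferInstanceAs (Encodable Empty)
  | 1 => inferInstanceAs (Encodable Empty)
  | 2 => inferInstanceAs (Encodable Unit)
  | (_ + 3) => inferInstanceAs (Encodable Empty)

/-- A Gödel numbering of sentences, via Mathlib's encoding of bounded formulas. -/
def gnum (φ : Snt) : ℕ :=
  Encodable.encode
    (show List ((Σ k, LA.Term (Empty ⊕ Fin k)) ⊕ ((Σ n, LA.Relations n) ⊕ ℕ)) from
      BoundedFormula.encoding.encode (⟨0, φ⟩ : Σ n, LA.BoundedFormula Empty n))

/-- The (axiom set of the) theory `T` is computable. -/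
def CompThy (T : Thy) : Prop :=
  ComputablePred (fun m : ℕ => ∃ φ ∈ T, gnum φ = m)

/-- `T` is a computable consistent extension of `PA`. -/
def GoodThy (T : Thy) : Prop := CompThy T ∧ Con T ∧ ExtPA T

/-- `φ` is `Γ`-conservative over `T` for a class of sentences `Γ`:
every `Γ` sentence provable in `T + φ` is provable in `T`. -/
def ConsIn (Γ : Set Snt) (T : Thy) (φ : Snt) : Prop :=
  ∀ γ ∈ Γ, Prv (add T φ) γ → Prv T γ

/-- `φ` is hereditarily `Γ`-conservative over `T`: `Γ`-conservative over every
subtheory of `T` (containing `PA`). -/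
def HConsIn (Γ : Set Snt) (T : Thy) (φ : Snt) : Prop :=
  ∀ V : Thy, SubThy V T → ConsIn Γ V φ

/-- `φ` is `Σ_k↓Π_k`-conservative over `V`. -/
def SPCons (k : ℕ) (V : Thy) (φ : Snt) : Prop :=
  ∀ σ ∈ SigmaS k, ∀ π ∈ PiS k, Prv (add V φ) (σ ⊓ π) → Prv V (σ ⊔ π)

/-- `φ` is hereditarily `Σ_k↓Π_k`-conservative over `T`. -/
def HSPCons (k : ℕ) (T : Thy) (φ : Snt) : Prop :=
  ∀ V : Thy, SubThy V T → SPCons k V φ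

/-- The theory `S` is `Σ_k↓Π_k`-conservative over `PA`. -/
def ThySPConsPA (k : ℕ) (S : Thy) : Prop :=
  ∀ σ ∈ SigmaS k, ∀ π ∈ PiS k, Prv S (σ ⊓ π) → Prv PAAx (σ ⊔ π)

/-- `δ` is a `Δ_k(S)` sentence: `S`-provably equivalent to both a `Σ_k` sentence
and a `Π_k` sentence. -/
def IsDeltaIn (k : ℕ) (S : Thy) (δ : Snt) : Prop :=
  (∃ σ ∈ SigmaS k, Prv S (δ ⇔ σ)) ∧ ∃ π ∈ PiS k, Prv S (δ ⇔ π)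

/-- `φ` is `Δ_k(S)`-conservative over `V`. -/
def DeltaConsRel (k : ℕ) (S V : Thy) (φ : Snt) : Prop :=
  ∀ δ : Snt, IsDeltaIn k S δ → Prv (add V φ) δ → Prv V δ

/-- `φ` is `Δ_k`-conservative over `T`, i.e. `Δ_k(Th(T))`-conservative over `T`. -/
def DeltaCons (k : ℕ) (T : Thy) (φ : Snt) : Prop := DeltaConsRel k (Th T) T φ

/-- `φ` is hereditarily `Δ_k`-conservative over `T`. -/
def HDeltaCons (k : ℕ) (T : Thy) (φ : Snt) : Prop :=
  ∀ V : Thy, SubThy V T → DeltaConsRel k (Th V) V φ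

/-- `φ` is doubly `Π_k`-conservative over `T`: `φ` is `Π_k`-conservative and `¬φ` is
`Σ_k`-conservative over `T`. -/
def DCons (k : ℕ) (T : Thy) (φ : Snt) : Prop :=
  ConsIn (PiS k) T φ ∧ ConsIn (SigmaS k) T (∼φ)

/-- `φ` is hereditarily doubly `Π_k`-conservative over `T`. -/
def HDCons (k : ℕ) (T : Thy) (φ : Snt) : Prop :=
  ∀ V : Thy, SubThy V T → DCons k V φ

/-- `(T,U)` is a `B_n`-pair. -/
def Bpair (n : ℕ) (T U : Thy) : Prop :=
  (¬ ThIn (PiS n) T ⊆ Th U ∨ Con (T ∪ ThIn (PiS n) U)) ∧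
  (¬ ThIn (PiS n) U ⊆ Th T ∨ Con (U ∪ ThIn (PiS n) T))

/-- `(T,U)` is a `C_n`-pair. -/
def Cpair (n : ℕ) (T U : Thy) : Prop :=
  Con (T ∪ ThIn (PiS n) U) ∧ Con (U ∪ ThIn (PiS n) T)

/-- `(T,U)` is a `C⁻_n`-pair. -/
def Cmpair (n : ℕ) (T U : Thy) : Prop :=
  Con (T ∪ ThIn (PiS n) U) ∨ Con (U ∪ ThIn (PiS n) T)

/-- `(T,U)` is a `C^∧_n`-pair. -/
def Capair (n : ℕ) (T U : Thy) : Prop :=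
  Con (T ∪ ThIn (SigAndPiS n) U) ∧ Con (U ∪ ThIn (SigAndPiS n) T)

/-- `(T,U)` is a `C^B_n`-pair. -/
def CBpair (n : ℕ) (T U : Thy) : Prop :=
  Con (T ∪ ThIn (BSigmaS n) U)



/-- A (small) model of `PA`. -/
structure Mod where
  carrier : Type
  str : LA.Structure carrier
  ne : Nonempty carrier
  pa : ∀ φ ∈ PAAx, Sentence.Realize carrier φ

instance : CoeSort Mod Type := ⟨Mod.carrier⟩
instance (M : Mod) : LA.Structure M := M.str
instance (M : Mod) : Nonempty M := M.ne

def zz (M : Mod) : M := Structure.funMap (L := LA) (show LA.Functions 0 from Unit.unit) ![]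
def sc (M : Mod) (a : M) : M := Structure.funMap (L := LA) (show LA.Functions 1 from Unit.unit) ![a]
def ad (M : Mod) (a b : M) : M := Structure.funMap (L := LA) (show LA.Functions 2 from false) ![a, b]
def mu (M : Mod) (a b : M) : M := Structure.funMap (L := LA) (show LA.Functions 2 from true) ![a, b]
def lle (M : Mod) (a b : M) : Prop :=
  Structure.RelMap (L := LA) (show LA.Relations 2 from Unit.unit) ![a, b]

instance (M : Mod) : Zero M := ⟨zz M⟩
instance (M : Mod) : One M := ⟨sc M 0⟩
instance (M : Mod) : Add M := ⟨ad M⟩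
instance (M : Mod) : Mul M := ⟨mu M⟩
instance (M : Mod) : LE M := ⟨lle M⟩

set_option linter.unusedSimpArgs false
section realize
variable {M : Type} [LA.Structure M]
theorem realize_zeroT' {m : ℕ} (w : Empty ⊕ Fin m → M) :
    (zeroT : LA.Term (Empty ⊕ Fin m)).realize w =
      Structure.funMap (L := LA) (show LA.Functions 0 from Unit.unit) ![] := by
  refine (Term.realize_constants (L := LA)).trans ?_
  exact congrArg (Structure.funMap _) (Subsingleton.elim _ _)
theorem realize_succT' {m : ℕ} (w : Empty ⊕ Fin m → M) (t : LA.Term (Empty ⊕ Fin m)) :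
    (succT t).realize w =
      Structure.funMap (L := LA) (show LA.Functions 1 from Unit.unit) ![t.realize w] := by
  exact Term.realize_functions_apply₁
theorem realize_addT' {m : ℕ} (w : Empty ⊕ Fin m → M) (t u : LA.Term (Empty ⊕ Fin m)) :
    (addT t u).realize w =
      Structure.funMap (L := LA) (show LA.Functions 2 from false) ![t.realize w, u.realize w] := by
  exact Term.realize_functions_apply₂
theorem realize_mulT' {m : ℕ} (w : Empty ⊕ Fin m → M) (t u : LA.Term (Empty ⊕ Fin m)) :
    (mulT t u).realize w =
      Structure.funMap (L := LA) (show LA.Functions 2 from true) ![t.realize w, u.realize w] := by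
  exact Term.realize_functions_apply₂
theorem realize_leF' {m : ℕ} (w : Empty → M) (v : Fin m → M) (t u : LA.Term (Empty ⊕ Fin m)) :
    (leF t u).Realize w v ↔
      Structure.RelMap (L := LA) (show LA.Relations 2 from Unit.unit)
        ![t.realize (Sum.elim w v), u.realize (Sum.elim w v)] := by
  exact BoundedFormula.realize_rel₂
theorem realize_vT' {m : ℕ} (w : Empty → M) (v : Fin m → M) (i : Fin m) :
    (vT i).realize (Sum.elim w v) = v i := by
  simp [vT]
end realize

section realizeM
variable {M : Mod}
@[simp] theorem realize_zeroT {m : ℕ} (w : Empty ⊕ Fin m → M) :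
    (zeroT : LA.Term (Empty ⊕ Fin m)).realize w = 0 := realize_zeroT' w
@[simp] theorem realize_succT {m : ℕ} (w : Empty ⊕ Fin m → M) (t : LA.Term (Empty ⊕ Fin m)) :
    (succT t).realize w = sc M (t.realize w) := realize_succT' w t
@[simp] theorem realize_addT {m : ℕ} (w : Empty ⊕ Fin m → M) (t u : LA.Term (Empty ⊕ Fin m)) :
    (addT t u).realize w = t.realize w + u.realize w := realize_addT' w t u
@[simp] theorem realize_mulT {m : ℕ} (w : Empty ⊕ Fin m → M) (t u : LA.Term (Empty ⊕ Fin m)) :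
    (mulT t u).realize w = t.realize w * u.realize w := realize_mulT' w t u
@[simp] theorem realize_leF {m : ℕ} (w : Empty → M) (v : Fin m → M)
    (t u : LA.Term (Empty ⊕ Fin m)) :
    (leF t u).Realize w v ↔ t.realize (Sum.elim w v) ≤ u.realize (Sum.elim w v) :=
  realize_leF' w v t u
@[simp] theorem realize_vT {m : ℕ} (w : Empty → M) (v : Fin m → M) (i : Fin m) :
    (vT i).realize (Sum.elim w v) = v i := realize_vT' w v i
end realizeM

/-- predicates on all models -/
abbrev Pred (m : ℕ) := ∀ M : Mod, (Fin m → M) → Prop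
abbrev Func (m : ℕ) := ∀ M : Mod, (Fin m → M) → M

/-- term-definable functions -/
class TD {m : ℕ} (f : Func m) : Prop where
  out : ∃ t : LA.Term (Empty ⊕ Fin m), ∀ (M : Mod) (v : Fin m → M),
    t.realize (Sum.elim default v) = f M v

/-- definable predicates -/
class AD {m : ℕ} (P : Pred m) : Prop where
  out : ∃ φ : LA.BoundedFormula Empty m, ∀ (M : Mod) (v : Fin m → M), φ.Realize default v ↔ P M v

/-- predicates definable by bounded formulas -/
class D0 {m : ℕ} (P : Pred m) : Prop where
  out : ∃ φ : LA.BoundedFormula Empty m, IsDelta0 φ ∧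
    ∀ (M : Mod) (v : Fin m → M), φ.Realize default v ↔ P M v

instance TD.var {m : ℕ} (i : Fin m) : TD (fun _ v => v i) := ⟨vT i, fun _ _ => by simp⟩
instance TD.zero {m : ℕ} : TD (m := m) (fun _ _ => 0) := ⟨zeroT, fun _ _ => by simp⟩
theorem TD.succ {m : ℕ} {f : Func m} [hf : TD f] : TD (fun M v => sc M (f M v)) := by
  obtain ⟨t, ht⟩ := hf; exact ⟨succT t, fun _ _ => by simp [ht]⟩
instance {m : ℕ} {f : Func m} [hf : TD f] : TD (fun M v => sc M (f M v)) := TD.succ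
instance TD.one {m : ℕ} : TD (m := m) (fun _ _ => 1) := TD.succ (f := fun _ _ => 0)
instance TD.add {m : ℕ} {f g : Func m} [hf : TD f] [hg : TD g] :
    TD (fun M v => f M v + g M v) := by
  obtain ⟨t, ht⟩ := hf; obtain ⟨u, hu⟩ := hg; exact ⟨addT t u, fun _ _ => by simp [ht, hu]⟩
instance TD.mul {m : ℕ} {f g : Func m} [hf : TD f] [hg : TD g] :
    TD (fun M v => f M v * g M v) := by
  obtain ⟨t, ht⟩ := hf; obtain ⟨u, hu⟩ := hg; exact ⟨mulT t u, fun _ _ => by simp [ht, hu]⟩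

theorem realize_castSucc {M : Type} [LA.Structure M] {m : ℕ} (t : LA.Term (Empty ⊕ Fin m))
    (w : Empty → M) (v : Fin (m+1) → M) :
    (t.relabel (Sum.map id Fin.castSucc)).realize (Sum.elim w v) =
      t.realize (Sum.elim w (Fin.init v)) := by
  rw [Term.realize_relabel]
  congr 1
  funext x
  rcases x with x | x
  · rfl
  · rfl

theorem TD.init {m : ℕ} {f : Func m} (hf : TD f) :
    TD (m := m+1) (fun M v => f M (fun i => v i.castSucc)) := by
  obtain ⟨t, ht⟩ := hf
  exact ⟨t.relabel (Sum.map id Fin.castSucc), fun M v => (realize_castSucc t _ v).trans (ht M _)⟩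

/-- substitution of terms for variables -/
def liftS {m m' : ℕ} (f : Fin m → LA.Term (Empty ⊕ Fin m')) :
    Fin (m+1) → LA.Term (Empty ⊕ Fin (m'+1)) :=
  Fin.snoc (fun i => (f i).relabel (Sum.map id Fin.castSucc)) (vT (Fin.last m'))

def tsub {m m' : ℕ} (f : Fin m → LA.Term (Empty ⊕ Fin m')) (t : LA.Term (Empty ⊕ Fin m)) :
    LA.Term (Empty ⊕ Fin m') :=
  t.subst (Sum.elim (fun e => e.elim) f)

def sub : ∀ {m m' : ℕ}, (Fin m → LA.Term (Empty ⊕ Fin m')) → LA.BoundedFormula Empty m →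
    LA.BoundedFormula Empty m'
  | _, _, _, BoundedFormula.falsum => BoundedFormula.falsum
  | _, _, f, BoundedFormula.equal t u => BoundedFormula.equal (tsub f t) (tsub f u)
  | _, _, f, BoundedFormula.rel R ts => BoundedFormula.rel R (fun i => tsub f (ts i))
  | _, _, f, BoundedFormula.imp a b => BoundedFormula.imp (sub f a) (sub f b)
  | _, _, f, BoundedFormula.all a => BoundedFormula.all (sub (liftS f) a)

theorem realize_tsub {M : Type} [LA.Structure M] {m m' : ℕ}
    (f : Fin m → LA.Term (Empty ⊕ Fin m')) (t : LA.Term (Empty ⊕ Fin m)) (w : Empty → M)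
    (v : Fin m' → M) :
    (tsub f t).realize (Sum.elim w v) =
      t.realize (Sum.elim w (fun i => (f i).realize (Sum.elim w v))) := by
  unfold tsub
  rw [Term.realize_subst]
  congr 1
  funext x
  rcases x with x | x
  · exact x.elim
  · rfl

theorem realize_sub {M : Type} [LA.Structure M] {m : ℕ} (φ : LA.BoundedFormula Empty m) :
    ∀ {m' : ℕ} (f : Fin m → LA.Term (Empty ⊕ Fin m')) (w : Empty → M) (v : Fin m' → M),
    (sub f φ).Realize w v ↔ φ.Realize w (fun i => (f i).realize (Sum.elim w v)) := by
  induction φ with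
  | falsum => intros; rfl
  | equal t u => intro m' f w v; simp only [sub, BoundedFormula.Realize, realize_tsub]
  | rel R ts => intro m' f w v; simp only [sub, BoundedFormula.Realize, realize_tsub]
  | imp a b iha ihb => intro m' f w v; simp only [sub, BoundedFormula.Realize, iha, ihb]
  | all a ih =>
    intro m' f w v
    simp only [sub, BoundedFormula.Realize, ih]
    refine forall_congr' fun x => ?_
    have : (fun i => (liftS f i).realize (Sum.elim w (Fin.snoc v x : Fin (m'+1) → M))) =
        (Fin.snoc (fun i => (f i).realize (Sum.elim w v)) x : Fin (_+1) → M) := by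
      funext i
      refine Fin.lastCases ?_ (fun i => ?_) i
      · simp [liftS, realize_vT']
      · simp only [liftS, Fin.snoc_castSucc, realize_castSucc, Fin.init_snoc]
    rw [this]

theorem tsub_castSucc {m m' : ℕ} (f : Fin m → LA.Term (Empty ⊕ Fin m'))
    (t : LA.Term (Empty ⊕ Fin m)) :
    tsub (liftS f) (t.relabel (Sum.map id Fin.castSucc)) =
      (tsub f t).relabel (Sum.map id Fin.castSucc) := by
  induction t with
  | var x =>
    rcases x with x | x
    · exact x.elim
    · simp [tsub, liftS, Term.subst, Term.relabel]
  | func g ts ih =>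
    simp only [tsub, Term.relabel, Term.subst] at ih ⊢
    congr 1
    funext i
    exact ih i

theorem tsub_leF {m m' : ℕ} (f : Fin m → LA.Term (Empty ⊕ Fin m')) (t u : LA.Term (Empty ⊕ Fin m)) :
    sub f (leF t u) = leF (tsub f t) (tsub f u) := by
  unfold leF Relations.boundedFormula₂ Relations.boundedFormula
  simp only [sub]
  congr 1
  funext i
  fin_cases i <;> rfl

theorem tsub_last {m m' : ℕ} (f : Fin m → LA.Term (Empty ⊕ Fin m')) :
    tsub (liftS f) (vT (Fin.last m)) = vT (Fin.last m') := by
  simp [tsub, liftS, vT, Term.subst]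

theorem IsDelta0.sub {m : ℕ} {φ : LA.BoundedFormula Empty m} (h : IsDelta0 φ) :
    ∀ {m' : ℕ} (f : Fin m → LA.Term (Empty ⊕ Fin m')), IsDelta0 (sub f φ) := by
  induction h with
  | falsum => intros; exact .falsum
  | equal t u => intros; exact .equal _ _
  | le t u => intro m' f; rw [tsub_leF]; exact .le _ _
  | imp _ _ iha ihb => intro m' f; exact .imp (iha f) (ihb f)
  | ball t _ ih =>
    intro m' f
    have := IsDelta0.ball (tsub f t) (ih (liftS f))
    rw [← tsub_castSucc, ← tsub_last f, ← tsub_leF] at this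
    exact this
  | bex t _ ih =>
    intro m' f
    have := IsDelta0.bex (tsub f t) (ih (liftS f))
    rw [← tsub_castSucc, ← tsub_last f, ← tsub_leF] at this
    exact this

theorem AD.subst {m m' : ℕ} {P : Pred m} (h : AD P) {f : Fin m → Func m'} (hf : ∀ i, TD (f i)) :
    AD (fun M v => P M (fun i => f i M v)) := by
  obtain ⟨φ, hφ⟩ := h
  choose t ht using fun i => (hf i).out
  refine ⟨Guaspari.sub t φ, fun M v => ?_⟩
  rw [realize_sub, hφ]; simp only [ht]

theorem D0.subst {m m' : ℕ} {P : Pred m} (h : D0 P) {f : Fin m → Func m'} (hf : ∀ i, TD (f i)) :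
    D0 (fun M v => P M (fun i => f i M v)) := by
  obtain ⟨φ, h0, hφ⟩ := h
  choose t ht using fun i => (hf i).out
  refine ⟨Guaspari.sub t φ, h0.sub t, fun M v => ?_⟩
  rw [realize_sub, hφ]; simp only [ht]

instance (priority := 50) D0.toAD {m : ℕ} {P : Pred m} [h : D0 P] : AD P := ⟨h.out.choose, h.out.choose_spec.2⟩

section AD
variable {m : ℕ} {P Q : Pred m} {f g : Func m}
theorem AD.congr (h : AD P) (e : ∀ M v, Q M v ↔ P M v) : AD Q := by
  obtain ⟨φ, hφ⟩ := h; exact ⟨φ, fun M v => (hφ M v).trans (e M v).symm⟩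
instance AD.eq [hf : TD f] [hg : TD g] : AD (fun M v => f M v = g M v) := by
  obtain ⟨t, ht⟩ := hf; obtain ⟨u, hu⟩ := hg
  exact ⟨t =' u, fun M v => by simp [ht, hu]⟩
instance AD.le [hf : TD f] [hg : TD g] : AD (fun M v => f M v ≤ g M v) := by
  obtain ⟨t, ht⟩ := hf; obtain ⟨u, hu⟩ := hg
  exact ⟨leF t u, fun M v => by simp [ht, hu]⟩
instance AD.not [hP : AD P] : AD (fun M v => ¬ P M v) := by
  obtain ⟨φ, h⟩ := hP; exact ⟨∼φ, fun M v => by simp [h]⟩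
instance AD.and [hP : AD P] [hQ : AD Q] : AD (fun M v => P M v ∧ Q M v) := by
  obtain ⟨φ, h⟩ := hP; obtain ⟨ψ, h'⟩ := hQ; exact ⟨φ ⊓ ψ, fun M v => by simp [h, h']⟩
instance AD.or [hP : AD P] [hQ : AD Q] : AD (fun M v => P M v ∨ Q M v) := by
  obtain ⟨φ, h⟩ := hP; obtain ⟨ψ, h'⟩ := hQ; exact ⟨φ ⊔ ψ, fun M v => by simp [h, h']⟩
instance AD.imp [hP : AD P] [hQ : AD Q] : AD (fun M v => P M v → Q M v) := by
  obtain ⟨φ, h⟩ := hP; obtain ⟨ψ, h'⟩ := hQ; exact ⟨φ ⟹ ψ, fun M v => by simp [h, h']⟩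
instance AD.iff [hP : AD P] [hQ : AD Q] : AD (fun M v => (P M v ↔ Q M v)) := by
  obtain ⟨φ, h⟩ := hP; obtain ⟨ψ, h'⟩ := hQ; exact ⟨φ ⇔ ψ, fun M v => by simp [h, h']⟩
instance AD.all {R : ∀ M : Mod, (Fin m → M) → M → Prop}
    [h : AD (m := m+1) (fun M v => R M (fun i => v i.castSucc) (v (Fin.last m)))] :
    AD (fun M v => ∀ a, R M v a) := by
  obtain ⟨φ, h⟩ := h; exact ⟨∀' φ, fun M v => by simp [h]⟩
instance AD.ex {R : ∀ M : Mod, (Fin m → M) → M → Prop}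
    [h : AD (m := m+1) (fun M v => R M (fun i => v i.castSucc) (v (Fin.last m)))] :
    AD (fun M v => ∃ a, R M v a) := by
  obtain ⟨φ, h⟩ := h; exact ⟨∃' φ, fun M v => by simp [h]⟩

theorem D0.congr (h : D0 P) (e : ∀ M v, Q M v ↔ P M v) : D0 Q := by
  obtain ⟨φ, h0, hφ⟩ := h; exact ⟨φ, h0, fun M v => (hφ M v).trans (e M v).symm⟩
instance D0.eq [hf : TD f] [hg : TD g] : D0 (fun M v => f M v = g M v) := by
  obtain ⟨t, ht⟩ := hf; obtain ⟨u, hu⟩ := hg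
  exact ⟨t =' u, .equal _ _, fun M v => by simp [ht, hu]⟩
instance D0.le [hf : TD f] [hg : TD g] : D0 (fun M v => f M v ≤ g M v) := by
  obtain ⟨t, ht⟩ := hf; obtain ⟨u, hu⟩ := hg
  exact ⟨leF t u, .le _ _, fun M v => by simp [ht, hu]⟩
instance D0.imp [hP : D0 P] [hQ : D0 Q] : D0 (fun M v => P M v → Q M v) := by
  obtain ⟨φ, h0, h⟩ := hP; obtain ⟨ψ, h0', h'⟩ := hQ
  exact ⟨φ ⟹ ψ, .imp h0 h0', fun M v => by simp [h, h']⟩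
instance D0.fls : D0 (m := m) (fun _ _ => False) :=
  ⟨⊥, .falsum, fun M v => by simp⟩
instance D0.not [hP : D0 P] : D0 (fun M v => ¬ P M v) := D0.imp (Q := fun _ _ => False)
instance D0.and [hP : D0 P] [hQ : D0 Q] : D0 (fun M v => P M v ∧ Q M v) :=
  D0.congr (P := fun M v => ¬ (P M v → ¬ Q M v)) inferInstance (by intros; tauto)
instance D0.or [hP : D0 P] [hQ : D0 Q] : D0 (fun M v => P M v ∨ Q M v) :=
  D0.congr (P := fun M v => ¬ P M v → Q M v) inferInstance (by intros; tauto)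
instance D0.iff [hP : D0 P] [hQ : D0 Q] : D0 (fun M v => (P M v ↔ Q M v)) :=
  D0.congr (P := fun M v => (P M v → Q M v) ∧ (Q M v → P M v)) inferInstance (by intros; tauto)
instance D0.ball {R : ∀ M : Mod, (Fin m → M) → M → Prop} [hf : TD f]
    [h : D0 (m := m+1) (fun M v => R M (fun i => v i.castSucc) (v (Fin.last m)))] :
    D0 (fun M v => ∀ a, a ≤ f M v → R M v a) := by
  obtain ⟨φ, h0, h⟩ := h
  obtain ⟨t, ht⟩ := hf
  exact ⟨_, .ball t h0, fun M v => by
    simp only [BoundedFormula.realize_all, BoundedFormula.realize_ex, BoundedFormula.realize_imp,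
      BoundedFormula.realize_inf, realize_leF, realize_castSucc, realize_vT, ht, h, Fin.init_snoc, Fin.snoc_last, Fin.snoc_castSucc]⟩
instance D0.bex {R : ∀ M : Mod, (Fin m → M) → M → Prop} [hf : TD f]
    [h : D0 (m := m+1) (fun M v => R M (fun i => v i.castSucc) (v (Fin.last m)))] :
    D0 (fun M v => ∃ a, a ≤ f M v ∧ R M v a) := by
  obtain ⟨φ, h0, h⟩ := h
  obtain ⟨t, ht⟩ := hf
  exact ⟨_, .bex t h0, fun M v => by
    simp only [BoundedFormula.realize_all, BoundedFormula.realize_ex, BoundedFormula.realize_imp,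
      BoundedFormula.realize_inf, realize_leF, realize_castSucc, realize_vT, ht, h, Fin.init_snoc, Fin.snoc_last, Fin.snoc_castSucc]⟩
end AD

/-- induction in models -/
theorem ind {m : ℕ} {R : ∀ M : Mod, (Fin m → M) → M → Prop}
    [h : AD (m := m+1) (fun M v => R M (fun i => v i.castSucc) (v (Fin.last m)))]
    (M : Mod) (v : Fin m → M) (h0 : R M v 0) (hs : ∀ a, R M v a → R M v (sc M a)) :
    ∀ a, R M v a := by
  obtain ⟨φ, hφ⟩ := h
  have := M.pa (indAxiom φ) (Or.inr ⟨m, φ, rfl⟩)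
  unfold indAxiom at this
  have := (BoundedFormula.realize_alls (M := M) (v := default)).1 this v
  simp only [BoundedFormula.realize_imp, BoundedFormula.realize_inf, BoundedFormula.realize_all] at this
  have key := this ⟨?_, ?_⟩
  · intro a
    have := (hφ _ _).1 (key a)
    simpa using this
  · intro a ha
    simp at ha
    rw [hφ]
    simpa [ha] using h0
  · intro a ha b hb
    simp at hb
    rw [BoundedFormula.realize_liftAt_one (by omega), hφ]
    rw [hφ] at ha
    have e1 : ∀ x : Fin (m+1+1) → M, Fin.init (x ∘ fun i : Fin (m+1) => if (i:ℕ) < m then Fin.castSucc i else i.succ)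
      = Fin.init (Fin.init x) := by
      intro x; funext i; simp [Fin.init]
    have e2 : ∀ x : Fin (m+1+1) → M, (x ∘ fun i : Fin (m+1) => if (i:ℕ) < m then Fin.castSucc i else i.succ) (Fin.last m)
      = x (Fin.last _) := by
      intro x; simp
    rw [e2]
    change R M (Fin.init (Fin.snoc (Fin.snoc v a) b ∘ fun i : Fin (m+1) => if (i:ℕ) < m then Fin.castSucc i else i.succ)) _
    rw [e1]
    simp at ha ⊢
    rw [hb]
    exact hs a ha

section basic
variable (M : Mod)
theorem ax1 (a : M) : sc M a ≠ 0 := by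
  have := M.pa (∀' ∼(succT (vT 0) =' zeroT)) (by simp [PAAx])
  simp only [Sentence.Realize, Formula.Realize, BoundedFormula.realize_all, BoundedFormula.realize_not,
    BoundedFormula.realize_bdEqual, realize_succT, realize_vT, realize_zeroT] at this
  exact this a
theorem ax2 (a b : M) (h : sc M a = sc M b) : a = b := by
  have := M.pa (∀' ∀' ((succT (vT 0) =' succT (vT 1)) ⟹ (vT 0 =' vT 1))) (by simp [PAAx])
  simp only [Sentence.Realize, Formula.Realize, BoundedFormula.realize_all, BoundedFormula.realize_imp,
    BoundedFormula.realize_bdEqual, realize_succT, realize_vT, realize_zeroT] at this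
  exact this a b h
theorem ax3 (a : M) : a + 0 = a := by
  have := M.pa (∀' (addT (vT 0) zeroT =' vT 0)) (by simp [PAAx])
  simp only [Sentence.Realize, Formula.Realize, BoundedFormula.realize_all,
    BoundedFormula.realize_bdEqual, realize_addT, realize_vT, realize_zeroT] at this
  exact this a
theorem ax4 (a b : M) : a + sc M b = sc M (a + b) := by
  have := M.pa (∀' ∀' (addT (vT 0) (succT (vT 1)) =' succT (addT (vT 0) (vT 1)))) (by simp [PAAx])
  simp only [Sentence.Realize, Formula.Realize, BoundedFormula.realize_all,
    BoundedFormula.realize_bdEqual, realize_addT, realize_succT, realize_vT, realize_zeroT] at this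
  exact this a b
theorem ax5 (a : M) : a * 0 = 0 := by
  have := M.pa (∀' (mulT (vT 0) zeroT =' zeroT)) (by simp [PAAx])
  simp only [Sentence.Realize, Formula.Realize, BoundedFormula.realize_all,
    BoundedFormula.realize_bdEqual, realize_mulT, realize_vT, realize_zeroT] at this
  exact this a
theorem ax6 (a b : M) : a * sc M b = a * b + a := by
  have := M.pa (∀' ∀' (mulT (vT 0) (succT (vT 1)) =' addT (mulT (vT 0) (vT 1)) (vT 0))) (by simp [PAAx])
  simp only [Sentence.Realize, Formula.Realize, BoundedFormula.realize_all,
    BoundedFormula.realize_bdEqual, realize_addT, realize_mulT, realize_succT, realize_vT, realize_zeroT] at this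
  exact this a b
theorem ax7 (a b : M) : a ≤ b ↔ ∃ c, c + a = b := by
  have := M.pa (∀' ∀' (leF (vT 0) (vT 1) ⇔ ∃' (addT (vT 2) (vT 0) =' vT 1))) (by simp [PAAx])
  simp only [Sentence.Realize, Formula.Realize, BoundedFormula.realize_all, BoundedFormula.realize_iff,
    BoundedFormula.realize_ex,
    BoundedFormula.realize_bdEqual, realize_addT, realize_leF, realize_vT, realize_zeroT] at this
  exact this a b
end basic



section arith
variable {M : Mod}

theorem sc_eq (a : M) : sc M a = a + 1 := by
  have := ax4 M a 0
  rw [ax3] at this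
  exact this.symm
theorem m_add_zero (a : M) : a + 0 = a := ax3 M a
theorem m_add_succ (a b : M) : a + (b + 1) = (a + b) + 1 := by
  rw [← sc_eq, ← sc_eq, ax4]
theorem m_mul_succ (a b : M) : a * (b + 1) = a * b + a := by
  rw [← sc_eq, ax6]

theorem m_zero_add (a : M) : 0 + a = a :=
  ind (R := fun _ _ a => 0 + a = a) M ![] (ax3 M 0)
    (fun a h => by rw [sc_eq, m_add_succ, h]) a
theorem m_add_assoc (a b c : M) : a + b + c = a + (b + c) :=
  ind (R := fun _ v c => v 0 + v 1 + c = v 0 + (v 1 + c)) M ![a, b]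
    (by simp only [ax3])
    (fun c h => by simp only [sc_eq, m_add_succ, h]) c
theorem m_succ_add (a b : M) : (a + 1) + b = a + b + 1 :=
  ind (R := fun _ v b => (v 0 + 1) + b = v 0 + b + 1) M ![a]
    (by simp only [ax3])
    (fun c h => by simp only [sc_eq, m_add_succ, h]) b
theorem m_add_comm (a b : M) : a + b = b + a :=
  ind (R := fun _ v b => v 0 + b = b + v 0) M ![a]
    (by simp only [ax3, m_zero_add])
    (fun c h => by simp only [sc_eq, m_add_succ, m_succ_add, h]) b
theorem m_zero_mul (a : M) : 0 * a = 0 :=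
  ind (R := fun _ _ a => 0 * a = 0) M ![] (ax5 M 0)
    (fun a h => by rw [sc_eq, m_mul_succ, h, ax3]) a
theorem m_left_distrib (a b c : M) : a * (b + c) = a * b + a * c :=
  ind (R := fun _ v c => v 0 * (v 1 + c) = v 0 * v 1 + v 0 * c) M ![a, b]
    (by simp only [ax3, ax5])
    (fun c h => by simp only [sc_eq, m_add_succ, m_mul_succ]; rw [h, m_add_assoc]) c
theorem m_succ_mul (a b : M) : (a + 1) * b = a * b + b :=
  ind (R := fun _ v b => (v 0 + 1) * b = v 0 * b + b) M ![a]
    (by simp only [ax3, ax5])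
    (fun c h => by
      simp only [sc_eq, m_mul_succ, h, m_add_succ]
      rw [m_add_assoc (_ * _) c, m_add_comm c, m_add_assoc (_ * _), m_add_assoc (_ * _), m_add_assoc,
        m_add_assoc (_ * _), m_add_assoc]) b
theorem m_mul_comm (a b : M) : a * b = b * a :=
  ind (R := fun _ v b => v 0 * b = b * v 0) M ![a]
    (by simp only [ax5, m_zero_mul])
    (fun c h => by simp only [sc_eq, m_mul_succ, m_succ_mul, h]) b
theorem m_mul_assoc (a b c : M) : a * b * c = a * (b * c) :=
  ind (R := fun _ v c => v 0 * v 1 * c = v 0 * (v 1 * c)) M ![a, b]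
    (by simp only [ax5])
    (fun c h => by simp only [sc_eq, m_mul_succ]; rw [h, m_left_distrib]) c
theorem m_mul_one (a : M) : a * 1 = a := by
  have := m_mul_succ a 0
  rw [m_zero_add, ax5, m_zero_add] at this
  exact this

theorem m_add_right_cancel (a b c : M) : a + c = b + c → a = b :=
  ind (R := fun _ v c => v 0 + c = v 1 + c → v 0 = v 1) M ![a, b]
    (by simp only [ax3]; exact id)
    (fun c h e => by
      simp only [sc_eq, m_add_succ] at e
      simp only [← sc_eq] at e
      exact h (ax2 M _ _ e)) c

theorem m_cases (a : M) : a = 0 ∨ ∃ b, a = b + 1 :=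
  ind (R := fun _ _ a => a = 0 ∨ ∃ b, a = b + 1) M ![] (Or.inl rfl)
    (fun a _ => Or.inr ⟨a, sc_eq a⟩) a

theorem m_add_eq_zero (a b : M) (h : a + b = 0) : b = 0 := by
  rcases m_cases b with rfl | ⟨c, rfl⟩
  · rfl
  · rw [m_add_succ, ← sc_eq] at h; exact absurd h (ax1 M _)

theorem m_le_total (a b : M) : (∃ c, c + a = b) ∨ (∃ c, c + b = a) :=
  ind (R := fun _ v b => (∃ c, c + v 0 = b) ∨ (∃ c, c + b = v 0)) M ![a]
    (Or.inr ⟨a, ax3 M a⟩)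
    (fun b h => by
      rcases h with ⟨c, h⟩ | ⟨c, h⟩
      · exact Or.inl ⟨c + 1, by rw [m_succ_add, sc_eq, h]⟩
      · rcases m_cases c with rfl | ⟨d, rfl⟩
        · left; exact ⟨1, by rw [← h, m_zero_add, m_add_comm, sc_eq]⟩
        · right; exact ⟨d, by rw [← h, m_succ_add, sc_eq, m_add_succ]⟩) b

end arith

noncomputable instance instCS (M : Mod) : CommSemiring M where
  add := (· + ·)
  mul := (· * ·)
  zero := 0
  one := 1
  nsmul := nsmulRec
  npow := npowRec
  add_assoc := m_add_assoc
  zero_add := m_zero_add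
  add_zero := m_add_zero
  add_comm := m_add_comm
  mul_assoc := m_mul_assoc
  one_mul a := (m_mul_comm _ _).trans (m_mul_one a)
  mul_one := m_mul_one
  zero_mul := m_zero_mul
  mul_zero a := ax5 M a
  left_distrib := m_left_distrib
  right_distrib a b c := by
    rw [m_mul_comm, m_left_distrib, m_mul_comm c, m_mul_comm c]
  mul_comm := m_mul_comm

noncomputable instance (M : Mod) : LinearOrder M where
  le := (· ≤ ·)
  le_refl a := (ax7 M a a).2 ⟨0, zero_add a⟩
  le_trans a b c h1 h2 := by
    obtain ⟨x, rfl⟩ := (ax7 M _ _).1 h1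
    obtain ⟨y, rfl⟩ := (ax7 M _ _).1 h2
    exact (ax7 M _ _).2 ⟨y + x, by rw [add_assoc]⟩
  le_antisymm a b h1 h2 := by
    obtain ⟨x, rfl⟩ := (ax7 M _ _).1 h1
    obtain ⟨y, h⟩ := (ax7 M _ _).1 h2
    have : y + x = 0 := m_add_right_cancel _ _ a (by rw [add_assoc, h, zero_add])
    rw [m_add_eq_zero _ _ this, zero_add]
  le_total a b := by
    rw [ax7, ax7]; exact m_le_total a b
  toDecidableLE := Classical.decRel _

instance (M : Mod) : IsOrderedCancelAddMonoid M where
  add_le_add_left a b h c := by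
    obtain ⟨x, rfl⟩ := (ax7 M _ _).1 h
    exact (ax7 M _ _).2 ⟨x, by rw [add_assoc]⟩
  le_of_add_le_add_left a b c h := by
    obtain ⟨x, h⟩ := (ax7 M _ _).1 h
    refine (ax7 M _ _).2 ⟨x, m_add_right_cancel _ _ a ?_⟩
    rw [add_comm c, ← h, add_assoc, add_comm b]

theorem m_zero_le {M : Mod} (a : M) : 0 ≤ a := (ax7 M _ _).2 ⟨a, add_zero a⟩

instance (M : Mod) : Nontrivial M := ⟨0, 1, fun h => ax1 M 0 h.symm⟩

instance (M : Mod) : CanonicallyOrderedAdd M where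
  exists_add_of_le {a b} h := by
    obtain ⟨x, rfl⟩ := (ax7 M _ _).1 h
    exact ⟨x, add_comm _ _⟩
  le_self_add a b := (ax7 M _ _).2 ⟨b, add_comm _ _⟩
  le_add_self a b := (ax7 M _ _).2 ⟨b, rfl⟩

theorem m_lt_iff {M : Mod} (a b : M) : a < b ↔ a + 1 ≤ b := by
  constructor
  · intro h
    obtain ⟨x, rfl⟩ := (ax7 M _ _).1 h.le
    rcases m_cases x with rfl | ⟨c, rfl⟩
    · rw [zero_add] at h; exact absurd h (lt_irrefl _)
    · exact (ax7 M _ _).2 ⟨c, by ring⟩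
  · intro h
    refine lt_of_lt_of_le ?_ h
    refine lt_of_le_of_ne (le_self_add) ?_
    intro e
    have : (0:M) = 1 := add_left_cancel (a := a) (by rw [add_zero]; exact e)
    exact ax1 M 0 this.symm

instance (M : Mod) : ZeroLEOneClass M := ⟨m_zero_le _⟩

instance (M : Mod) : PosMulStrictMono M where
  mul_lt_mul_of_pos_left a ha b c h := by
    rw [m_lt_iff] at h ha
    obtain ⟨x, rfl⟩ := exists_add_of_le h
    obtain ⟨y, rfl⟩ := exists_add_of_le ha
    rw [m_lt_iff]
    refine le_iff_exists_add.2 ⟨y + x + y*x, ?_⟩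
    ring

instance (M : Mod) : IsStrictOrderedRing M where
  mul_lt_mul_of_pos_right a ha b c h := by
    rw [mul_comm b, mul_comm c]; exact mul_lt_mul_of_pos_left h ha

theorem m_lt_succ {M : Mod} (a b : M) : a < b + 1 ↔ a ≤ b := by
  rw [m_lt_iff]; exact add_le_add_iff_right 1

instance {m : ℕ} {f g : Func m} [TD f] [TD g] : D0 (fun M v => f M v < g M v) :=
  D0.congr (P := fun M v => ¬ g M v ≤ f M v) inferInstance (by intros; exact not_le.symm)

instance TD.natCast {m : ℕ} (n : ℕ) : TD (m := m) (fun _ _ => (n : _)) := by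
  induction n with
  | zero => simp only [Nat.cast_zero]; infer_instance
  | succ n ih => simp only [Nat.cast_succ]; infer_instance
instance TD.ofNat {m : ℕ} (n : ℕ) [n.AtLeastTwo] : TD (m := m) (fun _ _ => (OfNat.ofNat n : _)) :=
  TD.natCast n


instance D0.ballLt {m : ℕ} {f : Func m} {R : ∀ M : Mod, (Fin m → M) → M → Prop} [TD f]
    [D0 (m := m+1) (fun M v => R M (fun i => v i.castSucc) (v (Fin.last m)))] :
    D0 (fun M v => ∀ a, a < f M v → R M v a) := by
  have : TD (m := m+1) (fun M v => f M (fun i => v i.castSucc)) := TD.init inferInstance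
  exact D0.congr (P := fun M v => ∀ a, a ≤ f M v → a < f M v → R M v a) inferInstance
    (fun M v => ⟨fun h a _ h2 => h a h2, fun h a h2 => h a h2.le h2⟩)
instance D0.bexLt {m : ℕ} {f : Func m} {R : ∀ M : Mod, (Fin m → M) → M → Prop} [TD f]
    [D0 (m := m+1) (fun M v => R M (fun i => v i.castSucc) (v (Fin.last m)))] :
    D0 (fun M v => ∃ a, a < f M v ∧ R M v a) := by
  have : TD (m := m+1) (fun M v => f M (fun i => v i.castSucc)) := TD.init inferInstance
  exact D0.congr (P := fun M v => ∃ a, a ≤ f M v ∧ a < f M v ∧ R M v a) inferInstance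
    (fun M v => ⟨fun ⟨a, h, h2⟩ => ⟨a, h.le, h, h2⟩, fun ⟨a, _, h, h2⟩ => ⟨a, h, h2⟩⟩)


theorem D0.subst1 {P : ∀ M : Mod, M → Prop} (h : D0 (m := 1) (fun M v => P M (v 0)))
    {m : ℕ} {f : Func m} [hf : TD f] : D0 (fun M v => P M (f M v)) :=
  D0.subst h (f := ![f]) (by intro i; fin_cases i; exact hf)
theorem D0.subst2 {P : ∀ M : Mod, M → M → Prop} (h : D0 (m := 2) (fun M v => P M (v 0) (v 1)))
    {m : ℕ} {f g : Func m} [hf : TD f] [hg : TD g] : D0 (fun M v => P M (f M v) (g M v)) :=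
  D0.subst h (f := ![f, g]) (by intro i; fin_cases i; exacts [hf, hg])
theorem D0.subst3 {P : ∀ M : Mod, M → M → M → Prop}
    (h : D0 (m := 3) (fun M v => P M (v 0) (v 1) (v 2)))
    {m : ℕ} {f g k : Func m} [hf : TD f] [hg : TD g] [hk : TD k] :
    D0 (fun M v => P M (f M v) (g M v) (k M v)) :=
  D0.subst h (f := ![f, g, k]) (by intro i; fin_cases i; exacts [hf, hg, hk])

/-- substitution of the last variable -/
theorem AD.substLast {m : ℕ} {R : ∀ M : Mod, (Fin m → M) → M → Prop}
    (h : AD (m := m+1) (fun M v => R M (fun i => v i.castSucc) (v (Fin.last m))))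
    {k : ℕ} (g : Fin m → Fin k) (f : Func k) [hf : TD f] :
    AD (fun M v => R M (fun i => v (g i)) (f M v)) := by
  have := AD.subst h (f := Fin.lastCases f (fun i M v => v (g i))) (m' := k) (by
    intro i
    refine Fin.lastCases ?_ (fun i => ?_) i
    · simpa using hf
    · simpa using TD.var (g i))
  simpa using this

theorem ind' {m : ℕ} {R : ∀ M : Mod, (Fin m → M) → M → Prop}
    [h : AD (m := m+1) (fun M v => R M (fun i => v i.castSucc) (v (Fin.last m)))]
    (M : Mod) (v : Fin m → M) (h0 : R M v 0) (hs : ∀ a, R M v a → R M v (a + 1)) :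
    ∀ a, R M v a := ind M v h0 (fun a h => by rw [sc_eq]; exact hs a h)

/-- strong induction -/
theorem sind {m : ℕ} {R : ∀ M : Mod, (Fin m → M) → M → Prop}
    [h : AD (m := m+1) (fun M v => R M (fun i => v i.castSucc) (v (Fin.last m)))]
    (M : Mod) (v : Fin m → M) (hs : ∀ a, (∀ b, b < a → R M v b) → R M v a) :
    ∀ a, R M v a := by
  have : AD (m := m+1+1) (fun M v => R M (fun i => v i.castSucc.castSucc) (v (Fin.last (m+1)))) :=
    AD.substLast h (fun i => i.castSucc.castSucc) (fun _ v => v (Fin.last (m+1)))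
  have key := ind' (R := fun M v a => ∀ b, b < a → R M v b) M v
    (fun b hb => absurd hb (not_lt.2 (m_zero_le b)))
    (fun a ih b hb => by
      rcases lt_or_eq_of_le ((m_lt_succ b a).1 hb) with h | rfl
      · exact ih b h
      · exact hs _ ih)
  exact fun a => hs a (key a)

/-- least number principle -/
theorem least {m : ℕ} {R : ∀ M : Mod, (Fin m → M) → M → Prop}
    [h : AD (m := m+1) (fun M v => R M (fun i => v i.castSucc) (v (Fin.last m)))]
    (M : Mod) (v : Fin m → M) (a : M) (ha : R M v a) :
    ∃ b, b ≤ a ∧ R M v b ∧ ∀ c, c < b → ¬ R M v c := by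
  by_contra hc
  push Not at hc
  have := sind (R := fun M v a => ¬ R M v a) M v
  have key := sind (R := fun M w b => b ≤ w (Fin.last m) → ¬ R M (fun i => w i.castSucc) b)
    (h := by
      have : AD (m := m+1+1) (fun M v => R M (fun i => v i.castSucc.castSucc) (v (Fin.last (m+1)))) :=
        AD.substLast h (fun i => i.castSucc.castSucc) (fun _ v => v (Fin.last (m+1)))
      infer_instance) M (Fin.snoc v a)
  simp only [Fin.snoc_castSucc, Fin.snoc_last] at key
  refine key (fun b ih hb hR => ?_) a le_rfl ha
  obtain ⟨c, hcb, hRc⟩ := hc b hb hR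
  exact ih c hcb (hcb.le.trans hb) hRc

/-- collection -/
theorem coll {m : ℕ} {R : ∀ M : Mod, (Fin m → M) → M → M → Prop}
    (h : AD (m := m+2) (fun M v => R M (fun i => v i.castSucc.castSucc)
      (v (Fin.last m).castSucc) (v (Fin.last (m+1)))))
    (M : Mod) (v : Fin m → M) (b : M) (hR : ∀ x, x ≤ b → ∃ y, R M v x y) :
    ∃ B, ∀ x, x ≤ b → ∃ y, y ≤ B ∧ R M v x y := by
  have h' : AD (m := m+1+1+1+1+1) (fun M v => R M
      (fun i => v i.castSucc.castSucc.castSucc.castSucc.castSucc)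
      (v (Fin.last (m+3)).castSucc) (v (Fin.last (m+4)))) := by
    have := AD.subst h (m' := m+5) (f := Fin.lastCases (fun _ v => v (Fin.last (m+4)))
      (Fin.lastCases (fun _ v => v (Fin.last (m+3)).castSucc)
        (fun i _ v => v i.castSucc.castSucc.castSucc.castSucc.castSucc))) (by
      intro i
      refine Fin.lastCases ?_ (fun i => Fin.lastCases ?_ (fun i => ?_) i) i
      · simp only [Fin.lastCases_last]; infer_instance
      · simp only [Fin.lastCases_castSucc, Fin.lastCases_last]; infer_instance
      · simp only [Fin.lastCases_castSucc]; infer_instance)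
    simpa using this
  have h2 : AD (m := m+1+1) (fun M v =>
      v (Fin.last (m+1)) ≤ v (Fin.last m).castSucc → ∃ B, ∀ x, x ≤ v (Fin.last (m+1)) →
        ∃ y, y ≤ B ∧ R M (fun i => v i.castSucc.castSucc) x y) := inferInstance
  have key := ind' (R := fun M w b => b ≤ w (Fin.last m) → ∃ B, ∀ x, x ≤ b →
    ∃ y, y ≤ B ∧ R M (fun i => w i.castSucc) x y) (h := h2) M (Fin.snoc v b)
  simp only [Fin.snoc_castSucc, Fin.snoc_last] at key
  refine key ?_ ?_ b le_rfl
  · intro _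
    obtain ⟨y, hy⟩ := hR 0 (m_zero_le _)
    refine ⟨y, fun x hx => ⟨y, le_rfl, ?_⟩⟩
    rw [le_antisymm hx (m_zero_le _)]; exact hy
  · intro a ih ha
    obtain ⟨B, hB⟩ := ih (le_self_add.trans ha)
    obtain ⟨y, hy⟩ := hR _ ha
    refine ⟨B + y, fun x hx => ?_⟩
    rcases lt_or_eq_of_le hx with h | rfl
    · obtain ⟨z, hz, hzR⟩ := hB x ((m_lt_succ _ _).1 h)
      exact ⟨z, hz.trans le_self_add, hzR⟩
    · exact ⟨y, le_add_self, hy⟩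

/-- pairing -/
def pr {M : Mod} (a b : M) : M := (a + b) * (a + b) + a

instance {m : ℕ} {f g : Func m} [TD f] [TD g] : TD (fun M v => pr (f M v) (g M v)) := by
  unfold pr; infer_instance

theorem m_le_sq {M : Mod} (x : M) : x ≤ x * x := by
  rcases m_cases x with rfl | ⟨b, rfl⟩
  · simp
  · exact le_iff_exists_add.2 ⟨b * b + b, by ring⟩

theorem le_pr_left {M : Mod} (a b : M) : a ≤ pr a b := le_add_self
theorem le_pr_right {M : Mod} (a b : M) : b ≤ pr a b :=
  (le_add_self.trans (m_le_sq _)).trans le_self_add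

theorem pr_mono {M : Mod} {a b c d : M} (h : a ≤ c) (h' : b ≤ d) : pr a b ≤ pr c d := by
  unfold pr; gcongr

theorem pr_inj_aux {M : Mod} {a b c d : M} (h : a + b < c + d) : pr a b < pr c d := by
  have h1 : pr a b < (a + b + 1) * (a + b + 1) := by
    rw [m_lt_iff]; refine le_iff_exists_add.2 ⟨a + b + b, ?_⟩; unfold pr; ring
  have h2 : a + b + 1 ≤ c + d := (m_lt_iff _ _).1 h
  refine h1.trans_le ?_
  unfold pr
  calc _ ≤ (c + d) * (c + d) := by gcongr
    _ ≤ _ := le_self_add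

theorem pr_inj {M : Mod} {a b c d : M} : pr a b = pr c d ↔ a = c ∧ b = d := by
  constructor
  · intro h
    have hs : a + b = c + d := by
      rcases lt_trichotomy (a + b) (c + d) with h' | h' | h'
      · exact absurd h (pr_inj_aux h').ne
      · exact h'
      · exact absurd h (pr_inj_aux h').ne'
    unfold pr at h
    rw [hs] at h
    have : a = c := add_left_cancel h
    subst this
    exact ⟨rfl, add_left_cancel hs⟩
  · rintro ⟨rfl, rfl⟩; rfl

def dv {M : Mod} (p c : M) : Prop := ∃ q, q ≤ c ∧ c = q * p

theorem dv_iff {M : Mod} {p c : M} (hp : p ≠ 0) : dv p c ↔ p ∣ c := by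
  constructor
  · rintro ⟨q, _, rfl⟩; exact Dvd.intro_left q rfl
  · rintro ⟨q, rfl⟩
    refine ⟨q, ?_, mul_comm _ _⟩
    rcases m_cases p with rfl | ⟨b, rfl⟩
    · exact absurd rfl hp
    · exact le_iff_exists_add.2 ⟨b * q, by ring⟩

instance {m : ℕ} {f g : Func m} [TD f] [TD g] : D0 (fun M v => dv (f M v) (g M v)) :=
  D0.subst2 (P := fun M a b => dv a b) (by unfold dv; infer_instance)

/-- coded sets -/
def mem {M : Mod} (x w : M) : Prop := ∃ c, c ≤ w ∧ ∃ d, d ≤ w ∧ ∃ B, B ≤ w ∧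
  w = pr (pr c d) B ∧ x ≤ B ∧ dv (1 + (x + 1) * d) c

instance {m : ℕ} {f g : Func m} [TD f] [TD g] : D0 (fun M v => mem (f M v) (g M v)) :=
  D0.subst2 (P := fun M a b => mem a b) (by unfold mem; infer_instance)

theorem one_add_ne {M : Mod} (x : M) : 1 + x ≠ 0 := by
  rw [add_comm, ← sc_eq]; exact ax1 M x

theorem mem_pr {M : Mod} {x c d B : M} :
    mem x (pr (pr c d) B) ↔ x ≤ B ∧ (1 + (x + 1) * d) ∣ c := by
  rw [← dv_iff (one_add_ne _)]
  constructor
  · rintro ⟨c', _, d', _, B', _, h, h1, h2⟩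
    rw [pr_inj, pr_inj] at h
    obtain ⟨⟨rfl, rfl⟩, rfl⟩ := h
    exact ⟨h1, h2⟩
  · rintro ⟨h1, h2⟩
    exact ⟨c, (le_pr_left _ _).trans (le_pr_left _ _), d, (le_pr_right _ _).trans (le_pr_left _ _),
      B, le_pr_right _ _, rfl, h1, h2⟩

theorem mem_le {M : Mod} {x w : M} (h : mem x w) : x ≤ w := by
  obtain ⟨c, _, d, _, B, hB, _, h1, _⟩ := h
  exact h1.trans hB

theorem m_dvd_right {M : Mod} {p a b : M} (_ : p ≠ 0) (h : p ∣ a) (h' : p ∣ a + b) : p ∣ b := by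
  obtain ⟨x, rfl⟩ := h
  obtain ⟨y, hy⟩ := h'
  rcases le_total x y with h | h
  · obtain ⟨z, rfl⟩ := exists_add_of_le h
    rw [mul_add] at hy
    exact ⟨z, add_left_cancel hy⟩
  · obtain ⟨z, rfl⟩ := exists_add_of_le h
    rw [mul_add, add_assoc] at hy
    have : p * z + b = 0 := add_left_cancel (a := p * y) (by rw [add_zero]; exact hy)
    rw [m_add_eq_zero _ _ this]; exact dvd_zero p

theorem m_dvd_d {M : Mod} {i d x : M} (h : (1 + (i + 1) * d) ∣ x * d) : (1 + (i + 1) * d) ∣ x := by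
  refine m_dvd_right (a := (i + 1) * (x * d)) (one_add_ne _) (Dvd.dvd.mul_left h _) ⟨x, ?_⟩
  ring

theorem m_dvd_p {M : Mod} {B d i j c : M} (hd : ∀ k, k ≤ B → k ≠ 0 → k ∣ d) (hi : i ≤ B) (hj : j ≤ B)
    (hij : i ≠ j) (h : (1 + (i + 1) * d) ∣ c * (1 + (j + 1) * d)) : (1 + (i + 1) * d) ∣ c := by
  have key : ∀ k, k ≤ B → k ≠ 0 → (1 + (i + 1) * d) ∣ c * k * d → (1 + (i + 1) * d) ∣ c := by
    intro k hk hk0 h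
    have h1 := m_dvd_d h
    obtain ⟨e, he⟩ := hd k hk hk0
    refine m_dvd_d ?_
    have : c * d = c * k * e := by rw [he]; ring
    rw [this]; exact Dvd.dvd.mul_right h1 _
  rcases lt_or_gt_of_ne hij with h' | h'
  · obtain ⟨k, rfl⟩ := exists_add_of_le h'.le
    refine key k (le_add_self.trans hj) (by rintro rfl; simp at h') ?_
    refine m_dvd_right (a := (1 + (i + 1) * d) * c) (one_add_ne _) ⟨c, rfl⟩ ?_
    convert h using 1; ring
  · obtain ⟨k, rfl⟩ := exists_add_of_le h'.le
    refine key k (le_add_self.trans hi) (by rintro rfl; simp at h') ?_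
    refine m_dvd_right (a := c * (1 + (j + 1) * d)) (one_add_ne _) h ⟨c, ?_⟩
    ring

theorem m_fact {M : Mod} (B : M) : ∃ d, d ≠ 0 ∧ ∀ k, k ≤ B → k ≠ 0 → ∃ e, d = k * e := by
  refine ind' (R := fun _ _ B => ∃ d, d ≠ 0 ∧ ∀ k, k ≤ B → k ≠ 0 → ∃ e, d = k * e) M ![] ?_ ?_ B
  · exact ⟨1, one_ne_zero, fun k hk h0 => absurd (le_antisymm hk (m_zero_le _)) h0⟩
  · rintro a ⟨d, hd, h⟩
    refine ⟨d * (a + 1), ?_, fun k hk h0 => ?_⟩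
    · exact mul_ne_zero hd (by rw [add_comm]; exact one_add_ne _)
    · rcases lt_or_eq_of_le hk with h' | rfl
      · obtain ⟨e, rfl⟩ := h k ((m_lt_succ _ _).1 h') h0
        exact ⟨e * (a + 1), by ring⟩
      · exact ⟨d, mul_comm _ _⟩

/-- comprehension: bounded definable sets are coded -/
theorem compr {m : ℕ} {R : ∀ M : Mod, (Fin m → M) → M → Prop}
    (h : AD (m := m+1) (fun M v => R M (fun i => v i.castSucc) (v (Fin.last m))))
    (M : Mod) (v : Fin m → M) (B : M) : ∃ w : M, ∀ x, mem x w ↔ x ≤ B ∧ R M v x := by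
  obtain ⟨d, hd0, hd⟩ := m_fact B
  have hR : AD (m := m+2+1+1+1) (fun M v => R M
      (fun i => v i.castSucc.castSucc.castSucc.castSucc.castSucc) (v (Fin.last (m+4)))) :=
    AD.substLast h (fun i => i.castSucc.castSucc.castSucc.castSucc.castSucc) (fun _ v => v (Fin.last (m+4)))
  have h2 : AD (m := m+2+1) (fun M w =>
      ∃ c, c ≠ 0 ∧ ∀ i, i ≤ w (Fin.last m).castSucc.castSucc → ((∃ e, c = (1 + (i+1) * w (Fin.last (m+1)).castSucc) * e) ↔
      i < w (Fin.last (m+2)) ∧ R M (fun i => w i.castSucc.castSucc.castSucc) i)) := inferInstance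
  have key := ind' (R := fun M w j =>
      ∃ c, c ≠ 0 ∧ ∀ i, i ≤ w (Fin.last m).castSucc → ((∃ e, c = (1 + (i+1) * w (Fin.last (m+1))) * e) ↔
      i < j ∧ R M (fun i => w i.castSucc.castSucc) i)) (h := h2) M
      (Fin.snoc (Fin.snoc v B : Fin (m+1) → M) d)
  simp only [Fin.snoc_castSucc, Fin.snoc_last] at key
  have key2 := key ?_ ?_ (B + 1)
  · obtain ⟨c, _, hc⟩ := key2
    refine ⟨pr (pr c d) B, fun x => ?_⟩
    rw [mem_pr]
    refine and_congr_right fun hx => (hc x hx).trans ?_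
    rw [m_lt_succ]
    exact and_iff_right hx
  · refine ⟨1, one_ne_zero, fun i _ => ⟨?_, fun h => absurd h.1 (not_lt.2 (m_zero_le _))⟩⟩
    rintro ⟨e, he⟩
    exfalso
    rcases m_cases e with rfl | ⟨e, rfl⟩
    · simp at he
    · rcases m_cases d with rfl | ⟨d, rfl⟩
      · exact hd0 rfl
      · have : (1:M) < (1 + (i+1) * (d+1)) * (e+1) := by
          rw [m_lt_iff]; refine le_iff_exists_add.2 ⟨i + d + i * d + (1 + (i+1) * (d+1)) * e, by ring⟩
        exact absurd he this.ne
  · rintro j ⟨c, hc0, hc⟩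
    by_cases hj' : R M v j ∧ j ≤ B
    · obtain ⟨hj, hjB⟩ := hj'
      refine ⟨c * (1 + (j+1) * d), mul_ne_zero hc0 (one_add_ne _), fun i hi => ?_⟩
      by_cases hij : i = j
      · subst hij
        exact ⟨fun _ => ⟨(m_lt_succ _ _).2 le_rfl, hj⟩, fun _ => ⟨c, mul_comm _ _⟩⟩
      · rw [m_lt_succ, le_iff_lt_or_eq, or_iff_left hij, ← hc i hi]
        exact ⟨fun h => m_dvd_p hd hi hjB hij h, fun h => Dvd.dvd.mul_right h _⟩
    · refine ⟨c, hc0, fun i hi => (hc i hi).trans ?_⟩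
      rw [m_lt_succ, le_iff_lt_or_eq]
      constructor
      · rintro ⟨h, h'⟩; exact ⟨Or.inl h, h'⟩
      · rintro ⟨h | rfl, h'⟩
        · exact ⟨h, h'⟩
        · exact absurd ⟨h', hi⟩ hj'



theorem snoc_last_eq {α : Type*} {m : ℕ} (v : Fin (m+1) → α) :
    (Fin.snoc (fun i => v i.castSucc) (v (Fin.last m)) : Fin (m+1) → α) = v := by
  funext i
  refine Fin.lastCases ?_ (fun i => ?_) i <;> simp

/-- semantic `Σ_n` predicates -/
def SDef : ℕ → ∀ m : ℕ, Pred m → Prop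
  | 0, _, P => D0 P
  | n+1, m, P => ∃ R : ∀ M : Mod, (Fin m → M) → M → Prop,
      SDef n (m+1) (fun M v => ¬ R M (fun i => v i.castSucc) (v (Fin.last m))) ∧
      ∀ M v, P M v ↔ ∃ a, R M v a

class S (n : ℕ) {m : ℕ} (P : Pred m) : Prop where
  out : SDef n m P
class Pi (n : ℕ) {m : ℕ} (P : Pred m) : Prop where
  out : SDef n m (fun M v => ¬ P M v)

theorem S.congr {n m : ℕ} {P Q : Pred m} (h : S n P) (e : ∀ M v, Q M v ↔ P M v) : S n Q := by
  have : Q = P := by funext M v; exact propext (e M v)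
  rw [this]; exact h
theorem Pi.congr {n m : ℕ} {P Q : Pred m} (h : Pi n P) (e : ∀ M v, Q M v ↔ P M v) : Pi n Q := by
  have : Q = P := by funext M v; exact propext (e M v)
  rw [this]; exact h

/-- closure properties of a level -/
class Clo (n : ℕ) : Prop where
  and : ∀ {m : ℕ} {P Q : Pred m}, S n P → S n Q → S n (fun M v => P M v ∧ Q M v)
  or : ∀ {m : ℕ} {P Q : Pred m}, S n P → S n Q → S n (fun M v => P M v ∨ Q M v)
  ball : ∀ {m : ℕ} {f : Func m} {R : ∀ M : Mod, (Fin m → M) → M → Prop}, TD f →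
    S n (m := m+1) (fun M v => R M (fun i => v i.castSucc) (v (Fin.last m))) →
    S n (fun M v => ∀ a, a ≤ f M v → R M v a)
  bex : ∀ {m : ℕ} {f : Func m} {R : ∀ M : Mod, (Fin m → M) → M → Prop}, TD f →
    S n (m := m+1) (fun M v => R M (fun i => v i.castSucc) (v (Fin.last m))) →
    S n (fun M v => ∃ a, a ≤ f M v ∧ R M v a)
  subst : ∀ {m m' : ℕ} {P : Pred m} {f : Fin m → Func m'}, S n P → (∀ i, TD (f i)) →
    S n (fun M v => P M (fun i => f i M v))
  ad : ∀ {m : ℕ} {P : Pred m}, S n P → AD P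
  ofD0 : ∀ {m : ℕ} {P : Pred m}, D0 P → S n P


section inst0
variable {n m : ℕ} {P Q : Pred m}
instance S.not [h : Pi n P] : S n (fun M v => ¬ P M v) := ⟨h.out⟩
instance Pi.not [h : S n P] : Pi n (fun M v => ¬ P M v) :=
  ⟨(h.congr (by intros; exact not_not)).out⟩
theorem Pi.of (h : S n (fun M v => ¬ P M v)) : Pi n P := ⟨h.out⟩
theorem Pi.ne (h : Pi n P) : S n (fun M v => ¬ P M v) := ⟨h.out⟩
end inst0
section inst
variable {n m : ℕ} [Clo n] {P Q : Pred m} {f : Func m} {R : ∀ M : Mod, (Fin m → M) → M → Prop}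
instance S.and [S n P] [S n Q] : S n (fun M v => P M v ∧ Q M v) := Clo.and ‹_› ‹_›
instance S.or [S n P] [S n Q] : S n (fun M v => P M v ∨ Q M v) := Clo.or ‹_› ‹_›
instance Pi.and [Pi n P] [Pi n Q] : Pi n (fun M v => P M v ∧ Q M v) :=
  Pi.of (S.congr (P := fun M v => ¬ P M v ∨ ¬ Q M v) inferInstance (by intros; tauto))
instance Pi.or [Pi n P] [Pi n Q] : Pi n (fun M v => P M v ∨ Q M v) :=
  Pi.of (S.congr (P := fun M v => ¬ P M v ∧ ¬ Q M v) inferInstance (by intros; tauto))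
instance S.imp [Pi n P] [S n Q] : S n (fun M v => P M v → Q M v) :=
  S.congr (P := fun M v => ¬ P M v ∨ Q M v) inferInstance (by intros; tauto)
instance Pi.imp [S n P] [Pi n Q] : Pi n (fun M v => P M v → Q M v) :=
  Pi.congr (P := fun M v => ¬ P M v ∨ Q M v) inferInstance (by intros; tauto)
instance S.ball [TD f] [S n (m := m+1) (fun M v => R M (fun i => v i.castSucc) (v (Fin.last m)))] :
    S n (fun M v => ∀ a, a ≤ f M v → R M v a) := Clo.ball ‹_› ‹_›
instance S.bex [TD f] [S n (m := m+1) (fun M v => R M (fun i => v i.castSucc) (v (Fin.last m)))] :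
    S n (fun M v => ∃ a, a ≤ f M v ∧ R M v a) := Clo.bex ‹_› ‹_›
instance Pi.ball [TD f] [h : Pi n (m := m+1) (fun M v => R M (fun i => v i.castSucc) (v (Fin.last m)))] :
    Pi n (fun M v => ∀ a, a ≤ f M v → R M v a) :=
  Pi.of (S.congr (P := fun M v => ∃ a, a ≤ f M v ∧ ¬ R M v a)
    (Clo.bex (R := fun M v a => ¬ R M v a) ‹_› h.ne) (by intros; push Not; rfl))
instance Pi.bex [TD f] [h : Pi n (m := m+1) (fun M v => R M (fun i => v i.castSucc) (v (Fin.last m)))] :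
    Pi n (fun M v => ∃ a, a ≤ f M v ∧ R M v a) :=
  Pi.of (S.congr (P := fun M v => ∀ a, a ≤ f M v → ¬ R M v a)
    (Clo.ball (R := fun M v a => ¬ R M v a) ‹_› h.ne) (by intros; push Not; rfl))
instance (priority := 50) S.ofD0 [D0 P] : S n P := Clo.ofD0 ‹_›
instance (priority := 50) Pi.ofD0 [D0 P] : Pi n P := Pi.of (Clo.ofD0 inferInstance)
theorem S.subst {m' : ℕ} {f : Fin m → Func m'} (h : S n P) (hf : ∀ i, TD (f i)) :
    S n (fun M v => P M (fun i => f i M v)) := Clo.subst h hf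
theorem Pi.subst {m' : ℕ} {f : Fin m → Func m'} (h : Pi n P) (hf : ∀ i, TD (f i)) :
    Pi n (fun M v => P M (fun i => f i M v)) := Pi.of (Clo.subst h.ne hf)
theorem Pi.substLast
    (h : Pi n (m := m+1) (fun M v => R M (fun i => v i.castSucc) (v (Fin.last m))))
    {k : ℕ} (g : Fin m → Fin k) (f : Func k) [hf : TD f] :
    Pi n (fun M v => R M (fun i => v (g i)) (f M v)) := by
  have := Pi.subst h (f := Fin.lastCases f (fun i M v => v (g i))) (m' := k) (by
    intro i
    refine Fin.lastCases ?_ (fun i => ?_) i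
    · simpa using hf
    · simpa using TD.var (g i))
  simpa using this
theorem Pi.substLast2 {R : ∀ M : Mod, (Fin m → M) → M → M → Prop}
    (h : Pi n (m := m+2) (fun M v => R M (fun i => v i.castSucc.castSucc) (v (Fin.last m).castSucc)
      (v (Fin.last (m+1)))))
    {k : ℕ} (g : Fin m → Fin k) (f f' : Func k) [hf : TD f] [hf' : TD f'] :
    Pi n (fun M v => R M (fun i => v (g i)) (f M v) (f' M v)) := by
  have := Pi.subst h (f := Fin.lastCases f' (Fin.lastCases f (fun i M v => v (g i)))) (m' := k) (by
    intro i
    refine Fin.lastCases ?_ (fun i => Fin.lastCases ?_ (fun i => ?_) i) i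
    · simpa using hf'
    · simpa using hf
    · simpa using TD.var (g i))
  simpa using this
theorem S.ad (h : S n P) : AD P := Clo.ad h
theorem Pi.ad (h : Pi n P) : AD P := by
  have := Clo.ad h.ne
  exact AD.congr (P := fun M v => ¬ ¬ P M v) inferInstance (by intros; exact not_not.symm)
end inst

instance Clo.zero : Clo 0 where
  and {m P Q} h h' := by
    have : D0 P := h.out
    have : D0 Q := h'.out
    exact ⟨(inferInstance : D0 _)⟩
  or {m P Q} h h' := by
    have : D0 P := h.out
    have : D0 Q := h'.out
    exact ⟨(inferInstance : D0 _)⟩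
  ball {m f R} hf h := by
    have h := h.out
    simp only [SDef] at h
    exact ⟨(inferInstance : D0 _)⟩
  bex {m f R} hf h := by
    have h := h.out
    simp only [SDef] at h
    exact ⟨(inferInstance : D0 _)⟩
  subst {m m' P f} h hf := ⟨D0.subst h.out hf⟩
  ad {m P} h := by
    have : D0 P := h.out
    infer_instance
  ofD0 h := ⟨h⟩

theorem S.exPi {n m : ℕ} {R : ∀ M : Mod, (Fin m → M) → M → Prop}
    (h : Pi n (m := m+1) (fun M v => R M (fun i => v i.castSucc) (v (Fin.last m)))) :
    S (n+1) (fun M v => ∃ a, R M v a) := ⟨⟨R, h.out, fun _ _ => Iff.rfl⟩⟩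

theorem S.elim {n m : ℕ} {P : Pred m} (h : S (n+1) P) :
    ∃ R : ∀ M : Mod, (Fin m → M) → M → Prop,
      Pi n (m := m+1) (fun M v => R M (fun i => v i.castSucc) (v (Fin.last m))) ∧
      P = fun M v => ∃ a, R M v a := by
  obtain ⟨R, h, e⟩ := h.out
  exact ⟨R, ⟨h⟩, by funext M v; exact propext (e M v)⟩

theorem S.ex_aux {n m : ℕ} [Clo n] {R : ∀ M : Mod, (Fin m → M) → M → Prop}
    (h : S (n+1) (m := m+1) (fun M v => R M (fun i => v i.castSucc) (v (Fin.last m)))) :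
    S (n+1) (fun M v => ∃ a, R M v a) := by
  obtain ⟨Q, hQ, e⟩ := h.elim
  have e : ∀ (M : Mod) v a, R M v a ↔ ∃ b, Q M (Fin.snoc v a) b := by
    intro M v a
    have := congrFun (congrFun e M) (Fin.snoc v a)
    simpa using this
  have e2 : ∀ (M : Mod) v, (∃ a, R M v a) ↔ ∃ w, ∃ a, a ≤ w ∧ ∃ b, b ≤ w ∧ Q M (Fin.snoc v a) b := by
    intro M v
    simp only [e]
    constructor
    · rintro ⟨a, b, h⟩
      exact ⟨a + b, a, le_self_add, b, le_add_self, h⟩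
    · rintro ⟨_, a, _, b, _, h⟩
      exact ⟨a, b, h⟩
  have hQ' : Pi n (m := m+1+1+1) (fun M v => Q M
      (Fin.snoc (fun i => v i.castSucc.castSucc.castSucc) (v (Fin.last (m+1)).castSucc))
      (v (Fin.last (m+2)))) := by
    refine Pi.substLast2 (R := fun M v a b => Q M (Fin.snoc v a) b) ?_
      (fun i => i.castSucc.castSucc.castSucc) (fun _ v => v (Fin.last (m+1)).castSucc)
      (fun _ v => v (Fin.last (m+2)))
    exact Pi.congr hQ (fun M v => iff_of_eq (congrArg (fun x => Q M x _)
      (snoc_last_eq (fun i => v i.castSucc))))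
  refine S.congr (S.exPi (R := fun M v w => ∃ a, a ≤ w ∧ ∃ b, b ≤ w ∧ Q M (Fin.snoc v a) b)
    inferInstance) e2

theorem Clo.succ (n : ℕ) [Clo n] : Clo (n+1) where
  and {m P Q} h h' := by
    obtain ⟨A, hA, rfl⟩ := h.elim
    obtain ⟨B, hB, rfl⟩ := h'.elim
    have hA' : Pi n (m := m+1+1) (fun M v => A M (fun i => v i.castSucc.castSucc) (v (Fin.last _))) :=
      Pi.substLast hA (fun i => i.castSucc.castSucc) (fun _ v => v (Fin.last _))
    have hB' : Pi n (m := m+1+1) (fun M v => B M (fun i => v i.castSucc.castSucc) (v (Fin.last _))) :=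
      Pi.substLast hB (fun i => i.castSucc.castSucc) (fun _ v => v (Fin.last _))
    refine S.congr (S.exPi (R := fun M v w => (∃ a, a ≤ w ∧ A M v a) ∧ (∃ a, a ≤ w ∧ B M v a))
      inferInstance) (fun M v => ?_)
    constructor
    · rintro ⟨⟨a, ha⟩, ⟨b, hb⟩⟩
      exact ⟨a + b, ⟨a, le_self_add, ha⟩, ⟨b, le_add_self, hb⟩⟩
    · rintro ⟨_, ⟨a, _, ha⟩, ⟨b, _, hb⟩⟩
      exact ⟨⟨a, ha⟩, ⟨b, hb⟩⟩
  or {m P Q} h h' := by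
    obtain ⟨A, hA, rfl⟩ := h.elim
    obtain ⟨B, hB, rfl⟩ := h'.elim
    exact S.congr (S.exPi (R := fun M v w => A M v w ∨ B M v w)
      inferInstance) (fun M v => exists_or.symm)
  ball {m f R} hf h := by
    obtain ⟨Q, hQ, e⟩ := h.elim
    have e : ∀ (M : Mod) v a, R M v a ↔ ∃ b, Q M (Fin.snoc v a) b := by
      intro M v a
      have := congrFun (congrFun e M) (Fin.snoc v a)
      simpa using this
    have hQ0 : Pi n (m := m+2) (fun M v => Q M (Fin.snoc (fun i => v i.castSucc.castSucc)
        (v (Fin.last m).castSucc)) (v (Fin.last (m+1)))) := by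
      exact Pi.congr hQ (fun M v => iff_of_eq (congrArg (fun x => Q M x _)
        (snoc_last_eq (fun i => v i.castSucc))))
    have hQ' : Pi n (m := m+1+1+1) (fun M v => Q M
        (Fin.snoc (fun i => v i.castSucc.castSucc.castSucc) (v (Fin.last (m+1)).castSucc))
        (v (Fin.last (m+2)))) :=
      Pi.substLast2 (R := fun M v a b => Q M (Fin.snoc v a) b) hQ0
        (fun i => i.castSucc.castSucc.castSucc) (fun _ v => v (Fin.last (m+1)).castSucc)
        (fun _ v => v (Fin.last (m+2)))
    have := TD.init hf
    refine S.congr (S.exPi (R := fun M v w => ∀ a, a ≤ f M v → ∃ b, b ≤ w ∧ Q M (Fin.snoc v a) b)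
      inferInstance) (fun M v => ?_)
    simp only [e]
    constructor
    · intro h
      exact coll (R := fun M v a b => Q M (Fin.snoc v a) b) hQ0.ad M v _ h
    · rintro ⟨w, h⟩ a ha
      obtain ⟨b, _, hb⟩ := h a ha
      exact ⟨b, hb⟩
  bex {m f R} hf h := by
    obtain ⟨Q, hQ, e⟩ := h.elim
    have e : ∀ (M : Mod) v a, R M v a ↔ ∃ b, Q M (Fin.snoc v a) b := by
      intro M v a
      have := congrFun (congrFun e M) (Fin.snoc v a)
      simpa using this
    have hQ0 : Pi n (m := m+2) (fun M v => Q M (Fin.snoc (fun i => v i.castSucc.castSucc)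
        (v (Fin.last m).castSucc)) (v (Fin.last (m+1)))) := by
      exact Pi.congr hQ (fun M v => iff_of_eq (congrArg (fun x => Q M x _)
        (snoc_last_eq (fun i => v i.castSucc))))
    have hQ' : Pi n (m := m+1+1) (fun M v => Q M
        (Fin.snoc (fun i => v i.castSucc.castSucc) (v (Fin.last (m+1))))
        (v (Fin.last m).castSucc)) :=
      Pi.substLast2 (R := fun M v a b => Q M (Fin.snoc v a) b) hQ0
        (fun i => i.castSucc.castSucc) (fun _ v => v (Fin.last (m+1)))
        (fun _ v => v (Fin.last m).castSucc)
    have := TD.init hf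
    refine S.congr (S.exPi (R := fun M v b => ∃ a, a ≤ f M v ∧ Q M (Fin.snoc v a) b)
      inferInstance) (fun M v => ?_)
    simp only [e]
    constructor
    · rintro ⟨a, h, b, h'⟩; exact ⟨b, a, h, h'⟩
    · rintro ⟨b, a, h, h'⟩; exact ⟨a, h, b, h'⟩
  subst {m m' P f} h hf := by
    obtain ⟨R, hR, rfl⟩ := h.elim
    refine S.exPi (R := fun M v a => R M (fun i => f i M v) a) ?_
    have := Pi.subst hR (m' := m'+1) (f := Fin.lastCases (fun _ v => v (Fin.last m'))
      (fun i M v => f i M (fun i => v i.castSucc))) (by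
        intro i
        refine Fin.lastCases ?_ (fun i => ?_) i
        · simpa using TD.var _
        · simpa using TD.init (hf i))
    simpa using this
  ad {m P} h := by
    obtain ⟨R, hR, rfl⟩ := h.elim
    have := hR.ad
    infer_instance
  ofD0 {m P} h := by
    have h' : Pi n P := inferInstance
    refine S.congr (S.exPi (R := fun M v _ => P M v) ?_) (fun M v => by simp)
    exact Pi.subst h' (f := fun i M v => v i.castSucc) inferInstance

instance Clo.all : ∀ n, Clo n
  | 0 => Clo.zero
  | n+1 => @Clo.succ n (Clo.all n)

instance S.ex {n m : ℕ} {R : ∀ M : Mod, (Fin m → M) → M → Prop}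
    [h : S (n+1) (m := m+1) (fun M v => R M (fun i => v i.castSucc) (v (Fin.last m)))] :
    S (n+1) (fun M v => ∃ a, R M v a) := S.ex_aux h

instance Pi.all {n m : ℕ} {R : ∀ M : Mod, (Fin m → M) → M → Prop}
    [h : Pi (n+1) (m := m+1) (fun M v => R M (fun i => v i.castSucc) (v (Fin.last m)))] :
    Pi (n+1) (fun M v => ∀ a, R M v a) :=
  Pi.of (S.congr (S.ex (R := fun M v a => ¬ R M v a) (h := h.ne))
    (by intros; push Not; rfl))

theorem S.ofPi {n m : ℕ} {P : Pred m} (h : Pi n P) : S (n+1) P := by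
  refine S.congr (S.exPi (R := fun M v _ => P M v) ?_) (fun M v => by simp)
  exact Pi.subst h (f := fun i M v => v i.castSucc) inferInstance
theorem Pi.ofS {n m : ℕ} {P : Pred m} (h : S n P) : Pi (n+1) P :=
  Pi.of (S.ofPi (inferInstance : Pi n _))

/-- the predicate defined by a formula -/
def den {m : ℕ} (φ : LA.BoundedFormula Empty m) : Pred m := fun _ v => φ.Realize default v

theorem den_ex {m : ℕ} (φ : LA.BoundedFormula Empty (m+1)) :
    den (∃' φ) = fun M v => ∃ a, den φ M (Fin.snoc v a) := by
  funext M v; exact propext (BoundedFormula.realize_ex)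
theorem den_all {m : ℕ} (φ : LA.BoundedFormula Empty (m+1)) :
    den (∀' φ) = fun M v => ∀ a, den φ M (Fin.snoc v a) := by
  funext M v; exact propext (BoundedFormula.realize_all)
theorem IsSigmaFml.S {n m : ℕ} {φ : LA.BoundedFormula Empty m} (h : IsSigmaFml n φ) :
    S n (den φ) := by
  refine IsSigmaFml.rec (motive_1 := fun n m φ _ => Guaspari.S n (den φ))
    (motive_2 := fun n m φ _ => Guaspari.Pi n (den φ)) ?_ ?_ ?_ ?_ ?_ ?_ h
  · intro m φ h; exact ⟨⟨φ, h, fun _ _ => Iff.rfl⟩⟩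
  · intro k m φ _ h; exact S.ofPi h
  · intro k m φ _ h
    rw [den_ex]
    exact S.ex (h := by simpa only [snoc_last_eq] using h)
  · intro m φ h
    have : D0 (den φ) := ⟨φ, h, fun _ _ => Iff.rfl⟩
    infer_instance
  · intro k m φ _ h; exact Pi.ofS h
  · intro k m φ _ h
    rw [den_all]
    exact Pi.all (h := by simpa only [snoc_last_eq] using h)

theorem S.fml {n : ℕ} : ∀ {m : ℕ} {P : Pred m}, S n P →
    (∃ φ : LA.BoundedFormula Empty m, IsSigmaFml n φ ∧ den φ = P) ∧
    (∃ φ : LA.BoundedFormula Empty m, IsPiFml n φ ∧ den φ = fun M v => ¬ P M v) := by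
  induction n with
  | zero =>
    intro m P h
    obtain ⟨φ, h', e⟩ := h.out.out
    have e : den φ = P := by funext M v; exact propext (e M v)
    subst e
    exact ⟨⟨φ, .ofDelta0 h', rfl⟩, ⟨φ ⟹ ⊥, .ofDelta0 (.imp h' .falsum), rfl⟩⟩
  | succ n ih =>
    intro m P h
    obtain ⟨R, hR, rfl⟩ := h.elim
    obtain ⟨⟨φ, h1, e1⟩, ⟨ψ, h2, e2⟩⟩ := ih hR.ne
    refine ⟨⟨∃' ψ, .ex (.ofPi h2), ?_⟩, ⟨∀' φ, .all (.ofSigma h1), ?_⟩⟩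
    · rw [den_ex, e2]; funext M v; simp
    · rw [den_all, e1]; funext M v; simp



/-- one-step justification of a (code, environment) pair, from a set `X` -/
def J {M : Mod} (k e : M) (X : M → Prop) : Prop :=
  (∃ a b, k = pr 1 (pr a b) ∧ X (pr a e) ∧ X (pr b e)) ∨
  (∃ a b, k = pr 2 (pr a b) ∧ (X (pr a e) ∨ X (pr b e))) ∨
  (∃ a x, k = pr 3 a ∧ X (pr a (pr e x))) ∨
  (∃ a f b, k = pr 4 a ∧ e = pr f b ∧ ∀ x, x ≤ b → X (pr a (pr e x))) ∨
  (∃ a f y x, k = pr 5 a ∧ e = pr (pr f y) x ∧ X (pr a (pr f x))) ∨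
  (∃ f x, k = pr 6 0 ∧ e = pr (pr f x) x) ∨
  (∃ f, k = pr 7 0 ∧ e = pr f 0) ∨
  (∃ f x, k = pr 8 0 ∧ e = pr (pr f (x + 1)) x) ∨
  (∃ f x y, k = pr 9 0 ∧ e = pr (pr (pr f (x + y)) x) y) ∨
  (∃ f x y, k = pr 10 0 ∧ e = pr (pr (pr f (x * y)) x) y) ∨
  (∃ f x y, k = pr 11 0 ∧ e = pr (pr f x) y ∧ x ≤ y) ∨
  (∃ f x y, k = pr 12 0 ∧ e = pr (pr f x) y ∧ x < y)

theorem J.mono {M : Mod} {k e : M} {X Y : M → Prop} (h : ∀ x, X x → Y x) (hJ : J k e X) :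
    J k e Y := by
  rcases hJ with ⟨a, b, h1, h2, h3⟩ | ⟨a, b, h1, h2⟩ | ⟨a, x, h1, h2⟩ | ⟨a, f, b, h1, h2, h3⟩ |
    ⟨a, f, y, x, h1, h2, h3⟩ | h'
  · exact Or.inl ⟨a, b, h1, h _ h2, h _ h3⟩
  · exact Or.inr (Or.inl ⟨a, b, h1, h2.imp (h _) (h _)⟩)
  · exact Or.inr (Or.inr (Or.inl ⟨a, x, h1, h _ h2⟩))
  · exact Or.inr (Or.inr (Or.inr (Or.inl ⟨a, f, b, h1, h2, fun x hx => h _ (h3 x hx)⟩)))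
  · exact Or.inr (Or.inr (Or.inr (Or.inr (Or.inl ⟨a, f, y, x, h1, h2, h _ h3⟩))))
  · exact Or.inr (Or.inr (Or.inr (Or.inr (Or.inr h'))))

def jst {M : Mod} (w : M) : Prop :=
  ∀ k, k ≤ w → ∀ e, e ≤ w → mem (pr k e) w → J k e (fun x => mem x w)

/-- truth for (codes of) positive formulas -/
def T {M : Mod} (z : M) : Prop := ∃ w, jst w ∧ mem z w

def TB {M : Mod} (B z : M) : Prop := ∃ w, w ≤ B ∧ jst w ∧ mem z w

set_option synthInstance.maxHeartbeats 400000 in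
set_option synthInstance.maxSize 2000 in
instance S_jst {n : ℕ} : S (n + 1) (m := 1) (fun _ v => jst (v 0)) := by
  unfold jst J
  beta_reduce
  exact S.ball (f := fun M v => v 0)
theorem S.subst1 {n : ℕ} {P : ∀ M : Mod, M → Prop} (h : S n (m := 1) (fun M v => P M (v 0)))
    {m : ℕ} (f : Func m) [hf : TD f] : S n (fun M v => P M (f M v)) :=
  S.subst h (f := ![f]) (by intro i; fin_cases i; exact hf)
theorem S.subst2 {n : ℕ} {P : ∀ M : Mod, M → M → Prop}
    (h : S n (m := 2) (fun M v => P M (v 0) (v 1)))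
    {m : ℕ} (f g : Func m) [hf : TD f] [hg : TD g] : S n (fun M v => P M (f M v) (g M v)) :=
  S.subst h (f := ![f, g]) (by intro i; fin_cases i; exacts [hf, hg])
instance {n m : ℕ} {f : Func m} [TD f] : S (n + 1) (fun M v => jst (f M v)) :=
  S.subst1 (P := fun _ x => jst x) S_jst f
instance {m : ℕ} {f : Func m} [TD f] : AD (fun M v => jst (f M v)) :=
  S.ad (n := 0 + 1) inferInstance
instance {n m : ℕ} {f : Func m} [TD f] : S (n + 1) (fun M v => T (f M v)) :=
  S.subst1 (P := fun _ x => T x) (S.ex (n := n) (R := fun M v w => jst w ∧ mem (v 0) w)) f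

theorem jst.T {M : Mod} {w : M} (h : jst w) {k e : M} (hm : mem (pr k e) w) : J k e T :=
  (h k ((le_pr_left _ _).trans (mem_le hm)) e ((le_pr_right _ _).trans (mem_le hm)) hm).mono
    (fun _ hx => ⟨w, h, hx⟩)

theorem TB.mono {M : Mod} {B B' z : M} (h : B ≤ B') (hz : TB B z) : TB B' z := by
  obtain ⟨w, hw, h'⟩ := hz; exact ⟨w, hw.trans h, h'⟩

theorem T.toTB {M : Mod} {z : M} (h : Guaspari.T z) : ∃ B, TB B z := by
  obtain ⟨w, hw⟩ := h; exact ⟨w, w, le_rfl, hw⟩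

theorem T_of_JB {M : Mod} {B k e : M} (h : J k e (TB B)) : T (pr k e) := by
  obtain ⟨w, hw⟩ := compr (R := fun (M : Mod) (v : Fin 2 → M) x =>
    (∃ w, w ≤ v 0 ∧ jst w ∧ mem x w) ∨ x = v 1) inferInstance M ![B, pr k e] (B + pr k e)
  have hw1 : ∀ z, TB B z → mem z w := by
    intro z hz
    rw [hw]
    refine ⟨?_, Or.inl hz⟩
    obtain ⟨w', h1, _, h2⟩ := hz
    exact ((mem_le h2).trans h1).trans le_self_add
  refine ⟨w, ?_, (hw _).2 ⟨le_add_self, Or.inr rfl⟩⟩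
  intro k' _ e' _ hm
  rcases ((hw _).1 hm).2 with ⟨w', h1, h2, h3⟩ | h'
  · exact (h2 k' ((le_pr_left _ _).trans (mem_le h3)) e'
      ((le_pr_right _ _).trans (mem_le h3)) h3).mono (fun x hx => hw1 x ⟨w', h1, h2, hx⟩)
  · change pr k' e' = pr k e at h'
    obtain ⟨rfl, rfl⟩ := pr_inj.1 h'
    exact h.mono hw1

theorem T_iff {M : Mod} {k e : M} : T (pr k e) ↔ J k e T := by
  constructor
  · rintro ⟨w, hw, hm⟩; exact hw.T hm
  · intro hJ
    suffices ∃ B, J k e (TB B) by obtain ⟨B, hB⟩ := this; exact T_of_JB hB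
    rcases hJ with ⟨a, b, h1, h2, h3⟩ | ⟨a, b, h1, h2⟩ | ⟨a, x, h1, h2⟩ | ⟨a, f, b, h1, h2, h3⟩ |
      ⟨a, f, y, x, h1, h2, h3⟩ | h'
    · obtain ⟨B, h2⟩ := h2.toTB
      obtain ⟨B', h3⟩ := h3.toTB
      exact ⟨B + B', Or.inl ⟨a, b, h1, h2.mono le_self_add, h3.mono le_add_self⟩⟩
    · rcases h2 with h2 | h2
      · obtain ⟨B, h2⟩ := h2.toTB
        exact ⟨B, Or.inr (Or.inl ⟨a, b, h1, Or.inl h2⟩)⟩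
      · obtain ⟨B, h2⟩ := h2.toTB
        exact ⟨B, Or.inr (Or.inl ⟨a, b, h1, Or.inr h2⟩)⟩
    · obtain ⟨B, h2⟩ := h2.toTB
      exact ⟨B, Or.inr (Or.inr (Or.inl ⟨a, x, h1, h2⟩))⟩
    · obtain ⟨B, hB⟩ := coll (m := 2) (R := fun M v x w => jst w ∧ mem (pr (v 0) (pr (v 1) x)) w)
        inferInstance M ![a, e] b h3
      exact ⟨B, Or.inr (Or.inr (Or.inr (Or.inl ⟨a, f, b, h1, h2, hB⟩)))⟩
    · obtain ⟨B, h3⟩ := h3.toTB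
      exact ⟨B, Or.inr (Or.inr (Or.inr (Or.inr (Or.inl ⟨a, f, y, x, h1, h2, h3⟩))))⟩
    · exact ⟨0, Or.inr (Or.inr (Or.inr (Or.inr (Or.inr h'))))⟩

section codes
variable {M : Mod} {a b e f x y z : M}
theorem T1 : T (pr (pr 1 (pr a b)) e) ↔ T (pr a e) ∧ T (pr b e) := by
  rw [T_iff]; simp [J, pr_inj, ← and_assoc]
theorem T2 : T (pr (pr 2 (pr a b)) e) ↔ T (pr a e) ∨ T (pr b e) := by
  rw [T_iff]; simp [J, pr_inj, ← and_assoc]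
theorem T3 : T (pr (pr 3 a) e) ↔ ∃ x, T (pr a (pr e x)) := by
  rw [T_iff]; simp [J, pr_inj, ← and_assoc]
theorem T4 : T (pr (pr 4 a) (pr f b)) ↔ ∀ x, x ≤ b → T (pr a (pr (pr f b) x)) := by
  rw [T_iff]; simp [J, pr_inj, ← and_assoc]
theorem T5 : T (pr (pr 5 a) (pr (pr f y) x)) ↔ T (pr a (pr f x)) := by
  rw [T_iff]; simp [J, pr_inj, ← and_assoc]
theorem T6 : T (pr (pr 6 0) (pr (pr f y) x)) ↔ y = x := by
  rw [T_iff]; simp [J, pr_inj, ← and_assoc]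
theorem T7 : T (pr (pr 7 0) (pr f x)) ↔ x = 0 := by
  rw [T_iff]; simp [J, pr_inj, ← and_assoc]
theorem T8 : T (pr (pr 8 0) (pr (pr f y) x)) ↔ y = x + 1 := by
  rw [T_iff]; simp [J, pr_inj, ← and_assoc]
theorem T9 : T (pr (pr 9 0) (pr (pr (pr f z) x) y)) ↔ z = x + y := by
  rw [T_iff]; simp [J, pr_inj, ← and_assoc]
theorem T10 : T (pr (pr 10 0) (pr (pr (pr f z) x) y)) ↔ z = x * y := by
  rw [T_iff]; simp [J, pr_inj, ← and_assoc]
theorem T11 : T (pr (pr 11 0) (pr (pr f x) y)) ↔ x ≤ y := by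
  rw [T_iff]; simp [J, pr_inj, ← and_assoc]
theorem T12 : T (pr (pr 12 0) (pr (pr f x) y)) ↔ x < y := by
  rw [T_iff]; simp [J, pr_inj, ← and_assoc]
end codes


theorem T13 {M : Mod} {e : M} : ¬ T (pr (pr 13 0) e) := by
  rw [T_iff]; simp [J, pr_inj]

def prN (a b : ℕ) : ℕ := (a + b) * (a + b) + a
theorem cast_prN {M : Mod} (a b : ℕ) : ((prN a b : ℕ) : M) = pr (a : M) (b : M) := by
  unfold prN pr; push_cast; rfl

/-- code of an environment -/
def env {M : Mod} : ∀ {m : ℕ}, (Fin m → M) → M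
  | 0, _ => 0
  | m+1, v => pr (env (fun i : Fin m => v i.castSucc)) (v (Fin.last m))

theorem env_succ {M : Mod} {m : ℕ} (v : Fin (m+1) → M) :
  env v = pr (env (fun i : Fin m => v i.castSucc)) (v (Fin.last m)) := rfl
theorem env_snoc {M : Mod} {m : ℕ} (v : Fin m → M) (a : M) :
    env (Fin.snoc v a : Fin (m+1) → M) = pr (env v) a := by
  rw [env_succ]; simp

def Rep {m : ℕ} (P : Pred m) : Prop := ∃ k : ℕ, ∀ (M : Mod) v, P M v ↔ T (pr (k : M) (env v))

section rep
variable {m : ℕ} {P Q : Pred m}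
theorem Rep.congr (h : Rep P) (e : ∀ M v, Q M v ↔ P M v) : Rep Q := by
  have : Q = P := by funext M v; exact propext (e M v)
  rw [this]; exact h
theorem Rep.and (h : Rep P) (h' : Rep Q) : Rep (fun M v => P M v ∧ Q M v) := by
  obtain ⟨a, ha⟩ := h; obtain ⟨b, hb⟩ := h'
  refine ⟨prN 1 (prN a b), fun M v => ?_⟩
  rw [cast_prN, cast_prN, Nat.cast_one, T1]; exact and_congr (ha M v) (hb M v)
theorem Rep.or (h : Rep P) (h' : Rep Q) : Rep (fun M v => P M v ∨ Q M v) := by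
  obtain ⟨a, ha⟩ := h; obtain ⟨b, hb⟩ := h'
  refine ⟨prN 2 (prN a b), fun M v => ?_⟩
  rw [cast_prN, cast_prN, Nat.cast_ofNat, T2]; exact or_congr (ha M v) (hb M v)
theorem Rep.ex {P : Pred (m+1)} (h : Rep P) : Rep (fun M v => ∃ a, P M (Fin.snoc v a)) := by
  obtain ⟨a, ha⟩ := h
  refine ⟨prN 3 a, fun M v => ?_⟩
  rw [cast_prN, Nat.cast_ofNat, T3]; simp only [ha, env_snoc]
theorem Rep.ball {P : Pred (m+2)} (h : Rep P) :
    Rep (m := m+1) (fun M v => ∀ a, a ≤ v (Fin.last m) → P M (Fin.snoc v a)) := by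
  obtain ⟨a, ha⟩ := h
  refine ⟨prN 4 a, fun M v => ?_⟩
  rw [cast_prN, Nat.cast_ofNat, env_succ, T4]; simp only [ha, env_snoc]; rfl
theorem Rep.drop {P : Pred (m+1)} (h : Rep P) :
    Rep (m := m+2) (fun M v => P M (Fin.snoc (fun i => v i.castSucc.castSucc) (v (Fin.last (m+1))))) := by
  obtain ⟨a, ha⟩ := h
  refine ⟨prN 5 a, fun M v => ?_⟩
  rw [cast_prN, Nat.cast_ofNat, env_succ, env_succ, T5]; simp only [ha, env_snoc]
theorem Rep.fls : Rep (m := m) (fun _ _ => False) :=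
  ⟨prN 13 0, fun M v => by
    rw [cast_prN, Nat.cast_ofNat, Nat.cast_zero]; simpa using T13⟩
theorem Rep.eq2 : Rep (m := m+2) (fun _ v => v (Fin.last m).castSucc = v (Fin.last (m+1))) :=
  ⟨prN 6 0, fun M v => by
    rw [cast_prN, Nat.cast_ofNat, Nat.cast_zero, env_succ, env_succ, T6]⟩
theorem Rep.zero : Rep (m := m+1) (fun _ v => v (Fin.last m) = 0) :=
  ⟨prN 7 0, fun M v => by
    rw [cast_prN, Nat.cast_ofNat, Nat.cast_zero, env_succ, T7]⟩
theorem Rep.succ2 : Rep (m := m+2) (fun _ v => v (Fin.last m).castSucc = v (Fin.last (m+1)) + 1) :=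
  ⟨prN 8 0, fun M v => by
    rw [cast_prN, Nat.cast_ofNat, Nat.cast_zero, env_succ, env_succ, T8]⟩
theorem Rep.le2 : Rep (m := m+2) (fun _ v => v (Fin.last m).castSucc ≤ v (Fin.last (m+1))) :=
  ⟨prN 11 0, fun M v => by
    rw [cast_prN, Nat.cast_ofNat, Nat.cast_zero, env_succ, env_succ, T11]⟩
theorem Rep.lt2 : Rep (m := m+2) (fun _ v => v (Fin.last m).castSucc < v (Fin.last (m+1))) :=
  ⟨prN 12 0, fun M v => by
    rw [cast_prN, Nat.cast_ofNat, Nat.cast_zero, env_succ, env_succ, T12]⟩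
theorem Rep.add3 : Rep (m := m+3) (fun _ v => v (Fin.last m).castSucc.castSucc =
    v (Fin.last (m+1)).castSucc + v (Fin.last (m+2))) :=
  ⟨prN 9 0, fun M v => by
    rw [cast_prN, Nat.cast_ofNat, Nat.cast_zero, env_succ, env_succ, env_succ, T9]⟩
theorem Rep.mul3 : Rep (m := m+3) (fun _ v => v (Fin.last m).castSucc.castSucc =
    v (Fin.last (m+1)).castSucc * v (Fin.last (m+2))) :=
  ⟨prN 10 0, fun M v => by
    rw [cast_prN, Nat.cast_ofNat, Nat.cast_zero, env_succ, env_succ, env_succ, T10]⟩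
theorem Rep.tru : Rep (m := m) (fun _ _ => True) :=
  (Rep.ex Rep.zero).congr (fun M v => by simp)

/-- graph of a function is representable -/
def RF (f : Func m) : Prop :=
  Rep (m := m+1) (fun M v => v (Fin.last m) = f M (fun i => v i.castSucc))

theorem RF.var (i : Fin m) : RF (fun _ v => v i) := by
  unfold RF
  induction m with
  | zero => exact i.elim0
  | succ m ih =>
    refine Fin.lastCases ?_ (fun i => ?_) i
    · exact Rep.eq2.congr (fun M v => eq_comm)
    · exact (Rep.drop (ih i)).congr (fun M v => by simp)

variable {f g : Func m}
theorem RF.succ (h : RF f) : RF (fun M v => f M v + 1) := by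
  refine (Rep.ex (Rep.and Rep.succ2 (Rep.drop h))).congr (fun M v => ?_)
  simp [- Fin.castSucc_zero]
theorem RF.bin {R : ∀ M : Mod, M → M → M → Prop} (hR : Rep (m := m+3) (fun M v =>
    R M (v (Fin.last m).castSucc.castSucc) (v (Fin.last (m+1)).castSucc) (v (Fin.last (m+2)))))
    (h : RF f) (h' : RF g) : Rep (m := m+1) (fun M v => R M (v (Fin.last m))
      (f M (fun i => v i.castSucc)) (g M (fun i => v i.castSucc))) := by
  refine (Rep.ex (Rep.and (Rep.drop h) (Rep.ex (Rep.and (Rep.drop (Rep.drop h')) hR)))).congr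
    (fun M v => ?_)
  simp [- Fin.castSucc_zero]
theorem RF.rel {R : ∀ M : Mod, M → M → Prop} (hR : Rep (m := m+2) (fun M v =>
    R M (v (Fin.last m).castSucc) (v (Fin.last (m+1)))))
    (h : RF f) (h' : RF g) : Rep (fun M v => R M (f M v) (g M v)) := by
  refine (Rep.ex (Rep.and h (Rep.ex (Rep.and (Rep.drop h') hR)))).congr
    (fun M v => ?_)
  simp [- Fin.castSucc_zero]

theorem RF.term (t : LA.Term (Empty ⊕ Fin m)) :
    RF (fun M v => t.realize (Sum.elim (default : Empty → M) v)) := by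
  induction t with
  | var i =>
    rcases i with i | i
    · exact i.elim
    · exact RF.var i
  | @func l F ts ih =>
    match l, F, ts, ih with
    | 0, F, ts, ih =>
      refine Rep.zero.congr (fun M v => ?_)
      exact iff_of_eq (congrArg (v (Fin.last m) = ·)
        (congrArg (Structure.funMap (L := LA) (M := M) F) (Subsingleton.elim _ ![])))
    | 1, F, ts, ih =>
      refine (RF.succ (ih 0)).congr (fun M v => ?_)
      beta_reduce
      rw [← sc_eq]
      refine iff_of_eq (congrArg (v (Fin.last m) = ·)
        (congrArg (Structure.funMap (L := LA) (M := M) F) ?_))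
      funext i; fin_cases i; rfl
    | 2, false, ts, ih =>
      refine (RF.bin (R := fun M x y z => x = y + z) Rep.add3 (ih 0) (ih 1)).congr (fun M v => ?_)
      refine iff_of_eq (congrArg (v (Fin.last m) = ·)
        (congrArg (Structure.funMap (L := LA) (M := M) (show LA.Functions 2 from false)) ?_))
      funext i; fin_cases i <;> rfl
    | 2, true, ts, ih =>
      refine (RF.bin (R := fun M x y z => x = y * z) Rep.mul3 (ih 0) (ih 1)).congr (fun M v => ?_)
      refine iff_of_eq (congrArg (v (Fin.last m) = ·)
        (congrArg (Structure.funMap (L := LA) (M := M) (show LA.Functions 2 from true)) ?_))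
      funext i; fin_cases i <;> rfl
    | _+3, F, _, _ => exact F.elim

theorem den_castSucc (t : LA.Term (Empty ⊕ Fin m)) (M : Mod) (v : Fin m → M) (a : M) :
    (t.relabel (Sum.map id Fin.castSucc)).realize
      (Sum.elim (default : Empty → M) (Fin.snoc v a : Fin (m+1) → M)) =
    t.realize (Sum.elim (default : Empty → M) v) := by
  rw [realize_castSucc]; simp

theorem Rep.allLe (t : LA.Term (Empty ⊕ Fin m)) {P : Pred (m+1)} (h : Rep P) :
    Rep (fun M v => ∀ a, a ≤ t.realize (Sum.elim (default : Empty → M) v) → P M (Fin.snoc v a)) := by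
  refine (Rep.ex (Rep.and (RF.term t) (Rep.ball (Rep.drop h)))).congr (fun M v => ?_)
  simp [- Fin.castSucc_zero]
theorem Rep.exLe (t : LA.Term (Empty ⊕ Fin m)) {P : Pred (m+1)} (h : Rep P) :
    Rep (fun M v => ∃ a, a ≤ t.realize (Sum.elim (default : Empty → M) v) ∧ P M (Fin.snoc v a)) := by
  refine (Rep.ex (Rep.and (RF.rel (R := fun M x y => x ≤ y) Rep.le2 (RF.var (Fin.last m))
    (RF.term (t.relabel (Sum.map id Fin.castSucc)))) h)).congr (fun M v => ?_)
  simp only [den_castSucc, Fin.snoc_last]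

theorem Rep.delta0 {φ : LA.BoundedFormula Empty m} (h : IsDelta0 φ) :
    Rep (den φ) ∧ Rep (fun M v => ¬ den φ M v) := by
  induction h with
  | falsum => exact ⟨Rep.fls.congr (fun M v => by simp [den]), Rep.tru.congr (fun M v => by simp [den])⟩
  | equal t u =>
    have hn := Rep.or (RF.rel (R := fun M x y => x < y) Rep.lt2 (RF.term t) (RF.term u))
      (RF.rel (R := fun M x y => x < y) Rep.lt2 (RF.term u) (RF.term t))
    refine ⟨(RF.rel (R := fun M x y => x = y) Rep.eq2 (RF.term t) (RF.term u)).congr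
      (fun M v => by simp [den]), hn.congr (fun M v => ?_)⟩
    simp only [den, BoundedFormula.realize_bdEqual]
    exact lt_or_lt_iff_ne.symm
  | le t u =>
    refine ⟨(RF.rel (R := fun M x y => x ≤ y) Rep.le2 (RF.term t) (RF.term u)).congr
      (fun M v => by simp [den]), (RF.rel (R := fun M x y => x < y) Rep.lt2 (RF.term u)
        (RF.term t)).congr (fun M v => by simp [den])⟩
  | imp _ _ iha ihb =>
    exact ⟨(iha.2.or ihb.1).congr (fun M v => by simp [den, imp_iff_not_or]),
      (iha.1.and ihb.2).congr (fun M v => by simp [den])⟩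
  | ball t _ ih =>
    refine ⟨(Rep.allLe t ih.1).congr (fun M v => ?_), (Rep.exLe t ih.2).congr (fun M v => ?_)⟩
    · simp only [den, BoundedFormula.realize_all, BoundedFormula.realize_imp, realize_leF,
        den_castSucc, realize_vT, Fin.snoc_last]
    · simp only [den, BoundedFormula.realize_all, BoundedFormula.realize_imp, realize_leF,
        den_castSucc, realize_vT, Fin.snoc_last]
      push Not; rfl
  | bex t _ ih =>
    refine ⟨(Rep.exLe t ih.1).congr (fun M v => ?_), (Rep.allLe t ih.2).congr (fun M v => ?_)⟩
    · simp only [den, BoundedFormula.realize_ex, BoundedFormula.realize_inf, realize_leF,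
        den_castSucc, realize_vT, Fin.snoc_last]
    · simp only [den, BoundedFormula.realize_ex, BoundedFormula.realize_inf, realize_leF,
        den_castSucc, realize_vT, Fin.snoc_last]
      push Not; rfl

theorem Rep.d0 (h : D0 P) : Rep P := by
  obtain ⟨φ, h0, e⟩ := h.out
  exact (Rep.delta0 h0).1.congr (fun M v => (e M v).symm)
end rep

/-- universal `Σ_(n+1)` predicate -/
def Un : ∀ (_ : ℕ) {M : Mod}, M → M → Prop
  | 0, _, k, e => T (pr k e)
  | n+1, _, k, e => ∃ u, ¬ Un n k (pr e u)

theorem Un_S (n : ℕ) : S (n+1) (m := 2) (fun M v => Un n (v 0) (v 1)) := by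
  induction n with
  | zero => exact (inferInstance : S (0 + 1) (m := 2) (fun M v => T (pr (v 0) (v 1))))
  | succ n ih =>
    refine S.exPi (R := fun M v u => ¬ Un n (v 0) (pr (v 1) u)) ?_
    have := S.subst2 (P := fun M x y => Un n x y) ih (m := 3) (fun M v => v 0) (fun M v => pr (v 1) (v 2))
    exact Pi.not (h := this)

theorem Un_rep {n m : ℕ} {P : Pred m} (h : S (n+1) P) :
    ∃ k : ℕ, ∀ (M : Mod) v, P M v ↔ Un n (k : M) (env v) := by
  induction n generalizing m with
  | zero =>
    obtain ⟨R, hR, rfl⟩ := h.elim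
    have h1 : D0 (m := m+1) (fun M v => R M (fun i => v i.castSucc) (v (Fin.last m))) := by
      have : D0 _ := hR.out
      exact D0.congr (P := fun M v => ¬ ¬ R M (fun i => v i.castSucc) (v (Fin.last m))) inferInstance
        (fun M v => not_not.symm)
    obtain ⟨k, hk⟩ := Rep.ex (Rep.d0 h1)
    refine ⟨k, fun M v => (Iff.trans ?_ (hk M v))⟩
    simp
  | succ n ih =>
    obtain ⟨R, hR, rfl⟩ := h.elim
    obtain ⟨k, hk⟩ := ih hR.ne
    refine ⟨k, fun M v => ?_⟩
    change _ ↔ ∃ u, ¬ Un n (k : M) (pr (env v) u)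
    refine exists_congr fun u => ?_
    rw [← env_snoc, ← hk]; simp


/-- the standard structure -/
@[reducible] def natStr : LA.Structure ℕ where
  funMap {n} f x := match n, f, x with
    | 0, _, _ => (0 : ℕ)
    | 1, _, x => x 0 + 1
    | 2, false, x => x 0 + x 1
    | 2, true, x => x 0 * x 1
    | _+3, f, _ => f.elim
  RelMap {n} r x := match n, r, x with
    | 0, r, _ => r.elim
    | 1, r, _ => r.elim
    | 2, _, x => x 0 ≤ x 1
    | _+3, r, _ => r.elim

theorem nat_pa : ∀ φ ∈ PAAx, @Sentence.Realize LA ℕ natStr φ := by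
  let _ := natStr
  have h0 : ∀ {m : ℕ} (w : Empty ⊕ Fin m → ℕ), (zeroT : LA.Term (Empty ⊕ Fin m)).realize w = 0 :=
    fun w => realize_zeroT' w
  have h1 : ∀ {m : ℕ} (w : Empty ⊕ Fin m → ℕ) (t : LA.Term (Empty ⊕ Fin m)),
      (succT t).realize w = t.realize w + 1 := fun w t => realize_succT' w t
  have h2 : ∀ {m : ℕ} (w : Empty ⊕ Fin m → ℕ) (t u : LA.Term (Empty ⊕ Fin m)),
      (addT t u).realize w = t.realize w + u.realize w := fun w t u => realize_addT' w t u
  have h3 : ∀ {m : ℕ} (w : Empty ⊕ Fin m → ℕ) (t u : LA.Term (Empty ⊕ Fin m)),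
      (mulT t u).realize w = t.realize w * u.realize w := fun w t u => realize_mulT' w t u
  have h4 : ∀ {m : ℕ} (w : Empty → ℕ) (v : Fin m → ℕ) (t u : LA.Term (Empty ⊕ Fin m)),
    (leF t u).Realize w v ↔ t.realize (Sum.elim w v) ≤ u.realize (Sum.elim w v) :=
    fun w v t u => realize_leF' w v t u
  have h5 : ∀ {m : ℕ} (w : Empty → ℕ) (v : Fin m → ℕ) (i : Fin m),
    (vT i).realize (Sum.elim w v) = v i := fun w v i => realize_vT' w v i
  intro φ hφ
  rcases hφ with hφ | ⟨k, ψ, rfl⟩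
  · simp only [Set.mem_insert_iff, Set.mem_singleton_iff] at hφ
    rcases hφ with rfl | rfl | rfl | rfl | rfl | rfl | rfl <;>
      simp only [Sentence.Realize, Formula.Realize, BoundedFormula.realize_all,
        BoundedFormula.realize_imp, BoundedFormula.realize_iff, BoundedFormula.realize_not,
        BoundedFormula.realize_ex, BoundedFormula.realize_bdEqual, h0, h1, h2, h3, h4, h5]
    · intro a; exact Nat.succ_ne_zero _
    · intro a b h; exact Nat.succ.inj h
    · intro a; rfl
    · intro a b; rfl
    · intro a; rfl
    · intro a b; rfl
    · intro a b
      exact ⟨fun h => ⟨b - a, Nat.sub_add_cancel h⟩, fun ⟨c, h⟩ => h ▸ Nat.le_add_left _ _⟩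
  · unfold indAxiom
    refine BoundedFormula.realize_alls.2 fun v => ?_
    simp only [BoundedFormula.realize_imp, BoundedFormula.realize_inf, BoundedFormula.realize_all,
      BoundedFormula.realize_bdEqual, h0, h1, h5]
    rintro ⟨hb, hs⟩ a
    induction a with
    | zero => exact hb 0 (by simp)
    | succ a ih =>
      have := hs a ih (a+1) (by simp)
      rw [BoundedFormula.realize_liftAt_one (by omega)] at this
      convert this using 1
      funext i
      refine Fin.lastCases ?_ (fun i => ?_) i
      · simp
      · simp

/-- the standard model -/
def natMod : Mod := ⟨ℕ, natStr, ⟨0⟩, nat_pa⟩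

theorem m_std {M : Mod} (a : M) (n : ℕ) (h : a ≤ n) : ∃ k : ℕ, k ≤ n ∧ a = k := by
  induction n with
  | zero =>
    refine ⟨0, le_rfl, ?_⟩
    rw [Nat.cast_zero] at *
    exact le_antisymm h (m_zero_le a)
  | succ n ih =>
    rcases h.lt_or_eq with h | h
    · rw [Nat.cast_succ, m_lt_succ] at h
      obtain ⟨k, h1, h2⟩ := ih h
      exact ⟨k, by omega, h2⟩
    · exact ⟨n+1, le_rfl, h⟩

def toN (a : natMod) : ℕ := a
def ofN (a : ℕ) : natMod := a
/-- the embedding of the standard model -/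
noncomputable def nc (M : Mod) (a : natMod) : M := (toN a : M)
section nc
variable (M : Mod)
theorem nc_zero : nc M 0 = 0 := Nat.cast_zero
theorem nc_sc (a : natMod) : nc M (sc natMod a) = sc M (nc M a) := by
  rw [sc_eq (nc M a)]; exact Nat.cast_succ (R := M) (toN a)
theorem nc_add (a b : natMod) : nc M (a + b) = nc M a + nc M b := Nat.cast_add (R := M) (toN a) (toN b)
theorem nc_mul (a b : natMod) : nc M (a * b) = nc M a * nc M b := Nat.cast_mul (α := M) (toN a) (toN b)
theorem nc_le (a b : natMod) : nc M a ≤ nc M b ↔ a ≤ b := Nat.cast_le (α := M) (m := toN a) (n := toN b)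
theorem nc_inj (a b : natMod) : nc M a = nc M b ↔ a = b := Nat.cast_inj (R := M) (m := toN a) (n := toN b)
theorem nc_std {M : Mod} (a : M) (n : natMod) (h : a ≤ nc M n) : ∃ k : natMod, k ≤ n ∧ a = nc M k :=
  m_std a (toN n) h
end nc

theorem abs_term {m : ℕ} (t : LA.Term (Empty ⊕ Fin m)) (M : Mod) (v : Fin m → natMod) :
    t.realize (Sum.elim (default : Empty → M) (fun i => nc M (v i))) =
     nc M (t.realize (Sum.elim (default : Empty → natMod) v)) := by
  induction t with
  | var i =>
    rcases i with i | i
    · exact i.elim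
    · rfl
  | @func l F ts ih =>
    match l, F, ts, ih with
    | 0, F, ts, ih =>
      refine Eq.trans (congrArg (Structure.funMap (L := LA) (M := M) F) (Subsingleton.elim _ ![])) ?_
      exact (nc_zero M).symm
    | 1, F, ts, ih =>
      refine Eq.trans (b := sc M ((ts 0).realize (Sum.elim default fun i => nc M (v i))))
        (congrArg (Structure.funMap (L := LA) (M := M) F) ?_) ?_
      · funext i; fin_cases i; rfl
      · rw [ih 0]; exact (nc_sc M _).symm
    | 2, false, ts, ih =>
      refine Eq.trans (b := (ts 0).realize (Sum.elim default fun i => nc M (v i)) +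
          (ts 1).realize (Sum.elim default fun i => nc M (v i)))
        (congrArg (Structure.funMap (L := LA) (M := M) (show LA.Functions 2 from false)) ?_) ?_
      · funext i; fin_cases i <;> rfl
      · rw [ih 0, ih 1]; exact (nc_add M _ _).symm
    | 2, true, ts, ih =>
      refine Eq.trans (b := (ts 0).realize (Sum.elim default fun i => nc M (v i)) *
          (ts 1).realize (Sum.elim default fun i => nc M (v i)))
        (congrArg (Structure.funMap (L := LA) (M := M) (show LA.Functions 2 from true)) ?_) ?_
      · funext i; fin_cases i <;> rfl
      · rw [ih 0, ih 1]; exact (nc_mul M _ _).symm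
    | _+3, F, _, _ => exact F.elim

theorem snoc_nc {M : Mod} {m : ℕ} (v : Fin m → natMod) (a : natMod) :
    (Fin.snoc (fun i => nc M (v i)) (nc M a) : Fin (m+1) → M) =
      fun i => nc M ((Fin.snoc v a : Fin (m+1) → natMod) i) := by
  funext i
  refine Fin.lastCases ?_ (fun i => ?_) i <;> simp

theorem abs_fml {m : ℕ} {φ : LA.BoundedFormula Empty m} (h : IsDelta0 φ) (M : Mod)
    (v : Fin m → natMod) :
    den φ M (fun i => nc M (v i)) ↔ den φ natMod v := by
  induction h with
  | falsum => simp [den]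
  | equal t u =>
    simp only [den, BoundedFormula.realize_bdEqual, abs_term, nc_inj]
  | le t u =>
    simp only [den, realize_leF, abs_term, nc_le]
  | imp _ _ iha ihb =>
    simp only [den, BoundedFormula.realize_imp] at *
    rw [iha, ihb]
  | ball t _ ih =>
    simp only [den, BoundedFormula.realize_all, BoundedFormula.realize_imp, realize_leF,
        den_castSucc, realize_vT, Fin.snoc_last, abs_term] at *
    constructor
    · intro h a ha
      have := h _ ((nc_le M _ _).2 ha)
      rwa [snoc_nc, ih] at this
    · intro h a ha
      obtain ⟨k, hk, rfl⟩ := nc_std a _ ha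
      rw [snoc_nc, ih]
      exact h _ hk
  | bex t _ ih =>
    simp only [den, BoundedFormula.realize_ex, BoundedFormula.realize_inf, realize_leF,
        den_castSucc, realize_vT, Fin.snoc_last, abs_term] at *
    constructor
    · rintro ⟨a, ha, h⟩
      obtain ⟨k, hk, rfl⟩ := nc_std a _ ha
      rw [snoc_nc, ih] at h
      exact ⟨k, hk, h⟩
    · rintro ⟨a, ha, h⟩
      refine ⟨nc M a, (nc_le M _ _).2 ha, ?_⟩
      rwa [snoc_nc, ih]

theorem D0.abs {m : ℕ} {P : Pred m} (h : D0 P) (M : Mod) (v : Fin m → natMod) :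
    P M (fun i => nc M (v i)) ↔ P natMod v := by
  obtain ⟨φ, h0, e⟩ := h.out
  rw [← e, ← e]; exact abs_fml h0 M v



/-- predicates on `ℕ` that are `Σ_1`-definable -/
class ND {m : ℕ} (P : (Fin m → ℕ) → Prop) : Prop where
  out : ∃ P' : Pred m, S (0+1) P' ∧ ∀ v : Fin m → ℕ, P v ↔ P' natMod v

/-- functions on `ℕ` with `Σ_1`-definable graph -/
class NF {m : ℕ} (f : (Fin m → ℕ) → ℕ) : Prop where
  out : ND (m := m+1) (fun v => v (Fin.last m) = f (fun i => v i.castSucc))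

section nd
variable {m : ℕ} {P Q : (Fin m → ℕ) → Prop} {R : (Fin m → ℕ) → ℕ → Prop} {f g : (Fin m → ℕ) → ℕ}
theorem ND.congr (h : ND P) (e : ∀ v, Q v ↔ P v) : ND Q := by
  have : Q = P := funext fun v => propext (e v)
  rw [this]; exact h
theorem ND.iff (P : (Fin m → ℕ) → Prop) [h : ND P] (e : ∀ v, Q v ↔ P v) : ND Q := h.congr e
instance ND.and [hP : ND P] [hQ : ND Q] : ND (fun v => P v ∧ Q v) := by
  obtain ⟨A, hA, eA⟩ := hP; obtain ⟨B, hB, eB⟩ := hQ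
  exact ⟨fun M v => A M v ∧ B M v, inferInstance, fun v => and_congr (eA v) (eB v)⟩
instance ND.or [hP : ND P] [hQ : ND Q] : ND (fun v => P v ∨ Q v) := by
  obtain ⟨A, hA, eA⟩ := hP; obtain ⟨B, hB, eB⟩ := hQ
  exact ⟨fun M v => A M v ∨ B M v, inferInstance, fun v => or_congr (eA v) (eB v)⟩
theorem ND.exA (A : Pred (m+1)) (h : S (0+1) A) : S (0+1) (fun M v => ∃ a, A M (Fin.snoc v a)) :=
  S.ex (h := by simpa only [snoc_last_eq] using h)
instance ND.ex [h : ND (m := m+1) (fun v => R (fun i => v i.castSucc) (v (Fin.last m)))] :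
    ND (fun v => ∃ a, R v a) := by
  obtain ⟨A, hA, eA⟩ := h
  refine ⟨_, ND.exA A hA, fun v => exists_congr fun a => ?_⟩
  have := eA (Fin.snoc v a)
  simp only [Fin.snoc_castSucc, Fin.snoc_last] at this
  exact this
theorem ND.relabel {m' : ℕ} (h : ND P) (g : Fin m → Fin m') : ND (fun v => P (fun i => v (g i))) := by
  obtain ⟨A, hA, eA⟩ := h
  exact ⟨_, S.subst hA (f := fun i M v => v (g i)) inferInstance, fun v => eA _⟩
theorem ND.wk (h : ND P) : ND (m := m+1) (fun v => P (fun i => v i.castSucc)) := h.relabel _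
theorem NF.of (h : ND (m := m+1) (fun v => v (Fin.last m) = f (fun i => v i.castSucc))) : NF f := ⟨h⟩
theorem NF.wk (h : NF f) : NF (m := m+1) (fun v => f (fun i => v i.castSucc)) := by
  have := h.out.relabel (m' := m+2) (Fin.lastCases (Fin.last _) (fun i => i.castSucc.castSucc))
  simp only [Fin.lastCases_last, Fin.lastCases_castSucc] at this
  exact ⟨this⟩
theorem ND.sub1 {p : ℕ → Prop} (hp : ND (m := 1) (fun v => p (v 0))) (f : (Fin m → ℕ) → ℕ) [hf : NF f] :
    ND (fun v => p (f v)) := by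
  have h1 := hf.out
  have h2 := hp.relabel (m' := m+1) (fun _ => Fin.last m)
  refine ND.congr (ND.ex (R := fun v a => a = f v ∧ p a) (h := ND.and)) (fun v => ?_)
  simp
theorem ND.sub2 {p : ℕ → ℕ → Prop} (hp : ND (m := 2) (fun v => p (v 0) (v 1)))
    (f g : (Fin m → ℕ) → ℕ) [hf : NF f] [hg : NF g] :
    ND (fun v => p (f v) (g v)) := by
  have h1 := hf.out
  have h2 := hg.wk.out
  have h3 : ND (m := m+1+1) (fun v => p (v (Fin.last m).castSucc) (v (Fin.last (m+1)))) :=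
    hp.relabel (m' := m+1+1) ![(Fin.last m).castSucc, Fin.last (m+1)]
  refine ND.congr (ND.ex (R := fun v a => a = f v ∧ ∃ b, b = g v ∧ p a b) (h := ?_)) (fun v => ?_)
  · exact ND.and (hQ := ND.ex (R := fun v b => b = g (fun i => v i.castSucc) ∧ p (v (Fin.last m)) b)
      (h := ND.and))
  · simp
theorem ND.sub3 {p : ℕ → ℕ → ℕ → Prop} (hp : ND (m := 3) (fun v => p (v 0) (v 1) (v 2)))
    (f g h : (Fin m → ℕ) → ℕ) [hf : NF f] [hg : NF g] [hh : NF h] :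
    ND (fun v => p (f v) (g v) (h v)) := by
  have h1 := hf.out
  have h2 := hg.wk
  have h2' := hh.wk
  have h3 : ND (m := m+1+1+1) (fun v => p (v (Fin.last m).castSucc.castSucc)
      (v (Fin.last (m+1)).castSucc) (v (Fin.last (m+2)))) := hp.relabel (m' := m+1+1+1) ![(Fin.last m).castSucc.castSucc, (Fin.last (m+1)).castSucc,
    Fin.last (m+2)]
  have h4 := h2.out
  have h5 := h2'.wk.out
  refine ND.congr (ND.ex (R := fun v a => a = f v ∧ ∃ b, b = g v ∧ ∃ c, c = h v ∧ p a b c) (h := ?_)) (fun v => ?_)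
  · refine ND.and (hQ := ND.ex (R := fun v b => b = g (fun i => v i.castSucc) ∧ ∃ c,
      c = h (fun i => v i.castSucc) ∧ p (v (Fin.last m)) b c)
      (h := ND.and (hQ := ND.ex (R := fun v c => c = h (fun i => v i.castSucc.castSucc) ∧
        p (v (Fin.last m).castSucc) (v (Fin.last (m+1))) c) (h := ND.and))))
  · simp

theorem ND.d0 (P' : Pred m) [D0 P'] (e : ∀ v : Fin m → ℕ, P v ↔ P' natMod v) : ND P :=
  ⟨P', inferInstance, e⟩

instance ND.var (i j : Fin m) : ND (fun v => v i = v j) := ND.d0 (fun _ v => v i = v j) (fun _ => Iff.rfl)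
instance NF.var (i : Fin m) : NF (fun v => v i) := ⟨ND.var _ _⟩
instance NF.const (c : ℕ) : NF (m := m) (fun _ => c) := by
  refine ⟨?_⟩
  induction c with
  | zero => exact ND.d0 (fun _ v => v (Fin.last m) = 0) (fun _ => Iff.rfl)
  | succ c ih =>
    have h1 := ih.relabel (m' := m+1+1) (Fin.lastCases (Fin.last _) (fun i => i.castSucc.castSucc))
    simp only [Fin.lastCases_last] at h1
    have h2 : ND (m := m+1+1) (fun v => v (Fin.last m).castSucc = v (Fin.last (m+1)) + 1) :=
      ND.d0 (fun _ v => v (Fin.last m).castSucc = v (Fin.last (m+1)) + 1) (fun _ => Iff.rfl)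
    refine ND.congr (ND.ex (R := fun v a => a = c ∧ v (Fin.last m) = a + 1) (h := ND.and)) (fun v => ?_)
    simp
instance ND.eq [NF f] [NF g] : ND (fun v => f v = g v) :=
  ND.sub2 (p := fun x y => x = y) (ND.var _ _) f g
theorem NF.sub1 {F : ℕ → ℕ} (hF : ND (m := 2) (fun v => v 1 = F (v 0))) (f : (Fin m → ℕ) → ℕ)
    [hf : NF f] : NF (fun v => F (f v)) := by
  have := hf.wk
  exact ⟨ND.sub2 (p := fun x y => y = F x) hF (fun v => f (fun i => v i.castSucc)) (fun v => v (Fin.last m))⟩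
theorem NF.sub2 {F : ℕ → ℕ → ℕ} (hF : ND (m := 3) (fun v => v 2 = F (v 0) (v 1)))
    (f g : (Fin m → ℕ) → ℕ) [hf : NF f] [hg : NF g] : NF (fun v => F (f v) (g v)) := by
  have := hf.wk
  have := hg.wk
  exact ⟨ND.sub3 (p := fun x y z => z = F x y) hF (fun v => f (fun i => v i.castSucc))
    (fun v => g (fun i => v i.castSucc)) (fun v => v (Fin.last m))⟩
instance NF.add [NF f] [NF g] : NF (fun v => f v + g v) :=
  NF.sub2 (ND.d0 (fun _ v => v 2 = v 0 + v 1) (fun _ => Iff.rfl)) f g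
instance NF.mul [NF f] [NF g] : NF (fun v => f v * g v) :=
  NF.sub2 (ND.d0 (fun _ v => v 2 = v 0 * v 1) (fun _ => Iff.rfl)) f g
instance ND.le [NF f] [NF g] : ND (fun v => f v ≤ g v) :=
  ND.sub2 (ND.d0 (fun _ v => v 0 ≤ v 1) (fun _ => Iff.rfl)) f g
instance ND.lt [NF f] [NF g] : ND (fun v => f v < g v) :=
  ND.congr (P := fun v => f v + 1 ≤ g v) inferInstance (fun _ => Iff.rfl)
instance ND.ne [NF f] [NF g] : ND (fun v => f v ≠ g v) :=
  ND.congr (P := fun v => f v < g v ∨ g v < f v) inferInstance (fun _ => lt_or_lt_iff_ne.symm)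
instance ND.nle [NF f] [NF g] : ND (fun v => ¬ f v ≤ g v) :=
  ND.congr (P := fun v => g v < f v) inferInstance (fun _ => not_le)
instance ND.ball [hf : NF f] [h : ND (m := m+1) (fun v => R (fun i => v i.castSucc) (v (Fin.last m)))] :
    ND (fun v => ∀ a, a ≤ f v → R v a) := by
  have h1 : ND (m := m+1) (fun v => ∀ a, a ≤ v (Fin.last m) → R (fun i => v i.castSucc) a) := by
    have h' := h.relabel (m' := m+1+1) (Fin.lastCases (Fin.last _) (fun i => i.castSucc.castSucc))
    simp only [Fin.lastCases_last, Fin.lastCases_castSucc] at h'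
    obtain ⟨A, hA, eA⟩ := h'
    have hb : S (0+1) (m := m+1) (fun M v => ∀ a, a ≤ v (Fin.last m) → A M (Fin.snoc v a)) := by
      have : S (0+1) (m := m+1+1) (fun M v => A M (Fin.snoc (fun i => v i.castSucc) (v (Fin.last _)))) := by
        simpa only [snoc_last_eq] using hA
      exact S.ball (f := fun M v => v (Fin.last m)) (R := fun M v a => A M (Fin.snoc v a))
    refine ⟨_, hb, fun v => forall_congr' fun a => imp_congr Iff.rfl ?_⟩
    have := eA (Fin.snoc v a)
    simp only [Fin.snoc_castSucc, Fin.snoc_last] at this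
    exact this
  have h2 := hf.out
  refine ND.congr (ND.ex (R := fun v b => b = f v ∧ ∀ a, a ≤ b → R v a) (h := ND.and)) (fun v => ?_)
  simp
instance ND.ballt [hf : NF f] [h : ND (m := m+1) (fun v => R (fun i => v i.castSucc) (v (Fin.last m)))] :
    ND (fun v => ∀ a, a < f v → R v a) := by
  have := hf.wk
  refine ND.congr (P := fun v => ∀ a, a ≤ f v → (a = f v ∨ R v a)) inferInstance (fun v => ?_)
  refine forall_congr' fun a => ⟨fun h h1 => ?_, fun h h1 => ?_⟩
  · rcases h1.lt_or_eq with h2 | h2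
    exacts [Or.inr (h h2), Or.inl h2]
  · rcases h h1.le with h2 | h2
    exacts [absurd h2 h1.ne, h2]
instance ND.true : ND (m := m) (fun _ => True) := ND.congr (P := fun _ => 0 = 0) inferInstance (fun _ => by simp)
instance ND.false : ND (m := m) (fun _ => False) := ND.congr (P := fun _ => 0 = 1) inferInstance (fun _ => by simp)
end nd


set_option synthInstance.maxSize 2000
set_option synthInstance.maxHeartbeats 400000
section funs
variable {m : ℕ} {f g : (Fin m → ℕ) → ℕ}
theorem natpair_graph : ND (m := 3) (fun v => v 2 = Nat.pair (v 0) (v 1)) := by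
  refine ND.iff (fun v => (v 0 < v 1 ∧ v 2 = v 1 * v 1 + v 0) ∨
    (v 1 ≤ v 0 ∧ v 2 = v 0 * v 0 + v 0 + v 1)) (fun v => ?_)
  unfold Nat.pair
  split_ifs with h
  · simp [h]
  · simp [h, not_lt.1 h]
instance NF.pair [NF f] [NF g] : NF (fun v => Nat.pair (f v) (g v)) := NF.sub2 natpair_graph f g
instance NF.fst [NF f] : NF (fun v => (Nat.unpair (f v)).1) := by
  refine NF.sub1 (F := fun x => (Nat.unpair x).1) ?_ f
  refine ND.iff (fun v => ∃ z, v 0 = Nat.pair (v 1) z) (fun v => ?_)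
  constructor
  · intro h; exact ⟨(Nat.unpair (v 0)).2, by rw [h, Nat.pair_unpair]⟩
  · rintro ⟨z, h⟩; rw [h, Nat.unpair_pair]
instance NF.snd [NF f] : NF (fun v => (Nat.unpair (f v)).2) := by
  refine NF.sub1 (F := fun x => (Nat.unpair x).2) ?_ f
  refine ND.iff (fun v => ∃ z, v 0 = Nat.pair z (v 1)) (fun v => ?_)
  constructor
  · intro h; exact ⟨(Nat.unpair (v 0)).1, by rw [h, Nat.pair_unpair]⟩
  · rintro ⟨z, h⟩; rw [h, Nat.unpair_pair]
theorem natbeta_graph : ND (m := 3) (fun v => v 2 = Nat.beta (v 0) (v 1)) := by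
  refine ND.iff (fun v => v 2 ≤ (v 1 + 1) * (Nat.unpair (v 0)).2 ∧
    ∃ q, (Nat.unpair (v 0)).1 = q * ((v 1 + 1) * (Nat.unpair (v 0)).2 + 1) + v 2)
    (fun v => ?_)
  have key : ∀ x d r : ℕ, r = x % (d+1) ↔ r ≤ d ∧ ∃ q, x = q * (d+1) + r := by
    intro x d r
    constructor
    · rintro rfl
      exact ⟨Nat.lt_succ_iff.1 (Nat.mod_lt _ d.succ_pos), x / (d+1), (Nat.div_add_mod' _ _).symm⟩
    · rintro ⟨h, q, rfl⟩
      rw [Nat.add_comm, Nat.add_mul_mod_self_right, Nat.mod_eq_of_lt (Nat.lt_succ_iff.2 h)]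
  exact key _ _ _
instance NF.beta [NF f] [NF g] : NF (fun v => Nat.beta (f v) (g v)) := NF.sub2 natbeta_graph f g
end funs

theorem exists_beta (n : ℕ) (g : ℕ → ℕ) : ∃ c, ∀ i, i ≤ n → Nat.beta c i = g i := by
  refine ⟨Nat.unbeta ((List.range (n+1)).map g), fun i hi => ?_⟩
  have := Nat.beta_unbeta_coe ((List.range (n+1)).map g) ⟨i, by simpa using Nat.lt_succ_of_le hi⟩
  simpa using this

theorem partrec_nd {f : ℕ →. ℕ} (h : Nat.Partrec f) : ND (m := 2) (fun v => v 1 ∈ f (v 0)) := by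
  induction h with
  | zero => exact ND.iff (fun v => v 1 = 0) (fun v => by simp [pure, PFun.pure, eq_comm])
  | succ => exact ND.iff (fun v => v 1 = v 0 + 1) (fun v => by simp)
  | left => exact ND.iff (fun v => v 1 = (Nat.unpair (v 0)).1) (fun v => by simp)
  | right => exact ND.iff (fun v => v 1 = (Nat.unpair (v 0)).2) (fun v => by simp)
  | @pair f g _ _ hf hg =>
    have h1 : ∀ {m} (a b : (Fin m → ℕ) → ℕ) [NF a] [NF b], ND (fun v => b v ∈ f (a v)) :=
      fun a b => ND.sub2 (p := fun x y => y ∈ f x) hf a b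
    have h2 : ∀ {m} (a b : (Fin m → ℕ) → ℕ) [NF a] [NF b], ND (fun v => b v ∈ g (a v)) :=
      fun a b => ND.sub2 (p := fun x y => y ∈ g x) hg a b
    refine ND.iff (fun v => ∃ a, ∃ b, (a ∈ f (v 0) ∧ b ∈ g (v 0)) ∧ v 1 = Nat.pair a b) (fun v => ?_)
    simp only [Seq.seq, Part.map_eq_map, Part.mem_bind_iff, Part.mem_map_iff]
    constructor
    · rintro ⟨_, ⟨a, ha, rfl⟩, b, hb, h⟩; exact ⟨a, b, ⟨ha, hb⟩, h.symm⟩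
    · rintro ⟨a, b, ⟨ha, hb⟩, h⟩; exact ⟨_, ⟨a, ha, rfl⟩, b, hb, h.symm⟩
  | @comp f g _ _ hf hg =>
    have h1 : ∀ {m} (a b : (Fin m → ℕ) → ℕ) [NF a] [NF b], ND (fun v => b v ∈ f (a v)) :=
      fun a b => ND.sub2 (p := fun x y => y ∈ f x) hf a b
    have h2 : ∀ {m} (a b : (Fin m → ℕ) → ℕ) [NF a] [NF b], ND (fun v => b v ∈ g (a v)) :=
      fun a b => ND.sub2 (p := fun x y => y ∈ g x) hg a b
    refine ND.iff (fun v => ∃ a, a ∈ g (v 0) ∧ v 1 ∈ f a) (fun v => ?_)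
    exact Part.mem_bind_iff
  | @prec f g _ _ hf hg =>
    have h1 : ∀ {m} (a b : (Fin m → ℕ) → ℕ) [NF a] [NF b], ND (fun v => b v ∈ f (a v)) :=
      fun a b => ND.sub2 (p := fun x y => y ∈ f x) hf a b
    have h2 : ∀ {m} (a b : (Fin m → ℕ) → ℕ) [NF a] [NF b], ND (fun v => b v ∈ g (a v)) :=
      fun a b => ND.sub2 (p := fun x y => y ∈ g x) hg a b
    have hP : ND (m := 2) (fun v => ∃ c, Nat.beta c 0 ∈ f (Nat.unpair (v 0)).1 ∧
      v 1 = Nat.beta c (Nat.unpair (v 0)).2 ∧ ∀ i, i < (Nat.unpair (v 0)).2 →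
        Nat.beta c (i+1) ∈ g (Nat.pair (Nat.unpair (v 0)).1 (Nat.pair i (Nat.beta c i)))) := inferInstance
    refine hP.congr (fun v => ?_)
    generalize v 1 = y
    generalize v 0 = x
    simp only [Nat.unpaired]
    generalize (Nat.unpair x).1 = a
    generalize (Nat.unpair x).2 = n
    constructor
    · intro h
      have key : ∀ n y, y ∈ (Nat.rec (f a) (fun y IH => do let i ← IH; g (Nat.pair a (Nat.pair y i))) n : Part ℕ) →
          ∃ s : ℕ → ℕ, s 0 ∈ f a ∧ y = s n ∧ ∀ i, i < n → s (i+1) ∈ g (Nat.pair a (Nat.pair i (s i))) := by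
        intro n
        induction n with
        | zero => intro y hy; exact ⟨fun _ => y, hy, rfl, by simp⟩
        | succ n ih =>
          intro y hy
          obtain ⟨z, hz, hy⟩ := Part.mem_bind_iff.1 hy
          obtain ⟨s, s0, s1, s2⟩ := ih z hz
          refine ⟨fun i => if i ≤ n then s i else y, by simpa using s0, by simp, fun i hi => ?_⟩
          rcases Nat.lt_succ_iff_lt_or_eq.1 hi with hi | rfl
          · have := s2 i hi
            simpa [hi.le, Nat.succ_le_iff.2 hi] using this
          · simpa [← s1] using hy
      obtain ⟨s, s0, s1, s2⟩ := key n y h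
      obtain ⟨c, hc⟩ := exists_beta n s
      refine ⟨c, by rwa [hc 0 (Nat.zero_le _)], by rw [hc n le_rfl, s1], fun i hi => ?_⟩
      rw [hc _ hi, hc _ hi.le]; exact s2 i hi
    · rintro ⟨c, c0, rfl, c2⟩
      have key : ∀ i, i ≤ n → Nat.beta c i ∈ (Nat.rec (f a) (fun y IH => do let i ← IH; g (Nat.pair a (Nat.pair y i))) i : Part ℕ) := by
        intro i
        induction i with
        | zero => intro _; exact c0
        | succ i ih =>
          intro hi
          exact Part.mem_bind_iff.2 ⟨_, ih (by omega), c2 i hi⟩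
      exact key n le_rfl
  | @rfind f _ hf =>
    have h1 : ∀ {m} (a b : (Fin m → ℕ) → ℕ) [NF a] [NF b], ND (fun v => b v ∈ f (a v)) :=
      fun a b => ND.sub2 (p := fun x y => y ∈ f x) hf a b
    have hP : ND (m := 2) (fun v => 0 ∈ f (Nat.pair (v 0) (v 1)) ∧ ∀ k, k < v 1 → ∃ y, y ≠ 0 ∧ y ∈ f (Nat.pair (v 0) k)) := inferInstance
    refine hP.congr (fun v => ?_)
    refine Nat.mem_rfind.trans ?_
    have e : ∀ (b : Bool) x, b ∈ (fun m => decide (m = 0)) <$> f x ↔ ∃ y, y ∈ f x ∧ decide (y = 0) = b :=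
      fun b x => Part.mem_map_iff _
    constructor
    · rintro ⟨h, h'⟩
      obtain ⟨a, ha, h⟩ := (e _ _).1 h
      refine ⟨(of_decide_eq_true h) ▸ ha, fun k hk => ?_⟩
      obtain ⟨a, ha, h⟩ := (e _ _).1 (h' hk)
      exact ⟨a, of_decide_eq_false h, ha⟩
    · rintro ⟨h, h'⟩
      refine ⟨(e _ _).2 ⟨0, h, rfl⟩, fun {k} hk => ?_⟩
      obtain ⟨a, ha, h⟩ := h' k hk
      exact (e _ _).2 ⟨a, h, by simpa using ha⟩

theorem Nat.nf1 {F : ℕ → ℕ} (h : Computable F) {m : ℕ} (f : (Fin m → ℕ) → ℕ) [NF f] : NF (fun v => F (f v)) := by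
  have := partrec_nd (Partrec.nat_iff.1 h)
  exact NF.sub1 (ND.congr this (fun v => by simp)) f
theorem Nat.nf2 {F : ℕ → ℕ → ℕ} (h : Computable₂ F) {m : ℕ} (f g : (Fin m → ℕ) → ℕ) [NF f] [NF g] :
    NF (fun v => F (f v) (g v)) := by
  have h' : Computable (fun x : ℕ => F (Nat.unpair x).1 (Nat.unpair x).2) :=
    h.comp (Computable.fst.comp Computable.unpair) (Computable.snd.comp Computable.unpair)
  have := Nat.nf1 h' (fun v => Nat.pair (f v) (g v))
  simpa only [Nat.unpair_pair] using this
theorem Nat.nd1 {p : ℕ → Prop} (h : ComputablePred p) {m : ℕ} (f : (Fin m → ℕ) → ℕ) [NF f] :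
    ND (fun v => p (f v)) := by
  obtain ⟨hd, hp⟩ := h
  have h' : Computable (fun x : ℕ => (decide (p x)).toNat) := Computable.comp (Primrec.dom_bool _).to_comp hp
  have := Nat.nf1 h' f
  refine ND.iff (fun v => (decide (p (f v))).toNat = 1) (fun v => ?_)
  simp

set_option synthInstance.maxSize 2000
set_option synthInstance.maxHeartbeats 400000

theorem NF.powi {m : ℕ} (f : (Fin m → ℕ) → ℕ) [NF f] : NF (fun v => 2 ^ (f v)) :=
  Nat.nf2 (F := fun a b => a ^ b) (Primrec₂.unpaired'.1 Nat.Primrec.pow).to_comp (fun _ => 2) f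
instance NF.pow {m : ℕ} (f : (Fin m → ℕ) → ℕ) [NF f] : NF (fun v => 2 ^ (f v)) := NF.powi f
/-- the `x`-th binary digit of `s` -/
def bit (s x : ℕ) : ℕ := s / 2 ^ x % 2
instance NF.bit {m : ℕ} (f g : (Fin m → ℕ) → ℕ) [NF f] [NF g] : NF (fun v => bit (f v) (g v)) := by
  have h1 := Nat.nf2 (F := fun a b => a / b) Primrec.nat_div.to_comp f (fun v => 2 ^ g v)
  exact Nat.nf2 (F := fun a b => a % b) Primrec.nat_mod.to_comp (fun v => f v / 2 ^ g v) (fun _ => 2)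
theorem bit_eq (s x : ℕ) : bit s x = (s.testBit x).toNat := by
  rw [bit, Nat.testBit_eq_decide_div_mod_eq]
  rcases Nat.mod_two_eq_zero_or_one (s / 2 ^ x) with h | h <;> simp [h]

/-- derivability for a Horn system with base facts `B` and two-premise rules `R` -/
inductive Der (B : ℕ → Prop) (R : ℕ → ℕ → ℕ → Prop) : ℕ → Prop
  | base {x : ℕ} : B x → Der B R x
  | step {x y z : ℕ} : Der B R y → Der B R z → R x y z → Der B R x

theorem Der.seq {B : ℕ → Prop} {R : ℕ → ℕ → ℕ → Prop} {x : ℕ} (h : Der B R x) :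
    ∃ (L : ℕ) (s : ℕ → ℕ), s L = x ∧ ∀ i, i ≤ L → (B (s i) ∨ ∃ j k, (j < i ∧ k < i) ∧ R (s i) (s j) (s k)) := by
  induction h with
  | @base x h => exact ⟨0, fun _ => x, rfl, fun i _ => Or.inl h⟩
  | @step x y z _ _ hR h1 h2 =>
    obtain ⟨L1, s1, e1, h1⟩ := h1
    obtain ⟨L2, s2, e2, h2⟩ := h2
    have a1 : ∀ i, i ≤ L1 → (fun i => if i ≤ L1 then s1 i else if i ≤ L1 + 1 + L2 then s2 (i - (L1+1)) else x) i = s1 i :=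
      fun i hi => if_pos hi
    have a2 : ∀ i, i ≤ L2 → (fun i => if i ≤ L1 then s1 i else if i ≤ L1 + 1 + L2 then s2 (i - (L1+1)) else x) (L1+1+i) = s2 i := by
      intro i hi
      have e : L1 + 1 + i - (L1 + 1) = i := by omega
      simp only [e]
      rw [if_neg (by omega), if_pos (by omega)]
    have a3 : (fun i => if i ≤ L1 then s1 i else if i ≤ L1 + 1 + L2 then s2 (i - (L1+1)) else x) (L1+1+L2+1) = x := by
      simp only
      rw [if_neg (by omega), if_neg (by omega)]
    revert a1 a2 a3
    generalize (fun i => if i ≤ L1 then s1 i else if i ≤ L1 + 1 + L2 then s2 (i - (L1+1)) else x) = s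
    intro a1 a2 a3
    refine ⟨L1+1+L2+1, s, a3, fun i hi => ?_⟩
    rcases lt_or_ge L1 i with h | h
    · rcases lt_or_ge (L1+1+L2) i with h' | h'
      · obtain rfl : i = L1+1+L2+1 := by omega
        refine Or.inr ⟨L1, L1+1+L2, ⟨by omega, by omega⟩, ?_⟩
        rw [a1 L1 le_rfl, a2 L2 le_rfl, a3, e1, e2]; exact hR
      · obtain ⟨i, rfl⟩ := Nat.exists_eq_add_of_le (show L1 + 1 ≤ i from h)
        rw [a2 i (by omega)]
        rcases h2 i (by omega) with h | ⟨j, k, ⟨hj, hk⟩, h⟩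
        · exact Or.inl h
        · refine Or.inr ⟨L1+1+j, L1+1+k, ⟨by omega, by omega⟩, ?_⟩
          rwa [a2 j (by omega), a2 k (by omega)]
    · rw [a1 i h]
      rcases h1 i h with h | ⟨j, k, ⟨hj, hk⟩, h⟩
      · exact Or.inl h
      · refine Or.inr ⟨j, k, ⟨hj, hk⟩, ?_⟩
        rwa [a1 j (by omega), a1 k (by omega)]

theorem Der.nd {B : ℕ → Prop} {R : ℕ → ℕ → ℕ → Prop} (hB : ND (m := 1) (fun v => B (v 0)))
    (hR : ND (m := 3) (fun v => R (v 0) (v 1) (v 2))) {m : ℕ} (f : (Fin m → ℕ) → ℕ) [NF f] :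
    ND (fun v => Der B R (f v)) := by
  refine ND.sub1 (p := fun x => Der B R x) ?_ f
  have h1 : ∀ {m} (a : (Fin m → ℕ) → ℕ) [NF a], ND (fun v => B (a v)) := fun a => ND.sub1 hB a
  have h2 : ∀ {m} (a b c : (Fin m → ℕ) → ℕ) [NF a] [NF b] [NF c], ND (fun v => R (a v) (b v) (c v)) :=
    fun a b c => ND.sub3 hR a b c
  have h3 : ND (m := 1) (fun v => ∃ c, ∃ L, Nat.beta c L = v 0 ∧ ∀ i, i ≤ L → (B (Nat.beta c i) ∨
    ∃ j, ∃ k, (j < i ∧ k < i) ∧ R (Nat.beta c i) (Nat.beta c j) (Nat.beta c k))) := inferInstance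
  refine h3.congr (fun v => ?_)
  generalize v 0 = x
  constructor
  · intro h
    obtain ⟨L, s, rfl, h'⟩ := h.seq
    obtain ⟨c, hc⟩ := exists_beta L s
    refine ⟨c, L, hc L le_rfl, fun i hi => ?_⟩
    rcases h' i hi with h | ⟨j, k, ⟨hj, hk⟩, h⟩
    · rw [hc i hi]; exact Or.inl h
    · refine Or.inr ⟨j, k, ⟨hj, hk⟩, ?_⟩
      rwa [hc i hi, hc j (by omega), hc k (by omega)]
  · rintro ⟨c, L, rfl, h⟩
    have : ∀ i, i ≤ L → Der B R (Nat.beta c i) := by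
      intro i
      induction i using Nat.strong_induction_on with
      | _ i ih =>
        intro hi
        rcases h i hi with h | ⟨j, k, ⟨hj, hk⟩, h⟩
        · exact .base h
        · exact .step (ih j hj (by omega)) (ih k hk (by omega)) h
    exact this L le_rfl

set_option synthInstance.maxSize 4000
set_option synthInstance.maxHeartbeats 800000

def opC (i q r : ℕ) : ℕ := Nat.pair 4 (Nat.pair i (Nat.pair q r))
/-- code of a variable -/
def cV : ∀ (m : ℕ), Fin m → ℕ
  | 0, i => i.elim0
  | m+1, i => Fin.lastCases (motive := fun _ => ℕ) (Nat.pair 2 0) (fun j => Nat.pair 3 (cV m j)) i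
theorem cV_last (m : ℕ) : cV (m+1) (Fin.last m) = Nat.pair 2 0 := by simp [cV]
theorem cV_cast (m : ℕ) (j : Fin m) : cV (m+1) j.castSucc = Nat.pair 3 (cV m j) := by simp [cV]

/-- code of a term -/
def cT {m : ℕ} : LA.Term (Empty ⊕ Fin m) → ℕ
  | .var (.inl e) => e.elim
  | .var (.inr i) => cV m i
  | @Term.func _ _ 0 _ _ => 0
  | @Term.func _ _ 1 _ ts => opC 0 0 (cT (ts 0))
  | @Term.func _ _ 2 f ts => opC (cond f 2 1) (cT (ts 0)) (cT (ts 1))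
  | @Term.func _ _ (_+3) _ _ => 0
/-- code of a formula -/
def cF : ∀ {m : ℕ}, LA.BoundedFormula Empty m → ℕ
  | _, .falsum => 0
  | _, .equal t u => opC 3 (cT t) (cT u)
  | _, @BoundedFormula.rel _ _ _ 2 _ ts => opC 4 (cT (ts 0)) (cT (ts 1))
  | _, @BoundedFormula.rel _ _ _ 0 _ _ => 0
  | _, @BoundedFormula.rel _ _ _ 1 _ _ => 0
  | _, @BoundedFormula.rel _ _ _ (_+3) _ _ => 0
  | _, .imp φ ψ => opC 5 (cF φ) (cF ψ)
  | _, .all φ => Nat.pair 5 (cF φ)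

theorem term_ind {m : ℕ} {P : LA.Term (Empty ⊕ Fin m) → Prop} (hv : ∀ i, P (vT i)) (hz : P zeroT)
    (hs : ∀ t, P t → P (succT t)) (ha : ∀ t u, P t → P u → P (addT t u))
    (hm : ∀ t u, P t → P u → P (mulT t u)) (t) : P t := by
  induction t with
  | var x =>
    rcases x with x | x
    · exact x.elim
    · exact hv x
  | @func l f ts ih =>
    match l, f, ts, ih with
    | 0, f, ts, ih => rw [show Term.func f ts = zeroT from congrArg (Term.func (L := LA) (l := 0) f) (funext fun i => i.elim0)]; exact hz
    | 1, f, ts, ih =>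
      rw [show Term.func f ts = succT (ts 0) from congrArg (Term.func (L := LA) (l := 1) f) (funext fun i => by
        rw [Subsingleton.elim i 0]; rfl)]
      exact hs _ (ih 0)
    | 2, f, ts, ih =>
      have e : ts = ![ts 0, ts 1] := by
        funext i; refine Fin.cases rfl (fun j => ?_) i; rw [Subsingleton.elim j 0]; rfl
      have : ∀ f : Bool, P (Term.func (L := LA) (l := 2) f ts) := by
        intro f
        rw [e]
        cases f
        · exact ha _ _ (ih 0) (ih 1)
        · exact hm _ _ (ih 0) (ih 1)
      exact this f
    | (_+3), f, ts, ih => exact (show Empty from f).elim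

theorem fml_ind {P : ∀ {m : ℕ}, LA.BoundedFormula Empty m → Prop} (hb : ∀ {m}, P (⊥ : LA.BoundedFormula Empty m))
    (he : ∀ {m} (t u : LA.Term (Empty ⊕ Fin m)), P (t =' u)) (hl : ∀ {m} (t u : LA.Term (Empty ⊕ Fin m)), P (leF t u))
    (hi : ∀ {m} (φ ψ : LA.BoundedFormula Empty m), P φ → P ψ → P (φ ⟹ ψ))
    (ha : ∀ {m} (φ : LA.BoundedFormula Empty (m+1)), P φ → P (∀' φ)) {m} (φ : LA.BoundedFormula Empty m) : P φ := by
  induction φ with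
  | falsum => exact hb
  | equal t u => exact he t u
  | @rel m l R ts =>
    match l, R, ts with
    | 2, R, ts =>
      have e : ts = ![ts 0, ts 1] := by
        funext i; refine Fin.cases rfl (fun j => ?_) i; rw [Subsingleton.elim j 0]; rfl
      rw [e]; exact hl (ts 0) (ts 1)
    | 0, R, ts => exact (show Empty from R).elim
    | 1, R, ts => exact (show Empty from R).elim
    | (_+3), R, ts => exact (show Empty from R).elim
  | imp φ ψ h1 h2 => exact hi _ _ h1 h2
  | all φ h => exact ha _ h

section
variable {m : ℕ} (t u : LA.Term (Empty ⊕ Fin m)) (φ ψ : LA.BoundedFormula Empty m)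
theorem cT_v (i : Fin m) : cT (vT i) = cV m i := by simp [vT, cT]
theorem cT_zero : cT (zeroT : LA.Term (Empty ⊕ Fin m)) = 0 := by simp [zeroT, Constants.term, cT]
theorem cT_succ : cT (succT t) = opC 0 0 (cT t) := by simp [succT, Functions.apply₁, cT]
theorem cT_add : cT (addT t u) = opC 1 (cT t) (cT u) := by simp [addT, Functions.apply₂, cT]
theorem cT_mul : cT (mulT t u) = opC 2 (cT t) (cT u) := by simp [mulT, Functions.apply₂, cT]
theorem cF_bot : cF (⊥ : LA.BoundedFormula Empty m) = 0 := by simp [cF]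
theorem cF_eq : cF (t =' u) = opC 3 (cT t) (cT u) := by simp [Term.bdEqual, cF]
theorem cF_le : cF (leF t u) = opC 4 (cT t) (cT u) := by
  simp [leF, Relations.boundedFormula₂, Relations.boundedFormula, cF]
theorem cF_imp : cF (φ ⟹ ψ) = opC 5 (cF φ) (cF ψ) := by simp [cF]
theorem cF_all (φ : LA.BoundedFormula Empty (m+1)) : cF (∀' φ) = Nat.pair 5 (cF φ) := by simp [cF]
end

def eA {α : Type} [Encodable α] (l : List α) (t : ℕ) : ℕ :=
  l.foldr (fun a g => Nat.pair (Encodable.encode a) g + 1) t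
theorem eA_append {α : Type} [Encodable α] (l l' : List α) (t : ℕ) : eA (l ++ l') t = eA l (eA l' t) := by
  simp [eA]
theorem eA_cons {α : Type} [Encodable α] (a : α) (l' : List α) (t : ℕ) :
    eA (a :: l') t = Nat.pair (Encodable.encode a) (eA l' t) + 1 := rfl
theorem eA_nil {α : Type} [Encodable α] (t : ℕ) : eA ([] : List α) t = t := rfl
theorem eA_zero {α : Type} [Encodable α] (l : List α) : eA l 0 = Encodable.encode l := by
  induction l with
  | nil => rfl
  | cons a l ih => rw [eA_cons, ih, Encodable.encode_list_cons]

abbrev FSym : Type := (Σ k, LA.Term (Empty ⊕ Fin k)) ⊕ ((Σ n, LA.Relations n) ⊕ ℕ)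

/-- codes of the function symbols -/
def kz : ℕ := Encodable.encode (⟨0, Unit.unit⟩ : Σ i, LA.Functions i)
def ks : ℕ := Encodable.encode (⟨1, Unit.unit⟩ : Σ i, LA.Functions i)
def ka : ℕ := Encodable.encode (⟨2, false⟩ : Σ i, LA.Functions i)
def km : ℕ := Encodable.encode (⟨2, true⟩ : Σ i, LA.Functions i)
def kl : ℕ := Encodable.encode (⟨2, Unit.unit⟩ : Σ i, LA.Relations i)

section
variable {m : ℕ} (t u : LA.Term (Empty ⊕ Fin m)) (φ ψ : LA.BoundedFormula Empty m) (r : ℕ)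
theorem eT_v (i : Fin m) : eA (vT i).listEncode r = Nat.pair (2 * (2 * (i:ℕ) + 1)) r + 1 := by
  simp [vT, Term.listEncode, eA_cons, eA_nil]; rfl
theorem eT_zero : eA (zeroT : LA.Term (Empty ⊕ Fin m)).listEncode r = Nat.pair (2 * kz + 1) r + 1 := by
  simp [zeroT, Constants.term, Term.listEncode, eA_cons, eA_nil]; rfl
theorem eT_succ : eA (succT t).listEncode r = Nat.pair (2 * ks + 1) (eA t.listEncode r) + 1 := by
  simp [succT, Functions.apply₁, Term.listEncode, eA_cons, List.finRange_succ]; rfl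
theorem eT_add : eA (addT t u).listEncode r = Nat.pair (2 * ka + 1) (eA t.listEncode (eA u.listEncode r)) + 1 := by
  simp [addT, Functions.apply₂, Term.listEncode, eA_cons, List.finRange_succ, eA_append]; rfl
theorem eT_mul : eA (mulT t u).listEncode r = Nat.pair (2 * km + 1) (eA t.listEncode (eA u.listEncode r)) + 1 := by
  simp [mulT, Functions.apply₂, Term.listEncode, eA_cons, List.finRange_succ, eA_append]; rfl
theorem enc_term : Encodable.encode (⟨m, t⟩ : Σ k, LA.Term (Empty ⊕ Fin k)) = Nat.pair m (eA t.listEncode 0) := by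
  rw [eA_zero]; rfl
theorem eF_bot : eA (⊥ : LA.BoundedFormula Empty m).listEncode r = Nat.pair (2 * (2 * (m + 2) + 1) + 1) r + 1 := by
  simp [BoundedFormula.listEncode, eA_cons, eA_nil]
theorem eF_eq : eA (t =' u).listEncode r = Nat.pair (2 * Nat.pair m (eA t.listEncode 0))
    (Nat.pair (2 * Nat.pair m (eA u.listEncode 0)) r + 1) + 1 := by
  simp only [Term.bdEqual, BoundedFormula.listEncode, eA_cons, eA_nil, Encodable.encode_inl, enc_term]
theorem eF_le : eA (leF t u).listEncode r = Nat.pair (2 * (2 * kl) + 1) (Nat.pair (2 * (2 * m + 1) + 1)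
    (Nat.pair (2 * Nat.pair m (eA t.listEncode 0))
    (Nat.pair (2 * Nat.pair m (eA u.listEncode 0)) r + 1) + 1) + 1) + 1 := by
  simp only [leF, Relations.boundedFormula₂, Relations.boundedFormula, BoundedFormula.listEncode, eA_append, eA_cons, eA_nil, Encodable.encode_inl,
    Encodable.encode_inr, enc_term, List.finRange_succ, List.map_cons, List.map_nil, List.finRange_zero, Encodable.encode_nat]
  rfl
theorem eF_imp : eA (φ ⟹ ψ).listEncode r = Nat.pair 3 (eA φ.listEncode (eA ψ.listEncode r)) + 1 := by
  simp [BoundedFormula.listEncode, eA_cons, eA_append]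
theorem eF_all (φ : LA.BoundedFormula Empty (m+1)) : eA (∀' φ).listEncode r = Nat.pair 7 (eA φ.listEncode r) + 1 := by
  simp [BoundedFormula.listEncode, eA_cons]
end

def tV (m j c : ℕ) : ℕ := Nat.pair 0 (Nat.pair m (Nat.pair j c))
def tT (m c r g : ℕ) : ℕ := Nat.pair 1 (Nat.pair m (Nat.pair c (Nat.pair r g)))
def tF (m c r g : ℕ) : ℕ := Nat.pair 2 (Nat.pair m (Nat.pair c (Nat.pair r g)))
section
variable {m : ℕ} (a b c d : (Fin m → ℕ) → ℕ) [NF a] [NF b] [NF c] [NF d]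
instance NF.opC : NF (fun v => opC (a v) (b v) (c v)) := by unfold Guaspari.opC; infer_instance
instance NF.tV : NF (fun v => tV (a v) (b v) (c v)) := by unfold Guaspari.tV; infer_instance
instance NF.tT : NF (fun v => tT (a v) (b v) (c v) (d v)) := by unfold Guaspari.tT; infer_instance
instance NF.tF : NF (fun v => tF (a v) (b v) (c v) (d v)) := by unfold Guaspari.tF; infer_instance
end

def BB (x : ℕ) : Prop := (∃ m, x = tV (m+1) m (Nat.pair 2 0)) ∨
  (∃ m, ∃ r, x = tT m 0 r (Nat.pair (2 * kz + 1) r + 1)) ∨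
  (∃ m, ∃ r, x = tF m 0 r (Nat.pair (2 * (2 * (m + 2) + 1) + 1) r + 1))
def R1 (x y : ℕ) : Prop := ∃ m, ∃ j, ∃ c, y = tV m j c ∧ x = tV (m+1) j (Nat.pair 3 c)
def R2 (x y : ℕ) : Prop := ∃ m, ∃ j, ∃ c, ∃ r, y = tV m j c ∧ x = tT m c r (Nat.pair (2 * (2 * j + 1)) r + 1)
def R3 (x y : ℕ) : Prop := ∃ m, ∃ c, ∃ r, ∃ g, y = tT m c r g ∧ x = tT m (opC 0 0 c) r (Nat.pair (2 * ks + 1) g + 1)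
def R4 (x y z : ℕ) : Prop := ∃ m, ∃ c, ∃ d, ∃ r, ∃ g, ∃ h, (y = tT m c g h ∧ z = tT m d r g) ∧
  (x = tT m (opC 1 c d) r (Nat.pair (2 * ka + 1) h + 1) ∨ x = tT m (opC 2 c d) r (Nat.pair (2 * km + 1) h + 1))
def R5 (x y z : ℕ) : Prop := ∃ m, ∃ c, ∃ d, ∃ r, ∃ g, ∃ h, (y = tT m c 0 g ∧ z = tT m d 0 h) ∧
  (x = tF m (opC 3 c d) r (Nat.pair (2 * Nat.pair m g) (Nat.pair (2 * Nat.pair m h) r + 1) + 1) ∨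
   x = tF m (opC 4 c d) r (Nat.pair (2 * (2 * kl) + 1) (Nat.pair (2 * (2 * m + 1) + 1)
     (Nat.pair (2 * Nat.pair m g) (Nat.pair (2 * Nat.pair m h) r + 1) + 1) + 1) + 1))
def R6 (x y z : ℕ) : Prop := ∃ m, ∃ c, ∃ d, ∃ r, ∃ g, ∃ h, (y = tF m c g h ∧ z = tF m d r g) ∧
  x = tF m (opC 5 c d) r (Nat.pair 3 h + 1)
def R7 (x y : ℕ) : Prop := ∃ m, ∃ c, ∃ r, ∃ g, y = tF (m+1) c r g ∧ x = tF m (Nat.pair 5 c) r (Nat.pair 7 g + 1)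
def RR (x y z : ℕ) : Prop := R1 x y ∨ R2 x y ∨ R3 x y ∨ R4 x y z ∨ R5 x y z ∨ R6 x y z ∨ R7 x y
instance nd_BB : ND (m := 1) (fun v => BB (v 0)) := by unfold BB; infer_instance
instance nd_R1 : ND (m := 3) (fun v => R1 (v 0) (v 1)) := by unfold R1; infer_instance
instance nd_R2 : ND (m := 3) (fun v => R2 (v 0) (v 1)) := by unfold R2; infer_instance
instance nd_R3 : ND (m := 3) (fun v => R3 (v 0) (v 1)) := by unfold R3; infer_instance
instance nd_R4 : ND (m := 3) (fun v => R4 (v 0) (v 1) (v 2)) := by unfold R4; infer_instance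
instance nd_R5 : ND (m := 3) (fun v => R5 (v 0) (v 1) (v 2)) := by unfold R5; infer_instance
instance nd_R6 : ND (m := 3) (fun v => R6 (v 0) (v 1) (v 2)) := by unfold R6; infer_instance
instance nd_R7 : ND (m := 3) (fun v => R7 (v 0) (v 1)) := by unfold R7; infer_instance
instance nd_RR : ND (m := 3) (fun v => RR (v 0) (v 1) (v 2)) := by unfold RR; infer_instance

def Mean (x : ℕ) : Prop :=
  (∃ m, ∃ j : Fin m, x = tV m j (cV m j)) ∨
  (∃ m, ∃ t : LA.Term (Empty ⊕ Fin m), ∃ r, x = tT m (cT t) r (eA t.listEncode r)) ∨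
  (∃ m, ∃ φ : LA.BoundedFormula Empty m, ∃ r, x = tF m (cF φ) r (eA φ.listEncode r))
theorem Mean.v {m j c : ℕ} (h : Mean (tV m j c)) : ∃ i : Fin m, j = i ∧ c = cV m i := by
  rcases h with ⟨m', i, h⟩ | ⟨m', t, r, h⟩ | ⟨m', t, r, h⟩ <;>
    simp only [tV, tT, tF, Nat.pair_eq_pair] at h
  · obtain ⟨_, rfl, rfl, rfl⟩ := h; exact ⟨i, rfl, rfl⟩
  · omega
  · omega
theorem Mean.t {m c r g : ℕ} (h : Mean (tT m c r g)) : ∃ t : LA.Term (Empty ⊕ Fin m), c = cT t ∧ g = eA t.listEncode r := by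
  rcases h with ⟨m', i, h⟩ | ⟨m', t, r, h⟩ | ⟨m', t, r, h⟩ <;>
    simp only [tV, tT, tF, Nat.pair_eq_pair] at h
  · omega
  · obtain ⟨_, rfl, rfl, rfl, rfl⟩ := h; exact ⟨t, rfl, rfl⟩
  · omega
theorem Mean.f {m c r g : ℕ} (h : Mean (tF m c r g)) : ∃ t : LA.BoundedFormula Empty m, c = cF t ∧ g = eA t.listEncode r := by
  rcases h with ⟨m', i, h⟩ | ⟨m', t, r, h⟩ | ⟨m', t, r, h⟩ <;>
    simp only [tV, tT, tF, Nat.pair_eq_pair] at h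
  · omega
  · omega
  · obtain ⟨_, rfl, rfl, rfl, rfl⟩ := h; exact ⟨t, rfl, rfl⟩
theorem Mean.ofT {m r : ℕ} (t : LA.Term (Empty ⊕ Fin m)) : Mean (tT m (cT t) r (eA t.listEncode r)) :=
  Or.inr (Or.inl ⟨m, t, r, rfl⟩)
theorem Mean.ofF {m r : ℕ} (t : LA.BoundedFormula Empty m) : Mean (tF m (cF t) r (eA t.listEncode r)) :=
  Or.inr (Or.inr ⟨m, t, r, rfl⟩)

theorem der_mean {x : ℕ} (h : Der BB RR x) : Mean x := by
  induction h with
  | base h =>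
    rcases h with ⟨m, rfl⟩ | ⟨m, r, rfl⟩ | ⟨m, r, rfl⟩
    · exact Or.inl ⟨m+1, Fin.last m, by rw [cV_last]; rfl⟩
    · have := Mean.ofT (m := m) (r := r) zeroT
      rwa [cT_zero, eT_zero] at this
    · have := Mean.ofF (m := m) (r := r) ⊥
      rwa [cF_bot, eF_bot] at this
  | step _ _ h h1 h2 =>
    rcases h with ⟨m, j, c, rfl, rfl⟩ | ⟨m, j, c, r, rfl, rfl⟩ | ⟨m, c, r, g, rfl, rfl⟩ |
      ⟨m, c, d, r, g, h, ⟨rfl, rfl⟩, h3⟩ | ⟨m, c, d, r, g, h, ⟨rfl, rfl⟩, h3⟩ |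
      ⟨m, c, d, r, g, h, ⟨rfl, rfl⟩, rfl⟩ | ⟨m, c, r, g, rfl, rfl⟩
    · obtain ⟨i, rfl, rfl⟩ := h1.v
      exact Or.inl ⟨m+1, i.castSucc, by rw [cV_cast]; rfl⟩
    · obtain ⟨i, rfl, rfl⟩ := h1.v
      rw [← cT_v, ← eT_v]; exact Mean.ofT _
    · obtain ⟨t, rfl, rfl⟩ := h1.t
      rw [← cT_succ, ← eT_succ]; exact Mean.ofT _
    · obtain ⟨t, rfl, rfl⟩ := h1.t
      obtain ⟨u, rfl, rfl⟩ := h2.t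
      rcases h3 with rfl | rfl
      · rw [← cT_add, ← eT_add]; exact Mean.ofT _
      · rw [← cT_mul, ← eT_mul]; exact Mean.ofT _
    · obtain ⟨t, rfl, rfl⟩ := h1.t
      obtain ⟨u, rfl, rfl⟩ := h2.t
      rcases h3 with rfl | rfl
      · rw [← cF_eq, ← eF_eq]; exact Mean.ofF _
      · rw [← cF_le, ← eF_le]; exact Mean.ofF _
    · obtain ⟨t, rfl, rfl⟩ := h1.f
      obtain ⟨u, rfl, rfl⟩ := h2.f
      rw [← cF_imp, ← eF_imp]; exact Mean.ofF _
    · obtain ⟨t, rfl, rfl⟩ := h1.f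
      rw [← cF_all, ← eF_all]; exact Mean.ofF _

theorem der_v {m : ℕ} (j : Fin m) : Der BB RR (tV m j (cV m j)) := by
  induction m with
  | zero => exact j.elim0
  | succ m ih =>
    refine Fin.lastCases ?_ (fun j => ?_) j
    · rw [cV_last]; exact .base (Or.inl ⟨m, rfl⟩)
    · rw [cV_cast]; exact .step (ih j) (ih j) (Or.inl ⟨m, _, _, rfl, rfl⟩)
theorem der_t {m : ℕ} (t : LA.Term (Empty ⊕ Fin m)) : ∀ r, Der BB RR (tT m (cT t) r (eA t.listEncode r)) := by
  induction t using term_ind with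
  | hv i => intro r; rw [cT_v, eT_v]; exact .step (der_v i) (der_v i) (Or.inr (Or.inl ⟨_, _, _, _, rfl, rfl⟩))
  | hz => intro r; rw [cT_zero, eT_zero]; exact .base (Or.inr (Or.inl ⟨_, _, rfl⟩))
  | hs t h =>
    intro r; rw [cT_succ, eT_succ]
    exact .step (h r) (h r) (Or.inr (Or.inr (Or.inl ⟨_, _, _, _, rfl, rfl⟩)))
  | ha t u h h' =>
    intro r; rw [cT_add, eT_add]
    exact .step (h _) (h' r) (Or.inr (Or.inr (Or.inr (Or.inl ⟨_, _, _, _, _, _, ⟨rfl, rfl⟩, Or.inl rfl⟩))))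
  | hm t u h h' =>
    intro r; rw [cT_mul, eT_mul]
    exact .step (h _) (h' r) (Or.inr (Or.inr (Or.inr (Or.inl ⟨_, _, _, _, _, _, ⟨rfl, rfl⟩, Or.inr rfl⟩))))
theorem der_f {m : ℕ} (φ : LA.BoundedFormula Empty m) : ∀ r, Der BB RR (tF m (cF φ) r (eA φ.listEncode r)) := by
  refine fml_ind (P := fun {m} φ => ∀ r, Der BB RR (tF m (cF φ) r (eA φ.listEncode r))) ?_ ?_ ?_ ?_ ?_ φ
  · intro m r; rw [cF_bot, eF_bot]; exact .base (Or.inr (Or.inr ⟨_, _, rfl⟩))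
  · intro m t u r; rw [cF_eq, eF_eq]
    exact .step (der_t t 0) (der_t u 0) (Or.inr (Or.inr (Or.inr (Or.inr (Or.inl
      ⟨_, _, _, _, _, _, ⟨rfl, rfl⟩, Or.inl rfl⟩)))))
  · intro m t u r; rw [cF_le, eF_le]
    exact .step (der_t t 0) (der_t u 0) (Or.inr (Or.inr (Or.inr (Or.inr (Or.inl
      ⟨_, _, _, _, _, _, ⟨rfl, rfl⟩, Or.inr rfl⟩)))))
  · intro m φ ψ h h' r; rw [cF_imp, eF_imp]
    exact .step (h _) (h' r) (Or.inr (Or.inr (Or.inr (Or.inr (Or.inr (Or.inl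
      ⟨_, _, _, _, _, _, ⟨rfl, rfl⟩, rfl⟩))))))
  · intro m φ h r; rw [cF_all, eF_all]
    exact .step (h r) (h r) (Or.inr (Or.inr (Or.inr (Or.inr (Or.inr (Or.inr
      ⟨_, _, _, _, rfl, rfl⟩))))))

theorem gnum_eq (φ : Snt) : gnum φ = eA φ.listEncode 0 := by rw [eA_zero]; rfl
theorem gnum_inj {φ ψ : Snt} (h : gnum φ = gnum ψ) : φ = ψ := by
  have h1 := Encodable.encode_injective h
  have h2 := BoundedFormula.encoding.encode_injective h1
  simpa using h2

def Ax (T : Thy) (k : ℕ) : Prop := ∃ τ ∈ T, k = cF τ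
theorem nd_Ax {T : Thy} (hT : CompThy T) {m : ℕ} (f : (Fin m → ℕ) → ℕ) [NF f] : ND (fun v => Ax T (f v)) := by
  refine ND.sub1 ?_ f
  have h1 : ∀ {m : ℕ} (f : (Fin m → ℕ) → ℕ) [NF f], ND (fun v => ∃ φ ∈ T, gnum φ = f v) :=
    fun f => Nat.nd1 hT f
  have h2 : ∀ {m : ℕ} (f : (Fin m → ℕ) → ℕ) [NF f], ND (fun v => Der BB RR (f v)) :=
    fun f => Der.nd nd_BB nd_RR f
  have h3 := h1 (m := 2) (fun v => v 1)
  have h4 := h2 (m := 2) (fun v => tF 0 (v 0) 0 (v 1))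
  refine ND.congr (ND.ex (m := 1) (R := fun v g => (∃ φ ∈ T, gnum φ = g) ∧ Der BB RR (tF 0 (v 0) 0 g)) (h := ND.and (hP := h3) (hQ := h4))) ?_
  intro v
  generalize v 0 = k
  constructor
  · rintro ⟨τ, hτ, rfl⟩
    exact ⟨gnum τ, ⟨τ, hτ, rfl⟩, by rw [gnum_eq]; exact der_f τ 0⟩
  · rintro ⟨g, ⟨φ, hφ, rfl⟩, h⟩
    obtain ⟨ψ, rfl, h'⟩ := (der_mean h).f
    rw [← gnum_eq] at h'
    exact ⟨φ, hφ, by rw [gnum_inj h']⟩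

set_option synthInstance.maxSize 4000
set_option synthInstance.maxHeartbeats 800000

/-- name for the value of the `i`-th operation at two names -/
def hO (i a b : ℕ) : ℕ := Nat.pair (Nat.pair 1 i) (Nat.pair (Nat.pair 0 a) b)
/-- a clause of the Herbrand system is violated (`W`: made true, `F`: made false) -/
inductive Bad (X : ℕ → Prop) (g : ℕ) (W F : ℕ → ℕ → Prop) : Prop
  | c0 (a : ℕ) : F a a → Bad X g W F
  | c1 (a b c : ℕ) : W a b → W a c → F b c → Bad X g W F
  | c2 (i a b c d : ℕ) : W a c → W b d → F (hO i a b) (hO i c d) → Bad X g W F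
  | c3 (e : ℕ) : F (Nat.pair 0 e) 0 → Bad X g W F
  | c4 (e : ℕ) : F (Nat.pair (Nat.pair 7 0) e) 0 → Bad X g W F
  | c5 (b e : ℕ) : F (Nat.pair (Nat.pair 7 (b+1)) e) (hO 0 0 (Nat.pair (Nat.pair 7 b) e)) → Bad X g W F
  | c6 (e x : ℕ) : F (Nat.pair (Nat.pair 2 0) (Nat.pair e x)) x → Bad X g W F
  | c7 (q e x : ℕ) : F (Nat.pair (Nat.pair 3 q) (Nat.pair e x)) (Nat.pair q e) → Bad X g W F
  | c8 (i q r e : ℕ) : F (Nat.pair (opC i q r) e) (hO i (Nat.pair q e) (Nat.pair r e)) → Bad X g W F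
  | c9 (a b : ℕ) : W (hO 3 a b) 0 → W a b → Bad X g W F
  | c10 (a b : ℕ) : F (hO 3 a b) 0 → F a b → Bad X g W F
  | c11 (a b : ℕ) : W (hO 5 a b) 0 → W a 0 → Bad X g W F
  | c12 (a b : ℕ) : W (hO 5 a b) 0 → F b 0 → Bad X g W F
  | c13 (a b : ℕ) : W b 0 → F (hO 5 a b) 0 → F a 0 → Bad X g W F
  | c14 (q e x : ℕ) : W (Nat.pair q (Nat.pair e x)) 0 → F (Nat.pair (Nat.pair 5 q) e) 0 → Bad X g W F
  | c15 (q e : ℕ) : W (Nat.pair (Nat.pair 5 q) e) 0 → F (Nat.pair q (Nat.pair e (Nat.pair (Nat.pair 6 q) e))) 0 → Bad X g W F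
  | c16 (k : ℕ) : X k → W (Nat.pair k 0) 0 → Bad X g W F
  | c17 : W g 0 → Bad X g W F

theorem Bad.mono {X : ℕ → Prop} {g : ℕ} {W F W' F' : ℕ → ℕ → Prop} (hW : ∀ a b, W a b → W' a b) (hF : ∀ a b, F a b → F' a b)
    (h : Bad X g W F) : Bad X g W' F' := by
  cases h with
  | c0 a h0 => exact .c0 _ (hF _ _ h0)
  | c1 a b c h0 h1 h2 => exact .c1 _ _ _ (hW _ _ h0) (hW _ _ h1) (hF _ _ h2)
  | c2 i a b c d h0 h1 h2 => exact .c2 _ _ _ _ _ (hW _ _ h0) (hW _ _ h1) (hF _ _ h2)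
  | c3 e h0 => exact .c3 _ (hF _ _ h0)
  | c4 e h0 => exact .c4 _ (hF _ _ h0)
  | c5 b e h0 => exact .c5 _ _ (hF _ _ h0)
  | c6 e x h0 => exact .c6 _ _ (hF _ _ h0)
  | c7 q e x h0 => exact .c7 _ _ _ (hF _ _ h0)
  | c8 i q r e h0 => exact .c8 _ _ _ _ (hF _ _ h0)
  | c9 a b h0 h1 => exact .c9 _ _ (hW _ _ h0) (hW _ _ h1)
  | c10 a b h0 h1 => exact .c10 _ _ (hF _ _ h0) (hF _ _ h1)
  | c11 a b h0 h1 => exact .c11 _ _ (hW _ _ h0) (hW _ _ h1)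
  | c12 a b h0 h1 => exact .c12 _ _ (hW _ _ h0) (hF _ _ h1)
  | c13 a b h0 h1 h2 => exact .c13 _ _ (hW _ _ h0) (hF _ _ h1) (hF _ _ h2)
  | c14 q e x h0 h1 => exact .c14 _ _ _ (hW _ _ h0) (hF _ _ h1)
  | c15 q e h0 h1 => exact .c15 _ _ (hW _ _ h0) (hF _ _ h1)
  | c16 k h0 h1 => exact .c16 _ h0 (hW _ _ h1)
  | c17 h0 => exact .c17 (hW _ _ h0)

theorem Bad.eventually {X : ℕ → Prop} {g : ℕ} {W F : ℕ → ℕ → Prop} {l : Filter ℕ} {W' F' : ℕ → ℕ → ℕ → Prop}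
    (hW : ∀ a b, W a b → ∀ᶠ d in l, W' d a b) (hF : ∀ a b, F a b → ∀ᶠ d in l, F' d a b)
    (h : Bad X g W F) : ∀ᶠ d in l, Bad X g (W' d) (F' d) := by
  cases h with
  | c0 a h0 => filter_upwards [hF _ _ h0] with d k0; exact .c0 _ k0
  | c1 a b c h0 h1 h2 => filter_upwards [hW _ _ h0, hW _ _ h1, hF _ _ h2] with d k0 k1 k2; exact .c1 _ _ _ k0 k1 k2
  | c2 i a b c d h0 h1 h2 => filter_upwards [hW _ _ h0, hW _ _ h1, hF _ _ h2] with d k0 k1 k2; exact .c2 _ _ _ _ _ k0 k1 k2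
  | c3 e h0 => filter_upwards [hF _ _ h0] with d k0; exact .c3 _ k0
  | c4 e h0 => filter_upwards [hF _ _ h0] with d k0; exact .c4 _ k0
  | c5 b e h0 => filter_upwards [hF _ _ h0] with d k0; exact .c5 _ _ k0
  | c6 e x h0 => filter_upwards [hF _ _ h0] with d k0; exact .c6 _ _ k0
  | c7 q e x h0 => filter_upwards [hF _ _ h0] with d k0; exact .c7 _ _ _ k0
  | c8 i q r e h0 => filter_upwards [hF _ _ h0] with d k0; exact .c8 _ _ _ _ k0
  | c9 a b h0 h1 => filter_upwards [hW _ _ h0, hW _ _ h1] with d k0 k1; exact .c9 _ _ k0 k1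
  | c10 a b h0 h1 => filter_upwards [hF _ _ h0, hF _ _ h1] with d k0 k1; exact .c10 _ _ k0 k1
  | c11 a b h0 h1 => filter_upwards [hW _ _ h0, hW _ _ h1] with d k0 k1; exact .c11 _ _ k0 k1
  | c12 a b h0 h1 => filter_upwards [hW _ _ h0, hF _ _ h1] with d k0 k1; exact .c12 _ _ k0 k1
  | c13 a b h0 h1 h2 => filter_upwards [hW _ _ h0, hF _ _ h1, hF _ _ h2] with d k0 k1 k2; exact .c13 _ _ k0 k1 k2
  | c14 q e x h0 h1 => filter_upwards [hW _ _ h0, hF _ _ h1] with d k0 k1; exact .c14 _ _ _ k0 k1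
  | c15 q e h0 h1 => filter_upwards [hW _ _ h0, hF _ _ h1] with d k0 k1; exact .c15 _ _ k0 k1
  | c16 k h0 h1 => filter_upwards [hW _ _ h1] with d k0; exact .c16 _ h0 k0
  | c17 h0 => filter_upwards [hW _ _ h0] with d k0; exact .c17 k0

theorem Bad_iff {X : ℕ → Prop} {g : ℕ} {W F : ℕ → ℕ → Prop} : Bad X g W F ↔
    (∃ a, F a a) ∨
    (∃ a, ∃ b, ∃ c, W a b ∧ W a c ∧ F b c) ∨
    (∃ i, ∃ a, ∃ b, ∃ c, ∃ d, W a c ∧ W b d ∧ F (hO i a b) (hO i c d)) ∨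
    (∃ e, F (Nat.pair 0 e) 0) ∨
    (∃ e, F (Nat.pair (Nat.pair 7 0) e) 0) ∨
    (∃ b, ∃ e, F (Nat.pair (Nat.pair 7 (b+1)) e) (hO 0 0 (Nat.pair (Nat.pair 7 b) e))) ∨
    (∃ e, ∃ x, F (Nat.pair (Nat.pair 2 0) (Nat.pair e x)) x) ∨
    (∃ q, ∃ e, ∃ x, F (Nat.pair (Nat.pair 3 q) (Nat.pair e x)) (Nat.pair q e)) ∨
    (∃ i, ∃ q, ∃ r, ∃ e, F (Nat.pair (opC i q r) e) (hO i (Nat.pair q e) (Nat.pair r e))) ∨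
    (∃ a, ∃ b, W (hO 3 a b) 0 ∧ W a b) ∨
    (∃ a, ∃ b, F (hO 3 a b) 0 ∧ F a b) ∨
    (∃ a, ∃ b, W (hO 5 a b) 0 ∧ W a 0) ∨
    (∃ a, ∃ b, W (hO 5 a b) 0 ∧ F b 0) ∨
    (∃ a, ∃ b, W b 0 ∧ F (hO 5 a b) 0 ∧ F a 0) ∨
    (∃ q, ∃ e, ∃ x, W (Nat.pair q (Nat.pair e x)) 0 ∧ F (Nat.pair (Nat.pair 5 q) e) 0) ∨
    (∃ q, ∃ e, W (Nat.pair (Nat.pair 5 q) e) 0 ∧ F (Nat.pair q (Nat.pair e (Nat.pair (Nat.pair 6 q) e))) 0) ∨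
    (∃ k, X k ∧ W (Nat.pair k 0) 0) ∨
    (W g 0) := by
  constructor
  · intro h
    cases h with
    | c0 a h0 => exact Or.inl ⟨a, h0⟩
    | c1 a b c h0 h1 h2 => exact Or.inr (Or.inl ⟨a, b, c, h0, h1, h2⟩)
    | c2 i a b c d h0 h1 h2 => exact Or.inr (Or.inr (Or.inl ⟨i, a, b, c, d, h0, h1, h2⟩))
    | c3 e h0 => exact Or.inr (Or.inr (Or.inr (Or.inl ⟨e, h0⟩)))
    | c4 e h0 => exact Or.inr (Or.inr (Or.inr (Or.inr (Or.inl ⟨e, h0⟩))))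
    | c5 b e h0 => exact Or.inr (Or.inr (Or.inr (Or.inr (Or.inr (Or.inl ⟨b, e, h0⟩)))))
    | c6 e x h0 => exact Or.inr (Or.inr (Or.inr (Or.inr (Or.inr (Or.inr (Or.inl ⟨e, x, h0⟩))))))
    | c7 q e x h0 => exact Or.inr (Or.inr (Or.inr (Or.inr (Or.inr (Or.inr (Or.inr (Or.inl ⟨q, e, x, h0⟩)))))))
    | c8 i q r e h0 => exact Or.inr (Or.inr (Or.inr (Or.inr (Or.inr (Or.inr (Or.inr (Or.inr (Or.inl ⟨i, q, r, e, h0⟩))))))))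
    | c9 a b h0 h1 => exact Or.inr (Or.inr (Or.inr (Or.inr (Or.inr (Or.inr (Or.inr (Or.inr (Or.inr (Or.inl ⟨a, b, h0, h1⟩)))))))))
    | c10 a b h0 h1 => exact Or.inr (Or.inr (Or.inr (Or.inr (Or.inr (Or.inr (Or.inr (Or.inr (Or.inr (Or.inr (Or.inl ⟨a, b, h0, h1⟩))))))))))
    | c11 a b h0 h1 => exact Or.inr (Or.inr (Or.inr (Or.inr (Or.inr (Or.inr (Or.inr (Or.inr (Or.inr (Or.inr (Or.inr (Or.inl ⟨a, b, h0, h1⟩)))))))))))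
    | c12 a b h0 h1 => exact Or.inr (Or.inr (Or.inr (Or.inr (Or.inr (Or.inr (Or.inr (Or.inr (Or.inr (Or.inr (Or.inr (Or.inr (Or.inl ⟨a, b, h0, h1⟩))))))))))))
    | c13 a b h0 h1 h2 => exact Or.inr (Or.inr (Or.inr (Or.inr (Or.inr (Or.inr (Or.inr (Or.inr (Or.inr (Or.inr (Or.inr (Or.inr (Or.inr (Or.inl ⟨a, b, h0, h1, h2⟩)))))))))))))
    | c14 q e x h0 h1 => exact Or.inr (Or.inr (Or.inr (Or.inr (Or.inr (Or.inr (Or.inr (Or.inr (Or.inr (Or.inr (Or.inr (Or.inr (Or.inr (Or.inr (Or.inl ⟨q, e, x, h0, h1⟩))))))))))))))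
    | c15 q e h0 h1 => exact Or.inr (Or.inr (Or.inr (Or.inr (Or.inr (Or.inr (Or.inr (Or.inr (Or.inr (Or.inr (Or.inr (Or.inr (Or.inr (Or.inr (Or.inr (Or.inl ⟨q, e, h0, h1⟩)))))))))))))))
    | c16 k h0 h1 => exact Or.inr (Or.inr (Or.inr (Or.inr (Or.inr (Or.inr (Or.inr (Or.inr (Or.inr (Or.inr (Or.inr (Or.inr (Or.inr (Or.inr (Or.inr (Or.inr (Or.inl ⟨k, h0, h1⟩))))))))))))))))
    | c17 h0 => exact Or.inr (Or.inr (Or.inr (Or.inr (Or.inr (Or.inr (Or.inr (Or.inr (Or.inr (Or.inr (Or.inr (Or.inr (Or.inr (Or.inr (Or.inr (Or.inr (Or.inr (h0)))))))))))))))))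
  · rintro (⟨a, h0⟩ | ⟨a, b, c, h0, h1, h2⟩ | ⟨i, a, b, c, d, h0, h1, h2⟩ | ⟨e, h0⟩ | ⟨e, h0⟩ | ⟨b, e, h0⟩ | ⟨e, x, h0⟩ | ⟨q, e, x, h0⟩ | ⟨i, q, r, e, h0⟩ | ⟨a, b, h0, h1⟩ | ⟨a, b, h0, h1⟩ | ⟨a, b, h0, h1⟩ | ⟨a, b, h0, h1⟩ | ⟨a, b, h0, h1, h2⟩ | ⟨q, e, x, h0, h1⟩ | ⟨q, e, h0, h1⟩ | ⟨k, h0, h1⟩ | h0)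
    · exact .c0 _ h0
    · exact .c1 _ _ _ h0 h1 h2
    · exact .c2 _ _ _ _ _ h0 h1 h2
    · exact .c3 _ h0
    · exact .c4 _ h0
    · exact .c5 _ _ h0
    · exact .c6 _ _ h0
    · exact .c7 _ _ _ h0
    · exact .c8 _ _ _ _ h0
    · exact .c9 _ _ h0 h1
    · exact .c10 _ _ h0 h1
    · exact .c11 _ _ h0 h1
    · exact .c12 _ _ h0 h1
    · exact .c13 _ _ h0 h1 h2
    · exact .c14 _ _ _ h0 h1
    · exact .c15 _ _ h0 h1
    · exact .c16 _ h0 h1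
    · exact .c17 h0

instance NF.hO {m : ℕ} (f g h : (Fin m → ℕ) → ℕ) [NF f] [NF g] [NF h] : NF (fun v => hO (f v) (g v) (h v)) :=
  inferInstanceAs (NF (fun v => Nat.pair (Nat.pair 1 (f v)) (Nat.pair (Nat.pair 0 (g v)) (h v))))

def bW (s d a b : ℕ) : Prop := Nat.pair a b < d ∧ bit s (Nat.pair a b) = 1
def bF (s d a b : ℕ) : Prop := Nat.pair a b < d ∧ bit s (Nat.pair a b) = 0
instance ND.bW {m : ℕ} (f g h k : (Fin m → ℕ) → ℕ) [NF f] [NF g] [NF h] [NF k] : ND (fun v => bW (f v) (g v) (h v) (k v)) :=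
  inferInstanceAs (ND (fun v => Nat.pair (h v) (k v) < g v ∧ Guaspari.bit (f v) (Nat.pair (h v) (k v)) = 1))
instance ND.bF {m : ℕ} (f g h k : (Fin m → ℕ) → ℕ) [NF f] [NF g] [NF h] [NF k] : ND (fun v => bF (f v) (g v) (h v) (k v)) :=
  inferInstanceAs (ND (fun v => Nat.pair (h v) (k v) < g v ∧ Guaspari.bit (f v) (Nat.pair (h v) (k v)) = 0))

theorem Bad.nd {X : ℕ → Prop} (hX : ND (m := 1) (fun v => X (v 0))) :
    ND (m := 3) (fun v => Bad X (v 0) (bW (v 2) (v 1)) (bF (v 2) (v 1))) := by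
  have hX4 : ND (m := 4) (fun v => X (v 3)) := ND.sub1 hX (fun v => v 3)
  have : ∀ {m : ℕ} (f : (Fin m → ℕ) → ℕ) [NF f], ND (fun v => X (f v)) := fun f _ => ND.sub1 hX f
  simp only [Bad_iff]
  repeat' refine ND.or (hP := ?_) (hQ := ?_)
  all_goals infer_instance

/-- the Herbrand system is unsatisfiable -/
def Uns (X : ℕ → Prop) (g : ℕ) : Prop := ∃ d, ∀ s, s < 2 ^ d → Bad X g (bW s d) (bF s d)
theorem Uns.nd {X : ℕ → Prop} (hX : ND (m := 1) (fun v => X (v 0))) {m : ℕ} (f : (Fin m → ℕ) → ℕ) [NF f] :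
    ND (fun v => Uns X (f v)) := by
  refine ND.sub1 ?_ f
  have h := Bad.nd hX
  have : ND (m := 2) (fun v => ∀ s, s < 2 ^ (v 1) → Bad X (v 0) (bW s (v 1)) (bF s (v 1))) :=
    ND.ballt (R := fun v s => Bad X (v 0) (bW s (v 1)) (bF s (v 1))) (f := fun v => 2 ^ (v 1)) (h := h)
  exact ND.ex (m := 1) (R := fun v d => ∀ s, s < 2 ^ d → Bad X (v 0) (bW s d) (bF s d)) (h := this)


theorem bit_one (s x : ℕ) : bit s x = 1 ↔ s.testBit x = true := by
  rw [bit_eq]; cases s.testBit x <;> simp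
theorem bit_zero (s x : ℕ) : bit s x = 0 ↔ s.testBit x = false := by
  rw [bit_eq]; cases s.testBit x <;> simp

theorem Uns_of {X : ℕ → Prop} {g : ℕ} (h : ∀ w : ℕ → ℕ → Prop, Bad X g w (fun a b => ¬ w a b)) : Uns X g := by
  by_contra hc
  unfold Uns at hc
  push Not at hc
  choose s hs hb using hc
  have hl : ∀ᶠ d in (Filter.hyperfilter ℕ : Filter ℕ), Bad X g (bW (s d) d) (bF (s d) d) := by
    have hlt : ∀ x : ℕ, ∀ᶠ d in (Filter.hyperfilter ℕ : Filter ℕ), x < d := fun x => by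
      have h1 : ∀ᶠ d in Filter.atTop, x < d := Filter.eventually_gt_atTop x
      rw [← Nat.cofinite_eq_atTop] at h1
      exact Filter.hyperfilter_le_cofinite h1
    refine Bad.eventually ?_ ?_ (h (fun a b => ∀ᶠ d in (Filter.hyperfilter ℕ : Filter ℕ), bit (s d) (Nat.pair a b) = 1))
    · intro a b hab
      filter_upwards [hab, hlt (Nat.pair a b)] with d h1 h2
      exact ⟨h2, h1⟩
    · intro a b hab
      have hab' := Ultrafilter.eventually_not.2 hab
      filter_upwards [hab', hlt (Nat.pair a b)] with d h1 h2
      refine ⟨h2, ?_⟩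
      rw [bit_zero]; rw [bit_one] at h1; simpa using h1
  obtain ⟨d, hd⟩ := hl.exists
  exact hb d hd

open Classical in
theorem of_Uns {X : ℕ → Prop} {g : ℕ} (h : Uns X g) (w : ℕ → ℕ → Prop) : Bad X g w (fun a b => ¬ w a b) := by
  obtain ⟨d, hd⟩ := h
  let f : Fin d → Bool := fun i => decide (w (i:ℕ).unpair.1 (i:ℕ).unpair.2)
  have := hd (Nat.ofBits f) (Nat.ofBits_lt_two_pow f)
  refine this.mono ?_ ?_
  · rintro a b ⟨h1, h2⟩
    rw [bit_one, Nat.testBit_ofBits_lt f _ h1] at h2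
    simpa [f] using h2
  · rintro a b ⟨h1, h2⟩
    rw [bit_zero, Nat.testBit_ofBits_lt f _ h1] at h2
    simpa [f] using h2

/-- environments as streams of values -/
theorem herb {K : Type} [LA.Structure K] (z : K) (op : ℕ → K → K → K)
    (h0 : Structure.funMap (L := LA) (show LA.Functions 0 from Unit.unit) ![] = z)
    (h1 : ∀ a, Structure.funMap (L := LA) (show LA.Functions 1 from Unit.unit) ![a] = op 0 z a)
    (h2 : ∀ a b, Structure.funMap (L := LA) (show LA.Functions 2 from false) ![a, b] = op 1 a b)
    (h3 : ∀ a b, Structure.funMap (L := LA) (show LA.Functions 2 from true) ![a, b] = op 2 a b)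
    (h4 : ∀ a b, a = b ↔ op 3 a b ≠ z)
    (h5 : ∀ a b, Structure.RelMap (L := LA) (show LA.Relations 2 from Unit.unit) ![a, b] ↔ op 4 a b ≠ z)
    (h6 : ∀ a b, op 5 a b ≠ z ↔ (a ≠ z → b ≠ z))
    {E N : Type} (top : E → K) (pop : E → E) (push : E → N → E) (nm : N → K) (hN : Function.Surjective nm)
    (t1 : ∀ e x, top (push e x) = nm x) (t2 : ∀ e x, pop (push e x) = e)
    (ev : ℕ → E → K) (e0 : ∀ e, ev 0 e = z) (e2 : ∀ e, ev (Nat.pair 2 0) e = top e)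
    (e3 : ∀ q e, ev (Nat.pair 3 q) e = ev q (pop e))
    (e4 : ∀ i q r e, ev (opC i q r) e = op i (ev q e) (ev r e))
    (e5 : ∀ q e, ev (Nat.pair 5 q) e ≠ z ↔ ∀ x, ev q (push e x) ≠ z)
    (A : ∀ m, E → Fin m → K) (hA : ∀ m e, A (m+1) e = Fin.snoc (α := fun _ => K) (A m (pop e)) (top e))
    {m : ℕ} (φ : LA.BoundedFormula Empty m) : ∀ e : E, φ.Realize default (A m e) ↔ ev (cF φ) e ≠ z := by
  have hV : ∀ m (i : Fin m) e, A m e i = ev (cV m i) e := by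
    intro m
    induction m with
    | zero => exact fun i => i.elim0
    | succ m ih =>
      intro i e
      refine Fin.lastCases ?_ (fun j => ?_) i
      · rw [hA, cV_last, e2, Fin.snoc_last]
      · rw [hA, cV_cast, e3, Fin.snoc_castSucc, ih]
  have hT : ∀ m (t : LA.Term (Empty ⊕ Fin m)) e, t.realize (Sum.elim default (A m e)) = ev (cT t) e := by
    intro m t e
    refine term_ind (P := fun t => t.realize (Sum.elim default (A m e)) = ev (cT t) e) ?_ ?_ ?_ ?_ ?_ t
    · intro i; rw [realize_vT', hV, cT_v]
    · rw [realize_zeroT', cT_zero, e0, h0]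
    · intro t ht; rw [realize_succT', cT_succ, e4, h1, ht, e0]
    · intro t u ht hu; rw [realize_addT', cT_add, e4, h2, ht, hu]
    · intro t u ht hu; rw [realize_mulT', cT_mul, e4, h3, ht, hu]
  refine fml_ind (P := fun {m} φ => ∀ e : E, φ.Realize default (A m e) ↔ ev (cF φ) e ≠ z) ?_ ?_ ?_ ?_ ?_ φ
  · intro m e; rw [cF_bot, e0]; simp
  · intro m t u e; rw [BoundedFormula.realize_bdEqual, hT, hT, cF_eq, e4, h4]
  · intro m t u e; rw [realize_leF', hT, hT, cF_le, e4, h5]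
  · intro m φ ψ hφ hψ e; rw [BoundedFormula.realize_imp, hφ, hψ, cF_imp, e4, h6]
  · intro m φ hφ e
    rw [BoundedFormula.realize_all, cF_all, e5, hN.forall]
    refine forall_congr' fun x => ?_
    rw [← hφ (push e x), hA, t1, t2]


def nN (b : ℕ) : ℕ := Nat.pair (Nat.pair 7 b) 0
def gName (c y k : ℕ) : ℕ := Nat.pair c (Nat.pair (Nat.pair 0 (nN y)) (nN k))

section sound
open Classical in
/-- the operations in a model -/
noncomputable def mop (K : Mod) (i : ℕ) (a b : K) : K :=
  if i = 0 then b + 1 else if i = 1 then a + b else if i = 2 then a * b else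
  if i = 3 then (if a = b then 1 else 0) else if i = 4 then (if a ≤ b then 1 else 0) else
  if (a ≠ 0 → b ≠ 0) then 1 else 0

theorem lt_pair_right' {k b : ℕ} (h : 0 < k) : b < Nat.pair k b :=
  lt_of_le_of_lt (Nat.right_le_pair 0 b) (Nat.pair_lt_pair_left b h)
theorem unpair_snd_lt {p : ℕ} (h : 0 < p.unpair.1) : p.unpair.2 < p := by
  have := lt_pair_right' (b := p.unpair.2) h
  rwa [Nat.pair_unpair] at this

/-- extend a stream -/
def scons {K : Type} (x : K) (s : ℕ → K) : ℕ → K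
  | 0 => x
  | i+1 => s i

open Classical in
/-- value of a code in a model -/
noncomputable def sem (K : Mod) (p : ℕ) (s : ℕ → K) : K :=
  if p.unpair.1 = 1 then mop K p.unpair.2 (s 1) (s 0)
  else if p.unpair.1 = 2 then s 0
  else if h : p.unpair.1 = 3 then
    have : p.unpair.2 < p := unpair_snd_lt (by omega)
    sem K p.unpair.2 (fun i => s (i+1))
  else if h : p.unpair.1 = 4 then
    have h0 : p.unpair.2 < p := unpair_snd_lt (by omega)
    have h1 : p.unpair.2.unpair.2.unpair.1 < p :=
      lt_of_le_of_lt (Nat.unpair_left_le _) (lt_of_le_of_lt (Nat.unpair_right_le _) h0)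
    have h2 : p.unpair.2.unpair.2.unpair.2 < p :=
      lt_of_le_of_lt (Nat.unpair_right_le _) (lt_of_le_of_lt (Nat.unpair_right_le _) h0)
    mop K p.unpair.2.unpair.1 (sem K p.unpair.2.unpair.2.unpair.1 s) (sem K p.unpair.2.unpair.2.unpair.2 s)
  else if h : p.unpair.1 = 5 then
    have : p.unpair.2 < p := unpair_snd_lt (by omega)
    if ∀ x, sem K p.unpair.2 (scons x s) ≠ 0 then 1 else 0
  else if h : p.unpair.1 = 6 then
    have : p.unpair.2 < p := unpair_snd_lt (by omega)
    if h : ∃ x, sem K p.unpair.2 (scons x s) = 0 then Classical.choose h else 0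
  else if p.unpair.1 = 7 then (p.unpair.2 : K)
  else 0
termination_by p

variable {K : Mod}
theorem sem0 (s : ℕ → K) : sem K 0 s = 0 := by rw [sem]; simp
theorem sem1 (i) (s : ℕ → K) : sem K (Nat.pair 1 i) s = mop K i (s 1) (s 0) := by rw [sem]; simp
theorem sem2 (i) (s : ℕ → K) : sem K (Nat.pair 2 i) s = s 0 := by rw [sem]; simp
theorem sem3 (i) (s : ℕ → K) : sem K (Nat.pair 3 i) s = sem K i (fun i => s (i+1)) := by rw [sem]; simp
theorem sem4 (i q r) (s : ℕ → K) : sem K (opC i q r) s = mop K i (sem K q s) (sem K r s) := by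
  rw [sem]; simp [opC]
theorem one_ne (K : Mod) : (1 : K) ≠ 0 := by
  have := one_add_ne (M := K)
  simp at this ⊢
theorem sem5 (q) (s : ℕ → K) : sem K (Nat.pair 5 q) s = 0 ↔ ∃ x, sem K q (scons x s) = 0 := by
  rw [sem]; simp
theorem sem6 (q) (s : ℕ → K) (h : ∃ x, sem K q (scons x s) = 0) :
    sem K q (scons (sem K (Nat.pair 6 q) s) s) = 0 := by
  have e : sem K (Nat.pair 6 q) s = Classical.choose h := by
    rw [sem]; simp [h]
  rw [e]; exact Classical.choose_spec h
theorem sem7 (b) (s : ℕ → K) : sem K (Nat.pair 7 b) s = b := by rw [sem]; simp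

/-- entry of a coded environment -/
def eget : ℕ → ℕ → ℕ
  | e, 0 => e.unpair.2
  | e, i+1 => eget e.unpair.1 i
theorem eget_le (e i : ℕ) : eget e i ≤ e := by
  induction i generalizing e with
  | zero => exact Nat.unpair_right_le e
  | succ i ih => exact (ih _).trans (Nat.unpair_left_le e)

/-- value of a name in a model -/
noncomputable def nval (K : Mod) (n : ℕ) : K :=
  if h : 0 < n.unpair.1 then
    sem K n.unpair.1 (fun i =>
      have : eget n.unpair.2 i < n := lt_of_le_of_lt (eget_le _ _) (unpair_snd_lt h)
      nval K (eget n.unpair.2 i))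
  else 0
termination_by n
noncomputable def nstr (K : Mod) (e : ℕ) : ℕ → K := fun i => nval K (eget e i)
theorem nval_pair (p e) : nval K (Nat.pair p e) = sem K p (nstr K e) := by
  rw [nval]
  simp only [Nat.unpair_pair]
  split_ifs with h
  · rfl
  · rw [show p = 0 by omega, sem0]
theorem nstr_zero (e x) : nstr K (Nat.pair e x) 0 = nval K x := by simp [nstr, eget]
theorem nstr_succ (e x i) : nstr K (Nat.pair e x) (i+1) = nstr K e i := by simp [nstr, eget]
theorem nstr_pair (e x) : nstr K (Nat.pair e x) = scons (nval K x) (nstr K e) := by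
  funext i; cases i
  · exact nstr_zero _ _
  · exact nstr_succ _ _ _
theorem nval_zero : nval K 0 = 0 := by rw [show 0 = Nat.pair 0 0 from rfl, nval_pair, sem0]
theorem nval_hO (i a b) : nval K (hO i a b) = mop K i (nval K a) (nval K b) := by
  rw [hO, nval_pair, sem1, nstr_pair, nstr_pair]; rfl

/-- first `m` entries of a stream as a valuation -/
def sA {K : Type} : ∀ m, (ℕ → K) → Fin m → K
  | 0, _ => Fin.elim0
  | m+1, s => Fin.snoc (α := fun _ => K) (sA m (fun i => s (i+1))) (s 0)

theorem sem_real {m : ℕ} (φ : LA.BoundedFormula Empty m) (s : ℕ → K) :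
    φ.Realize default (sA m s) ↔ sem K (cF φ) s ≠ 0 := by
  refine herb (K := K) 0 (mop K) rfl ?_ ?_ ?_ ?_ ?_ ?_ (fun s => s 0) (fun s i => s (i+1)) (fun s x => scons x s)
    (fun x => x) Function.surjective_id (fun _ _ => rfl) (fun _ _ => rfl) (sem K) sem0 (sem2 0) sem3 sem4 ?_ sA
    (fun _ _ => rfl) φ s
  · intro a; exact sc_eq a
  · intro a b; simp [mop]; rfl
  · intro a b; simp [mop]; rfl
  · intro a b; simp [mop]
  · intro a b; simp [mop]; rfl
  · intro a b; simp [mop]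
  · intro q e; rw [ne_eq, sem5]; push Not; rfl

theorem sat_of_model {T : Thy} (hT : ∀ τ ∈ T, Sentence.Realize K τ) (γ : LA.BoundedFormula Empty 2) (y k : ℕ)
    (h : γ.Realize default ![(y : K), (k : K)]) :
    ¬ Bad (Ax T) (gName (cF γ) y k) (fun a b => nval K a = nval K b) (fun a b => ¬ nval K a = nval K b) := by
  intro hB
  cases hB with
  | c0 a h0 => exact h0 rfl
  | c1 a b c h0 h1 h2 => exact h2 (h0.symm.trans h1)
  | c2 i a b c d h0 h1 h2 => exact h2 (by rw [nval_hO, nval_hO, h0, h1])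
  | c3 e h0 => exact h0 (by rw [nval_pair, sem0, nval_zero])
  | c4 e h0 => exact h0 (by rw [nval_pair, sem7, nval_zero]; simp)
  | c5 b e h0 => exact h0 (by rw [nval_pair, sem7, nval_hO, nval_pair, sem7]; simp [mop])
  | c6 e x h0 => exact h0 (by rw [nval_pair, sem2, nstr_pair]; rfl)
  | c7 q e x h0 => exact h0 (by rw [nval_pair, sem3, nstr_pair, nval_pair]; rfl)
  | c8 i q r e h0 => exact h0 (by rw [nval_pair, sem4, nval_hO, nval_pair, nval_pair])
  | c9 a b h0 h1 => rw [nval_hO, nval_zero, h1] at h0; simp [mop] at h0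
  | c10 a b h0 h1 => rw [nval_hO, nval_zero] at h0; simp [mop, h1] at h0
  | c11 a b h0 h1 => rw [nval_hO, nval_zero] at h0; rw [nval_zero] at h1; simp [mop, h1] at h0
  | c12 a b h0 h1 => rw [nval_hO, nval_zero] at h0; rw [nval_zero] at h1; simp [mop, h1] at h0
  | c13 a b h0 h1 h2 => rw [nval_hO, nval_zero] at h1; rw [nval_zero] at h0 h2; simp [mop, h2, h0] at h1
  | c14 q e x h0 h1 =>
    rw [nval_pair, nval_zero, nstr_pair] at h0
    rw [nval_pair, nval_zero, sem5] at h1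
    exact h1 ⟨_, h0⟩
  | c15 q e h0 h1 =>
    rw [nval_pair, nval_zero, sem5] at h0
    rw [nval_pair, nval_zero, nstr_pair, nval_pair] at h1
    exact h1 (sem6 _ _ h0)
  | c16 k h0 h1 =>
    obtain ⟨τ, hτ, rfl⟩ := h0
    rw [nval_pair, nval_zero] at h1
    refine (sem_real τ (nstr K 0)).1 ?_ h1
    have := hT τ hτ
    rwa [Subsingleton.elim (sA 0 (nstr K 0)) default]
  | c17 h0 =>
    rw [gName, nval_pair, nval_zero] at h0
    refine (sem_real γ _).1 ?_ h0
    convert h using 1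
    rw [nstr_pair, nstr_pair]
    funext i
    refine Fin.cases ?_ (fun j => ?_) i
    · show nval K (nN y) = _
      rw [nN, nval_pair, sem7]; rfl
    · rw [Subsingleton.elim j 0]
      show nval K (nN k) = _
      rw [nN, nval_pair, sem7]; rfl
end sound


section complete
variable {X : ℕ → Prop} {g : ℕ} {w : ℕ → ℕ → Prop}

def wset (h : ¬ Bad X g w (fun a b => ¬ w a b)) : Setoid ℕ where
  r := w
  iseqv := by
    have r : ∀ a, w a a := fun a => by by_contra hc; exact h (.c0 a hc)
    have t : ∀ a b c, w a b → w a c → w b c := fun a b c h1 h2 => by by_contra hc; exact h (.c1 a b c h1 h2 hc)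
    exact ⟨r, fun {a b} h1 => t a b a h1 (r a), fun {a b c} h1 h2 => t b a c (t a b a h1 (r a)) h2⟩
variable (h : ¬ Bad X g w (fun a b => ¬ w a b))
def WK : Type := Quotient (wset h)
def wm (a : ℕ) : WK h := Quotient.mk (wset h) a
theorem wm_eq {a b : ℕ} : wm h a = wm h b ↔ w a b := Quotient.eq (r := wset h)
theorem wm_surj : Function.Surjective (wm h) := Quotient.mk_surjective
def wop (i : ℕ) : WK h → WK h → WK h :=
  Quotient.map₂ (hO i) (fun a c h1 b d h2 => by by_contra hc; exact h (.c2 i a b c d h1 h2 hc))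
theorem wop_m (i a b : ℕ) : wop h i (wm h a) (wm h b) = wm h (hO i a b) := rfl
instance wstr : LA.Structure (WK h) where
  funMap := fun {n} f xs => match n, f, xs with
    | 0, _, _ => wm h 0
    | 1, _, xs => wop h 0 (wm h 0) (xs 0)
    | 2, f, xs => wop h (cond (show Bool from f) 2 1) (xs 0) (xs 1)
    | _+3, f, _ => (show Empty from f).elim
  RelMap := fun {n} f xs => match n, f, xs with
    | 0, f, _ => (show Empty from f).elim
    | 1, f, _ => (show Empty from f).elim
    | 2, _, xs => wop h 4 (xs 0) (xs 1) ≠ wm h 0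
    | _+3, f, _ => (show Empty from f).elim

/-- the valuation coded by an environment name -/
def eA' : ∀ m, ℕ → Fin m → WK h
  | 0, _ => Fin.elim0
  | m+1, e => Fin.snoc (α := fun _ => WK h) (eA' m e.unpair.1) (wm h e.unpair.2)

theorem w_real {m : ℕ} (φ : LA.BoundedFormula Empty m) (e : ℕ) :
    φ.Realize default (eA' h m e) ↔ ¬ w (Nat.pair (cF φ) e) 0 := by
  rw [← wm_eq h]
  refine herb (K := WK h) (wm h 0) (wop h) rfl (fun _ => rfl) (fun _ _ => rfl) (fun _ _ => rfl) ?_ (fun _ _ => Iff.rfl) ?_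
    (fun e => wm h e.unpair.2) (fun e => e.unpair.1) (fun e x => Nat.pair e x)
    (wm h) (wm_surj h) (fun _ _ => by simp) (fun _ _ => by simp) (fun p e => wm h (Nat.pair p e)) ?_ ?_ ?_ ?_ ?_ (eA' h)
    (fun _ _ => rfl) φ e
  · intro a b
    obtain ⟨a, rfl⟩ := wm_surj h a; obtain ⟨b, rfl⟩ := wm_surj h b
    rw [wop_m, ne_eq, wm_eq, wm_eq]
    refine ⟨fun h1 h2 => h (.c9 a b h2 h1), fun h1 => ?_⟩
    by_contra h2; exact h (.c10 a b h1 h2)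
  · intro a b
    obtain ⟨a, rfl⟩ := wm_surj h a; obtain ⟨b, rfl⟩ := wm_surj h b
    rw [wop_m, ne_eq, ne_eq, ne_eq, wm_eq, wm_eq, wm_eq]
    refine ⟨fun h1 h2 h3 => h (.c13 a b h3 h1 h2), fun h1 h2 => ?_⟩
    by_cases h3 : w a 0
    · exact h (.c11 a b h2 h3)
    · exact h (.c12 a b h2 (h1 h3))
  · intro e; rw [wm_eq]; by_contra hc; exact h (.c3 e hc)
  · intro e; rw [wm_eq]; by_contra hc
    exact h (.c6 e.unpair.1 e.unpair.2 (by rwa [Nat.pair_unpair]))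
  · intro q e; rw [wm_eq]; by_contra hc
    exact h (.c7 q e.unpair.1 e.unpair.2 (by rwa [Nat.pair_unpair]))
  · intro i q r e; rw [wop_m, wm_eq]; by_contra hc; exact h (.c8 i q r e hc)
  · intro q e
    simp only [ne_eq, wm_eq]
    refine ⟨fun h1 x h2 => h (.c14 q e x h2 h1), fun h1 h2 => h (.c15 q e h2 (h1 _))⟩

def wMod (hpa : ∀ φ ∈ PAAx, Sentence.Realize (WK h) φ) : Mod := ⟨WK h, wstr h, ⟨wm h 0⟩, hpa⟩
def wmm (hpa : ∀ φ ∈ PAAx, Sentence.Realize (WK h) φ) (a : ℕ) : wMod h hpa := wm h a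
theorem w_num (hpa : ∀ φ ∈ PAAx, Sentence.Realize (WK h) φ) (b e : ℕ) :
    wmm h hpa (Nat.pair (Nat.pair 7 b) e) = (b : wMod h hpa) := by
  induction b with
  | zero =>
    have : (0 : wMod h hpa) = wmm h hpa 0 := rfl
    rw [Nat.cast_zero, this]
    refine (wm_eq h).2 ?_
    by_contra hc; exact h (.c4 e hc)
  | succ b ih =>
    rw [Nat.cast_succ, ← ih, ← sc_eq]
    refine (wm_eq h).2 ?_
    by_contra hc; exact h (.c5 b e hc)
end complete

theorem model_of_sat {T : Thy} (hE : ExtPA T) (γ : LA.BoundedFormula Empty 2) (y k : ℕ) {w : ℕ → ℕ → Prop}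
    (h : ¬ Bad (Ax T) (gName (cF γ) y k) w (fun a b => ¬ w a b)) :
    ∃ K : Mod, (∀ τ ∈ T, Sentence.Realize K τ) ∧ γ.Realize default ![(y : K), (k : K)] := by
  have hT : ∀ τ ∈ T, Sentence.Realize (WK h) τ := by
    intro τ hτ
    have := (w_real h τ 0).2 (fun h1 => h (.c16 _ ⟨τ, hτ, rfl⟩ h1))
    rwa [Subsingleton.elim (eA' h 0 0) default] at this
  have ne : Nonempty (WK h) := ⟨wm h 0⟩
  have hM : (WK h) ⊨ T := ⟨hT⟩
  have hpa : ∀ φ ∈ PAAx, Sentence.Realize (WK h) φ := fun φ hφ => (hE φ hφ).realize_sentence (WK h)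
  refine ⟨wMod h hpa, hT, ?_⟩
  have h1 := (w_real h γ (Nat.pair (Nat.pair 0 (nN y)) (nN k))).2 (fun h1 => h (.c17 h1))
  have e : ![(y : wMod h hpa), (k : wMod h hpa)] = eA' h 2 (Nat.pair (Nat.pair 0 (nN y)) (nN k)) := by
    funext i
    refine Fin.cases ?_ (fun j => ?_) i
    · simp only [eA', Nat.unpair_pair]
      exact (w_num h hpa y 0).symm
    · rw [Subsingleton.elim j 0]
      simp only [eA', Nat.unpair_pair]
      exact (w_num h hpa k 0).symm
  rw [e]
  exact h1

theorem Uns_iff {T : Thy} (hE : ExtPA T) (γ : LA.BoundedFormula Empty 2) (y k : ℕ) :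
    Uns (Ax T) (gName (cF γ) y k) ↔ ∀ K : Mod, (∀ τ ∈ T, Sentence.Realize K τ) → ¬ γ.Realize default ![(y : K), (k : K)] := by
  constructor
  · intro h K hT hγ
    exact sat_of_model hT γ y k hγ (of_Uns h _)
  · intro h
    refine Uns_of fun w => ?_
    by_contra hc
    obtain ⟨K, hK, hγ⟩ := model_of_sat hE γ y k hc
    exact h K hK hγ

/-- the set of pairs refuted by a computable theory is `Σ_1` -/
theorem nd_refuted {T : Thy} (hC : CompThy T) (hE : ExtPA T) (γ : LA.BoundedFormula Empty 2) :
    ND (m := 2) (fun v => ∀ K : Mod, (∀ τ ∈ T, Sentence.Realize K τ) → ¬ γ.Realize default ![(v 0 : K), (v 1 : K)]) := by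
  have : NF (m := 2) (fun v => gName (cF γ) (v 0) (v 1)) :=
    inferInstanceAs (NF (m := 2) (fun v => Nat.pair (cF γ) (Nat.pair (Nat.pair 0 (Nat.pair (Nat.pair 7 (v 0)) 0)) (Nat.pair (Nat.pair 7 (v 1)) 0))))
  exact (Uns.nd (X := Ax T) (nd_Ax hC (fun v => v 0)) (fun v => gName (cF γ) (v 0) (v 1))).congr (fun v => (Uns_iff hE γ _ _).symm)


theorem IsPiFml.Pi {n m : ℕ} {φ : LA.BoundedFormula Empty m} (h : IsPiFml n φ) : Pi n (den φ) := by
  refine IsPiFml.rec (motive_1 := fun n m φ _ => Guaspari.S n (den φ))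
    (motive_2 := fun n m φ _ => Guaspari.Pi n (den φ)) ?_ ?_ ?_ ?_ ?_ ?_ h
  · intro m φ h; exact (IsSigmaFml.ofDelta0 h).S
  · intro k m φ _ h; exact S.ofPi h
  · intro k m φ _ h
    rw [den_ex]
    exact S.ex (h := by simpa only [snoc_last_eq] using h)
  · intro m φ h
    have : D0 (den φ) := ⟨φ, h, fun _ _ => Iff.rfl⟩
    infer_instance
  · intro k m φ _ h; exact Pi.ofS h
  · intro k m φ _ h
    rw [den_all]
    exact Pi.all (h := by simpa only [snoc_last_eq] using h)

/-- truth of a sentence -/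
def Tr (M : Mod) (φ : Snt) : Prop := Sentence.Realize M φ
def Sat (T : Thy) (K : Mod) : Prop := ∀ τ ∈ T, Tr K τ
def Arr (n : ℕ) (M K : Mod) : Prop := ∀ σ ∈ SigmaS n, Tr M σ → Tr K σ

theorem Arr.trans {n : ℕ} {M K L : Mod} (h : Arr n M K) (h' : Arr n K L) : Arr n M L :=
  fun σ hσ h1 => h' σ hσ (h σ hσ h1)

theorem den_tr (φ : Snt) (M : Mod) (v : Fin 0 → M) : den φ M v ↔ Tr M φ := by
  rw [Subsingleton.elim v default]; rfl
theorem tr_not {M : Mod} {φ : Snt} : Tr M (∼φ) ↔ ¬ Tr M φ := Iff.rfl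
theorem tr_imp {M : Mod} {φ ψ : Snt} : Tr M (φ ⟹ ψ) ↔ (Tr M φ → Tr M ψ) := Iff.rfl
theorem tr_and {M : Mod} {φ ψ : Snt} : Tr M (φ ⊓ ψ) ↔ (Tr M φ ∧ Tr M ψ) := BoundedFormula.realize_inf
theorem tr_or {M : Mod} {φ ψ : Snt} : Tr M (φ ⊔ ψ) ↔ (Tr M φ ∨ Tr M ψ) := BoundedFormula.realize_sup

theorem S.snt {n : ℕ} {P : Mod → Prop} (h : S n (m := 0) (fun M _ => P M)) :
    ∃ σ ∈ SigmaS n, ∀ M, Tr M σ ↔ P M := by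
  obtain ⟨⟨φ, h1, e⟩, _⟩ := h.fml
  exact ⟨φ, h1, fun M => by rw [← den_tr φ M default, e]⟩
theorem S.pisnt {n : ℕ} {P : Mod → Prop} (h : S n (m := 0) (fun M _ => P M)) :
    ∃ σ ∈ PiS n, ∀ M, Tr M σ ↔ ¬ P M := by
  obtain ⟨_, ⟨φ, h1, e⟩⟩ := h.fml
  exact ⟨φ, h1, fun M => by rw [← den_tr φ M default, e]⟩
theorem sig_S {n : ℕ} {σ : Snt} (h : σ ∈ SigmaS n) : S n (m := 0) (fun M _ => Tr M σ) :=
  (IsSigmaFml.S h).congr (fun M v => (den_tr σ M v).symm)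
theorem pi_S {n : ℕ} {σ : Snt} (h : σ ∈ PiS n) : S n (m := 0) (fun M _ => ¬ Tr M σ) :=
  ((IsPiFml.Pi h).congr (fun M v => (den_tr σ M v).symm)).ne
theorem sig_pi {n : ℕ} {σ : Snt} (h : σ ∈ SigmaS n) : ∃ π ∈ PiS n, ∀ M, Tr M π ↔ ¬ Tr M σ := (sig_S h).pisnt
theorem pi_sig {n : ℕ} {σ : Snt} (h : σ ∈ PiS n) : ∃ π ∈ SigmaS n, ∀ M, Tr M π ↔ ¬ Tr M σ := (pi_S h).snt
theorem sig_and {n : ℕ} {σ τ : Snt} (h : σ ∈ SigmaS n) (h' : τ ∈ SigmaS n) :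
    ∃ π ∈ SigmaS n, ∀ M, Tr M π ↔ (Tr M σ ∧ Tr M τ) := by
  have := sig_S h; have := sig_S h'
  exact S.snt (P := fun M => Tr M σ ∧ Tr M τ) inferInstance
theorem sig_or {n : ℕ} {σ τ : Snt} (h : σ ∈ SigmaS n) (h' : τ ∈ SigmaS n) :
    ∃ π ∈ SigmaS n, ∀ M, Tr M π ↔ (Tr M σ ∨ Tr M τ) := by
  have := sig_S h; have := sig_S h'
  exact S.snt (P := fun M => Tr M σ ∨ Tr M τ) inferInstance
theorem sig_true (n : ℕ) : ∃ π ∈ SigmaS n, ∀ M, Tr M π := by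
  obtain ⟨π, h, e⟩ := S.snt (n := n) (P := fun M => (0:M) = 0) inferInstance
  exact ⟨π, h, fun M => (e M).2 rfl⟩
theorem sig_false (n : ℕ) : ∃ π ∈ SigmaS n, ∀ M, ¬ Tr M π := by
  obtain ⟨π, h, e⟩ := S.snt (n := n) (P := fun M => ¬ (0:M) = 0) inferInstance
  exact ⟨π, h, fun M h' => (e M).1 h' rfl⟩
theorem Arr.S {n : ℕ} {M K : Mod} (h : Arr n M K) {P : Mod → Prop} (hP : S n (m := 0) (fun M _ => P M)) :
    P M → P K := by
  obtain ⟨σ, hσ, e⟩ := hP.snt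
  rw [← e, ← e]; exact h σ hσ

theorem prv_iff {T : Thy} (hE : ExtPA T) (φ : Snt) : Prv T φ ↔ ∀ K, Sat T K → Tr K φ := by
  constructor
  · intro h K hK
    have : K.carrier ⊨ T := ⟨hK⟩
    exact h.realize_sentence K
  · intro h
    refine Theory.models_sentence_iff.2 (fun N => ?_)
    exact h ⟨N, N.struc, N.nonempty', fun φ hφ => (hE φ hφ).realize_sentence N⟩ (fun τ hτ => N.is_model.realize_of_mem τ hτ)

theorem prv_of_mem {T : Thy} {φ : Snt} (h : φ ∈ T) : Prv T φ :=
  Theory.models_sentence_of_mem h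
theorem ext_add {T : Thy} (hE : ExtPA T) (φ : Snt) : ExtPA (add T φ) := by
  intro ψ hψ
  refine Theory.models_sentence_iff.2 (fun N => ?_)
  have : N ⊨ T := ⟨fun τ hτ => N.is_model.realize_of_mem τ (Set.mem_insert_of_mem _ hτ)⟩
  exact (hE ψ hψ).realize_sentence N
theorem ext_PA : ExtPA PAAx := fun _ h => prv_of_mem h
theorem sat_PA (M : Mod) : Sat PAAx M := M.pa
theorem sat_add {T : Thy} {φ : Snt} {K : Mod} : Sat (add T φ) K ↔ Sat T K ∧ Tr K φ := by
  constructor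
  · intro h; exact ⟨fun τ hτ => h τ (Set.mem_insert_of_mem _ hτ), h φ (Set.mem_insert _ _)⟩
  · rintro ⟨h1, h2⟩ τ hτ
    rcases Set.mem_insert_iff.1 hτ with rfl | h
    exacts [h2, h1 τ h]

theorem cpt {T : Thy} (hE : ExtPA T) (G : Set Snt)
    (h : ∀ F : Finset Snt, (F : Set Snt) ⊆ G → ∃ K, Sat T K ∧ ∀ γ ∈ F, Tr K γ) :
    ∃ K, Sat T K ∧ ∀ γ ∈ G, Tr K γ := by
  classical
  have hs : (T ∪ G).IsSatisfiable := by
    rw [Theory.isSatisfiable_iff_isFinitelySatisfiable]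
    intro F hF
    obtain ⟨K, hK, hg⟩ := h (F.filter (· ∈ G)) (by intro x hx; simpa using (Finset.mem_filter.1 (Finset.mem_coe.1 hx)).2)
    have : K.carrier ⊨ (F : Thy) := by
      refine ⟨fun {τ} hτ => ?_⟩
      rcases hF hτ with h1 | h1
      · exact hK _ h1
      · exact hg τ (Finset.mem_filter.2 ⟨hτ, h1⟩)
    exact Theory.Model.isSatisfiable K.carrier
  obtain ⟨N⟩ := hs
  have hT : N ⊨ T := ⟨fun τ hτ => N.is_model.realize_of_mem τ (Or.inl hτ)⟩
  exact ⟨⟨N, N.struc, N.nonempty', fun φ hφ => (hE φ hφ).realize_sentence N⟩,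
    fun τ hτ => N.is_model.realize_of_mem τ (Or.inl hτ), fun τ hτ => N.is_model.realize_of_mem τ (Or.inr hτ)⟩

theorem up_of {n : ℕ} {T : Thy} (hE : ExtPA T) {M : Mod} (h : ∀ σ ∈ SigmaS n, Tr M σ → ∃ K, Sat T K ∧ Tr K σ) :
    ∃ K, Sat T K ∧ Arr n M K := by
  have h1 : ∀ F : Finset Snt, (F : Set Snt) ⊆ {σ | σ ∈ SigmaS n ∧ Tr M σ} →
      ∃ σ ∈ SigmaS n, Tr M σ ∧ ∀ K, Tr K σ → ∀ γ ∈ F, Tr K γ := by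
    classical
    intro F
    induction F using Finset.induction_on with
    | empty =>
      intro _
      obtain ⟨π, hπ, e⟩ := sig_true n
      exact ⟨π, hπ, e M, by simp⟩
    | insert a F _ ih =>
      intro hF
      obtain ⟨σ, hσ, h1, h2⟩ := ih (fun x hx => hF (by simp at hx ⊢; exact Or.inr hx))
      have ha := hF (show a ∈ _ by simp)
      obtain ⟨π, hπ, e⟩ := sig_and ha.1 hσ
      refine ⟨π, hπ, (e M).2 ⟨ha.2, h1⟩, fun K hK γ hγ => ?_⟩
      rcases Finset.mem_insert.1 hγ with rfl | h3
      · exact ((e K).1 hK).1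
      · exact h2 K ((e K).1 hK).2 γ h3
  obtain ⟨K, hK, h2⟩ := cpt hE {σ | σ ∈ SigmaS n ∧ Tr M σ} (fun F hF => by
    obtain ⟨σ, hσ, hM, h2⟩ := h1 F hF
    obtain ⟨K, hK, h3⟩ := h σ hσ hM
    exact ⟨K, hK, h2 K h3⟩)
  exact ⟨K, hK, fun σ hσ hM => h2 σ ⟨hσ, hM⟩⟩

theorem down_of {n : ℕ} {T : Thy} (hE : ExtPA T) {M : Mod} (h : ∀ σ ∈ SigmaS n, ¬ Tr M σ → ∃ K, Sat T K ∧ ¬ Tr K σ) :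
    ∃ K, Sat T K ∧ Arr n K M := by
  have h1 : ∀ F : Finset Snt, (F : Set Snt) ⊆ {τ | ∃ σ ∈ SigmaS n, ¬ Tr M σ ∧ τ = ∼σ} →
      ∃ σ ∈ SigmaS n, ¬ Tr M σ ∧ ∀ K, ¬ Tr K σ → ∀ γ ∈ F, Tr K γ := by
    classical
    intro F
    induction F using Finset.induction_on with
    | empty =>
      intro _
      obtain ⟨π, hπ, e⟩ := sig_false n
      exact ⟨π, hπ, e M, by simp⟩
    | insert a F _ ih =>
      intro hF
      obtain ⟨σ, hσ, h1, h2⟩ := ih (fun x hx => hF (by simp at hx ⊢; exact Or.inr hx))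
      obtain ⟨σ', ha1, ha2, rfl⟩ := hF (show a ∈ _ by simp)
      obtain ⟨π, hπ, e⟩ := sig_or ha1 hσ
      refine ⟨π, hπ, fun hc => ((e M).1 hc).elim ha2 h1, fun K hK γ hγ => ?_⟩
      rcases Finset.mem_insert.1 hγ with rfl | h3
      · exact tr_not.2 fun hc => hK ((e K).2 (Or.inl hc))
      · exact h2 K (fun hc => hK ((e K).2 (Or.inr hc))) γ h3
  obtain ⟨K, hK, h2⟩ := cpt hE {τ | ∃ σ ∈ SigmaS n, ¬ Tr M σ ∧ τ = ∼σ} (fun F hF => by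
    obtain ⟨σ, hσ, hM, h2⟩ := h1 F hF
    obtain ⟨K, hK, h3⟩ := h σ hσ hM
    exact ⟨K, hK, h2 K h3⟩)
  refine ⟨K, hK, fun σ hσ hM => ?_⟩
  by_contra hc
  exact tr_not.1 (h2 _ ⟨σ, hσ, hc, rfl⟩) hM

def Up (n : ℕ) (T : Thy) (θ : Snt) : Prop := ∀ M, ¬ Tr M θ → ∃ K, Sat T K ∧ Tr K θ ∧ Arr n M K
def Down (n : ℕ) (T : Thy) (θ : Snt) : Prop := ∀ M, Tr M θ → ∃ K, Sat T K ∧ ¬ Tr K θ ∧ Arr n K M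

theorem up_of' {n : ℕ} {T : Thy} (hE : ExtPA T) {θ : Snt}
    (h : ∀ M, ¬ Tr M θ → ∀ σ ∈ SigmaS n, Tr M σ → ∃ K, Sat T K ∧ Tr K θ ∧ Tr K σ) : Up n T θ := by
  intro M hM
  obtain ⟨K, hK, h1⟩ := up_of (n := n) (ext_add hE θ) (M := M) (fun σ hσ h1 => by
    obtain ⟨K, hK, h2, h3⟩ := h M hM σ hσ h1
    exact ⟨K, sat_add.2 ⟨hK, h2⟩, h3⟩)
  exact ⟨K, (sat_add.1 hK).1, (sat_add.1 hK).2, h1⟩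
theorem down_of' {n : ℕ} {T : Thy} (hE : ExtPA T) {θ : Snt}
    (h : ∀ M, Tr M θ → ∀ σ ∈ SigmaS n, ¬ Tr M σ → ∃ K, Sat T K ∧ ¬ Tr K θ ∧ ¬ Tr K σ) : Down n T θ := by
  intro M hM
  obtain ⟨K, hK, h1⟩ := down_of (n := n) (ext_add hE (∼θ)) (M := M) (fun σ hσ h1 => by
    obtain ⟨K, hK, h2, h3⟩ := h M hM σ hσ h1
    exact ⟨K, sat_add.2 ⟨hK, tr_not.2 h2⟩, h3⟩)
  exact ⟨K, (sat_add.1 hK).1, tr_not.1 (sat_add.1 hK).2, h1⟩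

theorem sp_arr {n : ℕ} {T : Thy} (hE : ExtPA T) (h : ThySPConsPA n T) (M : Mod) :
    ∃ K, Sat T K ∧ (Arr n M K ∨ Arr n K M) := by
  by_contra hc
  have h1 : ∃ σ ∈ SigmaS n, Tr M σ ∧ ∀ K, Sat T K → ¬ Tr K σ := by
    by_contra h2
    push Not at h2
    obtain ⟨K, hK, h3⟩ := up_of hE h2
    exact hc ⟨K, hK, Or.inl h3⟩
  have h1' : ∃ σ ∈ SigmaS n, ¬ Tr M σ ∧ ∀ K, Sat T K → Tr K σ := by
    by_contra h2
    push Not at h2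
    obtain ⟨K, hK, h3⟩ := down_of hE h2
    exact hc ⟨K, hK, Or.inr h3⟩
  obtain ⟨σ, hσ, a1, a2⟩ := h1
  obtain ⟨τ, hτ, b1, b2⟩ := h1'
  obtain ⟨π, hπ, e⟩ := sig_pi hσ
  have h3 := h τ hτ π hπ ((prv_iff hE _).2 fun K hK => tr_and.2 ⟨b2 K hK, (e K).2 (a2 K hK)⟩)
  rcases tr_or.1 ((prv_iff ext_PA _).1 h3 M (sat_PA M)) with h4 | h4
  · exact b1 h4
  · exact (e M).1 h4 a1


theorem ND.d0rep {P : ℕ → ℕ → Prop} (h : ND (m := 2) (fun v => P (v 0) (v 1))) :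
    ∃ R : ∀ M : Mod, M → M → M → Prop, D0 (m := 3) (fun M v => R M (v 0) (v 1) (v 2)) ∧
      (∀ y k, P y k → ∃ u : ℕ, ∀ M : Mod, R M y k u) ∧ ∀ (M : Mod) (y k u : ℕ), R M y k u → P y k := by
  obtain ⟨P', hP', e⟩ := h.out
  obtain ⟨R, hR, rfl⟩ := hP'.elim
  have h1 : D0 (m := 3) (fun M v => R M (fun i => v i.castSucc) (v (Fin.last 2))) := by
    have h2 : D0 (m := 3) (fun M v => ¬ R M (fun i => v i.castSucc) (v (Fin.last 2))) := hR.out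
    exact D0.congr (P := fun M v => ¬ ¬ R M (fun i => v i.castSucc) (v (Fin.last 2))) inferInstance
      (by intros; exact not_not.symm)
  have e1 : ∀ (M : Mod) (v : Fin 3 → M), (fun i : Fin 2 => v i.castSucc) = ![v 0, v 1] := by
    intro M v; funext i; refine Fin.cases rfl (fun j => ?_) i; rw [Subsingleton.elim j 0]; rfl
  have h3 : D0 (m := 3) (fun M v => R M ![v 0, v 1] (v 2)) := by
    refine h1.congr (fun M v => ?_)
    rw [e1]; rfl
  have ab : ∀ (M : Mod) (y k u : ℕ), R M ![(y : M), (k : M)] (u : M) ↔ R natMod ![y, k] u := by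
    intro M y k u
    exact h3.abs M ![y, k, u]
  refine ⟨fun M a b c => R M ![a, b] c, h3, ?_, ?_⟩
  · intro y k hP
    obtain ⟨u, hu⟩ := (e ![y, k]).1 hP
    exact ⟨u, fun M => (ab M y k u).2 hu⟩
  · intro M y k u hR
    exact (e ![y, k]).2 ⟨u, (ab M y k u).1 hR⟩

def Dg (n : ℕ) (M : Mod) (y : M) : Prop := Un n y (pr 0 y)
theorem Dg_S (n : ℕ) : S (n+1) (m := 1) (fun M v => Dg n M (v 0)) :=
  S.subst2 (P := fun M x y => Un n x y) (Un_S n) (m := 1) (fun M v => v 0) (fun M v => pr 0 (v 0))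
theorem Dg_sub (n : ℕ) {m : ℕ} (f : Func m) [TD f] : S (n+1) (fun M v => Dg n M (f M v)) :=
  S.subst1 (P := fun M x => Dg n M x) (Dg_S n) f
theorem Dg_rep {n : ℕ} {P : ∀ M : Mod, M → Prop} (h : S (n+1) (m := 1) (fun M v => P M (v 0))) :
    ∃ k : ℕ, ∀ M : Mod, P M k ↔ Dg n M k := by
  obtain ⟨k, hk⟩ := Un_rep h
  refine ⟨k, fun M => ?_⟩
  have := hk M ![(k : M)]
  exact this

theorem single {n : ℕ} {T : Thy} (hC : CompThy T) (hE : ExtPA T)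
    (hS : ∀ M, ∃ K, Sat T K ∧ (Arr (n+1) M K ∨ Arr (n+1) K M)) :
    ∃ θ ∈ SigmaS (n+1), Up (n+1) T θ ∧ Down (n+1) T θ := by
  have hD0 := Dg_sub n (m := 2) (fun M v => v 0)
  have hD1 := Dg_sub n (m := 2) (fun M v => v 1)
  have hA : ND (m := 2) (fun v => ∀ K, Sat T K → ¬ (Dg n K (v 0 : ℕ) ∧ Dg n K (v 1 : ℕ))) := by
    have h1 : S (n+1) (m := 2) (fun M v => Dg n M (v 0) ∧ Dg n M (v 1)) := inferInstance
    obtain ⟨⟨γ, _, e⟩, _⟩ := h1.fml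
    refine (nd_refuted hC hE γ).congr (fun v => forall_congr' fun K => imp_congr Iff.rfl (not_congr ?_))
    exact (iff_of_eq (congrFun (congrFun e K) ![(v 0 : K), (v 1 : K)])).symm
  have hB : ND (m := 2) (fun v => ∀ K, Sat T K → (Dg n K (v 0 : ℕ) ∨ Dg n K (v 1 : ℕ))) := by
    have h1 : S (n+1) (m := 2) (fun M v => Dg n M (v 0) ∨ Dg n M (v 1)) := inferInstance
    obtain ⟨_, ⟨γ, _, e⟩⟩ := h1.fml
    refine (nd_refuted hC hE γ).congr (fun v => forall_congr' fun K => imp_congr Iff.rfl ?_)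
    have := iff_of_eq (congrFun (congrFun e K) ![(v 0 : K), (v 1 : K)])
    refine Iff.trans ?_ (not_congr this).symm
    exact not_not.symm
  obtain ⟨A, hAd, hA1, hA2⟩ := ND.d0rep (P := fun y k => ∀ K, Sat T K → ¬ (Dg n K (y : ℕ) ∧ Dg n K (k : ℕ))) hA
  obtain ⟨B, hBd, hB1, hB2⟩ := ND.d0rep (P := fun y k => ∀ K, Sat T K → (Dg n K (y : ℕ) ∨ Dg n K (k : ℕ))) hB
  let Th0 : ∀ M : Mod, M → M → Prop := fun M y p =>
    (∃ k, k ≤ p ∧ ∃ u, u ≤ p ∧ (A M y k u ∧ Dg n M k)) ∧ ∀ k, k ≤ p → ∀ u, u ≤ p → (B M y k u → Dg n M k)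
  have hTh : S (n+1) (m := 1) (fun M v => ∃ p, Th0 M (v 0) p) := by
    have a1 : D0 (m := 4) (fun M v => A M (v 0) (v 2) (v 3)) := D0.subst3 (P := fun M x y z => A M x y z) (m := 4) (f := fun M v => v 0) (g := fun M v => v 2) (k := fun M v => v 3) hAd
    have a2 : D0 (m := 4) (fun M v => B M (v 0) (v 2) (v 3)) := D0.subst3 (P := fun M x y z => B M x y z) (m := 4) (f := fun M v => v 0) (g := fun M v => v 2) (k := fun M v => v 3) hBd
    have a3 := Dg_sub n (m := 4) (fun M v => v 2)
    have b1 : S (n+1) (m := 4) (fun M v => A M (v 0) (v 2) (v 3) ∧ Dg n M (v 2)) := inferInstance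
    have b2 : S (n+1) (m := 4) (fun M v => B M (v 0) (v 2) (v 3) → Dg n M (v 2)) := inferInstance
    have c1 : S (n+1) (m := 3) (fun M v => ∃ u, u ≤ v 1 ∧ (A M (v 0) (v 2) u ∧ Dg n M (v 2))) :=
      Clo.bex (f := fun M v => v 1) (R := fun M v u => A M (v 0) (v 2) u ∧ Dg n M (v 2)) inferInstance b1
    have c2 : S (n+1) (m := 3) (fun M v => ∀ u, u ≤ v 1 → (B M (v 0) (v 2) u → Dg n M (v 2))) :=
      Clo.ball (f := fun M v => v 1) (R := fun M v u => B M (v 0) (v 2) u → Dg n M (v 2)) inferInstance b2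
    have d1 : S (n+1) (m := 2) (fun M v => ∃ k, k ≤ v 1 ∧ ∃ u, u ≤ v 1 ∧ (A M (v 0) k u ∧ Dg n M k)) :=
      Clo.bex (f := fun M v => v 1) (R := fun M v k => ∃ u, u ≤ v 1 ∧ (A M (v 0) k u ∧ Dg n M k)) inferInstance c1
    have d2 : S (n+1) (m := 2) (fun M v => ∀ k, k ≤ v 1 → ∀ u, u ≤ v 1 → (B M (v 0) k u → Dg n M k)) :=
      Clo.ball (f := fun M v => v 1) (R := fun M v k => ∀ u, u ≤ v 1 → (B M (v 0) k u → Dg n M k)) inferInstance c2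
    have e1 : S (n+1) (m := 2) (fun M v => Th0 M (v 0) (v 1)) := S.and (P := fun M v => ∃ k, k ≤ v 1 ∧ ∃ u, u ≤ v 1 ∧ (A M (v 0) k u ∧ Dg n M k))
    exact S.ex (m := 1) (R := fun M v p => Th0 M (v 0) p) (h := e1)
  obtain ⟨y, hy⟩ := Dg_rep (P := fun M y => ∃ p, Th0 M y p) hTh
  obtain ⟨θ, hθ, eθ⟩ := S.snt (P := fun M => Dg n M y) (Dg_sub n (m := 0) (fun M v => (y : M)))
  -- representing sentences
  have rep : ∀ σ ∈ SigmaS (n+1), ∃ k : ℕ, ∀ M : Mod, Tr M σ ↔ Dg n M k := by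
    intro σ hσ
    have h1 := sig_S hσ
    have h2 : S (n+1) (m := 1) (fun M v => Tr M σ) := S.subst (m' := 1) (f := fun i => i.elim0) h1 (fun i => i.elim0)
    exact Dg_rep (P := fun M _ => Tr M σ) h2
  have arrD : ∀ {M K : Mod}, Arr (n+1) M K → ∀ k : ℕ, Dg n M k → Dg n K k :=
    fun h k => h.S (P := fun M => Dg n M k) (Dg_sub n (m := 0) (fun M v => (k : M)))
  -- if all standard B-requirements hold, a standard A-witness makes θ true
  have mk : ∀ (M : Mod) (k : ℕ), (∀ K, Sat T K → ¬ (Dg n K y ∧ Dg n K k)) → Dg n M k →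
      (∀ k' : ℕ, (∀ K, Sat T K → (Dg n K y ∨ Dg n K k')) → Dg n M k') → Dg n M y := by
    intro M k hk hMk hall
    obtain ⟨u, hu⟩ := hA1 y k hk
    refine (hy M).1 ⟨((max k u : ℕ) : M), ⟨k, by exact_mod_cast le_max_left k u, u, by exact_mod_cast le_max_right k u, hu M, hMk⟩, ?_⟩
    intro k' hk' u' hu' hB'
    obtain ⟨k', _, rfl⟩ := m_std k' _ hk'
    obtain ⟨u', _, rfl⟩ := m_std u' _ hu'
    exact hall k' (hB2 M y k' u' hB')
  -- if a standard B-requirement fails, θ has a standard witness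
  have un : ∀ (M : Mod) (k' : ℕ), (∀ K, Sat T K → (Dg n K y ∨ Dg n K k')) → ¬ Dg n M k' → Dg n M y →
      ∃ k : ℕ, (∀ K, Sat T K → ¬ (Dg n K y ∧ Dg n K k)) ∧ Dg n M k := by
    intro M k' hk' hM hMy
    obtain ⟨u', hu'⟩ := hB1 y k' hk'
    obtain ⟨p, ⟨k, hk, u, hu, hA', hD'⟩, hb⟩ := (hy M).2 hMy
    have hp : p ≤ ((max k' u' : ℕ) : M) := by
      by_contra hc
      have hc' := le_of_lt (not_le.1 hc)
      refine hM (hb k' (le_trans ?_ hc') u' (le_trans ?_ hc') (hu' M))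
      · exact_mod_cast le_max_left k' u'
      · exact_mod_cast le_max_right k' u'
    obtain ⟨k, _, rfl⟩ := m_std k _ (hk.trans hp)
    obtain ⟨u, _, rfl⟩ := m_std u _ (hu.trans hp)
    exact ⟨k, hA2 M y k u hA', hD'⟩
  refine ⟨θ, hθ, up_of' hE ?_, down_of' hE ?_⟩
  · intro M hM σ hσ hMσ
    by_contra hc
    obtain ⟨k, hk⟩ := rep σ hσ
    rw [eθ] at hM
    rw [hk] at hMσ
    have hAk : ∀ K, Sat T K → ¬ (Dg n K y ∧ Dg n K k) := fun K hK h1 => hc ⟨K, hK, (eθ K).2 h1.1, (hk K).2 h1.2⟩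
    have h1 : ∃ k' : ℕ, (∀ K, Sat T K → (Dg n K y ∨ Dg n K k')) ∧ ¬ Dg n M k' := by
      by_contra h2
      push Not at h2
      exact hM (mk M k hAk hMσ h2)
    obtain ⟨k', hB', hMk'⟩ := h1
    obtain ⟨K, hK, h2 | h2⟩ := hS M
    · have hKk := arrD h2 k hMσ
      have hKy : ¬ Dg n K y := fun h3 => hAk K hK ⟨h3, hKk⟩
      exact hKy (mk K k hAk hKk (fun k' hk' => (hk' K hK).resolve_left hKy))
    · have hKy : ¬ Dg n K y := fun h3 => hM (arrD h2 y h3)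
      exact hMk' (arrD h2 k' ((hB' K hK).resolve_left hKy))
  · intro M hM σ hσ hMσ
    by_contra hc
    obtain ⟨k', hk'⟩ := rep σ hσ
    rw [eθ] at hM
    rw [hk'] at hMσ
    have hB' : ∀ K, Sat T K → (Dg n K y ∨ Dg n K k') := fun K hK => by
      by_contra h1
      push Not at h1
      exact hc ⟨K, hK, fun h2 => h1.1 ((eθ K).1 h2), fun h2 => h1.2 ((hk' K).1 h2)⟩
    obtain ⟨k, hA', hMk⟩ := un M k' hB' hMσ hM
    obtain ⟨K, hK, h2 | h2⟩ := hS M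
    · exact hA' K hK ⟨arrD h2 y hM, arrD h2 k hMk⟩
    · have hKk' : ¬ Dg n K k' := fun h3 => hMσ (arrD h2 k' h3)
      have hKy := (hB' K hK).resolve_right hKk'
      obtain ⟨k1, hA1', hk1⟩ := un K k' hB' hKk' hKy
      exact hA1' K hK ⟨hKy, hk1⟩


theorem S.up {n : ℕ} : ∀ {m : ℕ} {P : Pred m}, S n P → S (n+1) P := by
  induction n with
  | zero =>
    intro m P h
    have : D0 P := h.out
    infer_instance
  | succ n ih =>
    intro m P h
    obtain ⟨R, hR, rfl⟩ := h.elim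
    exact S.exPi (Pi.of (ih hR.ne))

theorem reduce {n : ℕ} {φ ψ : Snt} (hφ : φ ∈ SigmaS (n+1)) (hψ : ψ ∈ SigmaS (n+1)) :
    ∃ φ₁ ∈ SigmaS (n+1), ∃ ψ₁ ∈ SigmaS (n+1), ∀ M, (Tr M φ₁ → Tr M φ) ∧ (Tr M ψ₁ → Tr M ψ) ∧
      (Tr M φ → Tr M φ₁ ∨ Tr M ψ₁) ∧ (Tr M ψ → Tr M φ₁ ∨ Tr M ψ₁) ∧ ¬ (Tr M φ₁ ∧ Tr M ψ₁) := by
  obtain ⟨A, hA, eA⟩ := (sig_S hφ).elim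
  obtain ⟨B, hB, eB⟩ := (sig_S hψ).elim
  have eA : ∀ (M : Mod) (v : Fin 0 → M), Tr M φ ↔ ∃ a, A M v a := fun M v => iff_of_eq (congrFun (congrFun eA M) v)
  have eB : ∀ (M : Mod) (v : Fin 0 → M), Tr M ψ ↔ ∃ a, B M v a := fun M v => iff_of_eq (congrFun (congrFun eB M) v)
  have tri : ∀ (M : Mod) (v : Fin 0 → M), v = default := fun M v => Subsingleton.elim _ _
  have hA1 : S (n+1) (m := 1) (fun M v => A M default (v 0)) :=
    S.congr (S.ofPi hA) (fun M v => by rw [tri M (fun i => v i.castSucc)]; rfl)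
  have hB1 : S (n+1) (m := 1) (fun M v => B M default (v 0)) :=
    S.congr (S.ofPi hB) (fun M v => by rw [tri M (fun i => v i.castSucc)]; rfl)
  have hA2 : S (n+1) (m := 2) (fun M v => ¬ A M default (v 1)) := by
    have := Pi.substLast hA (k := 2) (fun i => i.elim0) (fun M v => v 1)
    have h2 : Pi n (m := 2) (fun M v => A M default (v 1)) :=
      Pi.congr this (fun M v => by rw [tri M (fun i : Fin 0 => v i.elim0)])
    exact S.up h2.ne
  have hB2 : S (n+1) (m := 2) (fun M v => ¬ B M default (v 1)) := by
    have := Pi.substLast hB (k := 2) (fun i => i.elim0) (fun M v => v 1)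
    have h2 : Pi n (m := 2) (fun M v => B M default (v 1)) :=
      Pi.congr this (fun M v => by rw [tri M (fun i : Fin 0 => v i.elim0)])
    exact S.up h2.ne
  have a1 : S (n+1) (m := 1) (fun M v => ∀ b, b ≤ v 0 → b < v 0 → ¬ B M default b) := by
    refine Clo.ball (f := fun M v => v 0) (R := fun M v b => b < v 0 → ¬ B M default b) inferInstance ?_
    exact (inferInstance : S (n+1) (m := 2) (fun M v => v 1 < v 0 → ¬ B M default (v 1)))
  have b1 : S (n+1) (m := 1) (fun M v => ∀ b, b ≤ v 0 → ¬ A M default b) :=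
    Clo.ball (f := fun M v => v 0) (R := fun M v b => ¬ A M default b) inferInstance hA2
  have a2 : S (n+1) (m := 1) (fun M v => A M default (v 0) ∧ ∀ b, b ≤ v 0 → b < v 0 → ¬ B M default b) := inferInstance
  have b2 : S (n+1) (m := 1) (fun M v => B M default (v 0) ∧ ∀ b, b ≤ v 0 → ¬ A M default b) := inferInstance
  obtain ⟨φ₁, hφ₁, e1⟩ := S.snt (P := fun M => ∃ a : M, A M default a ∧ ∀ b, b ≤ a → b < a → ¬ B M default b)
    (S.ex (m := 0) (R := fun M _ a => A M default a ∧ ∀ b, b ≤ a → b < a → ¬ B M default b) (h := a2))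
  obtain ⟨ψ₁, hψ₁, e2⟩ := S.snt (P := fun M => ∃ a : M, B M default a ∧ ∀ b, b ≤ a → ¬ A M default b)
    (S.ex (m := 0) (R := fun M _ a => B M default a ∧ ∀ b, b ≤ a → ¬ A M default b) (h := b2))
  refine ⟨φ₁, hφ₁, ψ₁, hψ₁, fun M => ?_⟩
  rw [e1, e2, eA M default, eB M default]
  have lA : ∀ a, A M default a → ∃ b, b ≤ a ∧ A M default b ∧ ∀ c, c < b → ¬ A M default c :=
    fun a => least (R := A) (h := hA.ad) M default a
  have lB : ∀ a, B M default a → ∃ b, b ≤ a ∧ B M default b ∧ ∀ c, c < b → ¬ B M default c :=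
    fun a => least (R := B) (h := hB.ad) M default a
  have c1 : (∃ a, A M default a) → (∃ a, A M default a ∧ ∀ b, b ≤ a → b < a → ¬ B M default b) ∨
      ∃ a, B M default a ∧ ∀ b, b ≤ a → ¬ A M default b := by
    rintro ⟨a, ha⟩
    obtain ⟨a, -, ha, hl⟩ := lA a ha
    by_cases h : ∃ b, b < a ∧ B M default b
    · obtain ⟨b, hb, hB⟩ := h
      exact Or.inr ⟨b, hB, fun c hc => hl c (lt_of_le_of_lt hc hb)⟩
    · exact Or.inl ⟨a, ha, fun b _ hb hB => h ⟨b, hb, hB⟩⟩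
  refine ⟨fun ⟨a, h, _⟩ => ⟨a, h⟩, fun ⟨a, h, _⟩ => ⟨a, h⟩, c1, ?_, ?_⟩
  · rintro ⟨b, hb⟩
    by_cases h : ∃ a, A M default a
    · exact c1 h
    · exact Or.inr ⟨b, hb, fun c _ hc => h ⟨c, hc⟩⟩
  · rintro ⟨⟨a, ha, h1⟩, b, hb, h2⟩
    rcases lt_or_ge b a with h | h
    · exact h1 b h.le h hb
    · exact h2 a h ha

theorem h_up {n : ℕ} {T : Thy} (hE : ExtPA T) {φ : Snt} (h : HConsIn (PiS n) T φ) : Up n T φ := by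
  refine up_of' hE (fun M hM σ hσ hMσ => ?_)
  by_contra hc
  obtain ⟨π, hπ, e⟩ := sig_pi hσ
  have hV := ext_add ext_PA (φ ⟹ π)
  have hs : SubThy (add PAAx (φ ⟹ π)) T := by
    refine ⟨hV, fun χ hχ => (prv_iff hE χ).2 (fun K hK => (prv_iff hV χ).1 hχ K (sat_add.2 ⟨sat_PA K, ?_⟩))⟩
    exact tr_imp.2 fun h1 => (e K).2 fun h2 => hc ⟨K, hK, h1, h2⟩
  have h1 := h _ hs π hπ ((prv_iff (ext_add hV φ) π).2 (fun K hK => by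
    obtain ⟨h1, h2⟩ := sat_add.1 hK
    exact tr_imp.1 (sat_add.1 h1).2 h2))
  exact (e M).1 ((prv_iff hV π).1 h1 M (sat_add.2 ⟨sat_PA M, tr_imp.2 fun h => absurd h hM⟩)) hMσ

theorem h_down {n : ℕ} {T : Thy} (hE : ExtPA T) {φ : Snt} (h : HConsIn (SigmaS n) T (∼φ)) : Down n T φ := by
  refine down_of' hE (fun M hM σ hσ hMσ => ?_)
  by_contra hc
  have hV := ext_add ext_PA (∼φ ⟹ σ)
  have hs : SubThy (add PAAx (∼φ ⟹ σ)) T := by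
    refine ⟨hV, fun χ hχ => (prv_iff hE χ).2 (fun K hK => (prv_iff hV χ).1 hχ K (sat_add.2 ⟨sat_PA K, ?_⟩))⟩
    refine tr_imp.2 fun h1 => ?_
    by_contra h2
    exact hc ⟨K, hK, tr_not.1 h1, h2⟩
  have h1 := h _ hs σ hσ ((prv_iff (ext_add hV (∼φ)) σ).2 (fun K hK => by
    obtain ⟨h1, h2⟩ := sat_add.1 hK
    exact tr_imp.1 (sat_add.1 h1).2 h2))
  exact hMσ ((prv_iff hV σ).1 h1 M (sat_add.2 ⟨sat_PA M, tr_imp.2 fun h => absurd hM (tr_not.1 h)⟩))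

theorem sat_sub {V T : Thy} (hE : ExtPA T) (h : SubThy V T) {K : Mod} (hK : Sat T K) : Sat V K :=
  fun τ hτ => (prv_iff hE τ).1 (h.2 τ (prv_of_mem hτ)) K hK

theorem hd_of {n : ℕ} {T : Thy} (hE : ExtPA T) {θ : Snt} (h1 : Up n T θ) (h2 : Down n T θ) : HDCons n T θ := by
  intro V hV
  refine ⟨fun π hπ hp => (prv_iff hV.1 π).2 fun M hM => ?_, fun σ hσ hp => (prv_iff hV.1 σ).2 fun M hM => ?_⟩
  · have hp := (prv_iff (ext_add hV.1 θ) π).1 hp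
    by_cases h : Tr M θ
    · exact hp M (sat_add.2 ⟨hM, h⟩)
    · obtain ⟨K, hK, hKθ, ha⟩ := h1 M h
      obtain ⟨σ, hσ, e⟩ := pi_sig hπ
      by_contra hc
      exact (e K).1 (ha σ hσ ((e M).2 hc)) (hp K (sat_add.2 ⟨sat_sub hE hV hK, hKθ⟩))
  · have hp := (prv_iff (ext_add hV.1 (∼θ)) σ).1 hp
    by_cases h : Tr M θ
    · obtain ⟨K, hK, hKθ, ha⟩ := h2 M h
      exact ha σ hσ (hp K (sat_add.2 ⟨sat_sub hE hV hK, tr_not.2 hKθ⟩))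
    · exact hp M (sat_add.2 ⟨hM, tr_not.2 h⟩)

theorem hd_sp {n : ℕ} {T : Thy} (hE : ExtPA T) {φ : Snt} (h : HDCons n T φ) : ThySPConsPA n T := by
  intro σ hσ π hπ hp
  have hp := (prv_iff hE _).1 hp
  have sub : ∀ χ : Snt, (∀ K, Sat T K → Tr K χ) → SubThy (add PAAx χ) T := fun χ hχ =>
    ⟨ext_add ext_PA χ, fun τ hτ => (prv_iff hE τ).2 fun K hK =>
      (prv_iff (ext_add ext_PA χ) τ).1 hτ K (sat_add.2 ⟨sat_PA K, hχ K hK⟩)⟩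
  have h1 := (h _ (sub (φ ⟹ π) fun K hK => tr_imp.2 fun _ => (tr_and.1 (hp K hK)).2)).1 π hπ
    ((prv_iff (ext_add (ext_add ext_PA _) _) π).2 fun K hK =>
      tr_imp.1 (sat_add.1 (sat_add.1 hK).1).2 (sat_add.1 hK).2)
  have h2 := (h _ (sub (∼φ ⟹ σ) fun K hK => tr_imp.2 fun _ => (tr_and.1 (hp K hK)).1)).2 σ hσ
    ((prv_iff (ext_add (ext_add ext_PA _) _) σ).2 fun K hK =>
      tr_imp.1 (sat_add.1 (sat_add.1 hK).1).2 (sat_add.1 hK).2)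
  have h1 := (prv_iff (ext_add ext_PA _) π).1 h1
  have h2 := (prv_iff (ext_add ext_PA _) σ).1 h2
  refine (prv_iff ext_PA _).2 fun K hK => tr_or.2 ?_
  by_cases hφ : Tr K φ
  · exact Or.inl (h2 K (sat_add.2 ⟨hK, tr_imp.2 fun hn => absurd hφ (tr_not.1 hn)⟩))
  · exact Or.inr (h1 K (sat_add.2 ⟨hK, tr_imp.2 fun hn => absurd hn hφ⟩))

/-- one half of the combination -/
theorem comb {n : ℕ} {T : Thy} {φ ψ φ₁ ψ₁ α β θ : Snt}
    (hφ : φ ∈ SigmaS n) (hψ : ψ ∈ SigmaS n) (hφ₁ : φ₁ ∈ SigmaS n) (hψ₁ : ψ₁ ∈ SigmaS n)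
    (hα : α ∈ SigmaS n) (hβ : β ∈ SigmaS n)
    (e : ∀ M, Tr M θ ↔ (Tr M φ₁ ∧ (Tr M α ∨ Tr M ψ)) ∨ (Tr M ψ₁ ∧ (Tr M β ∨ Tr M φ)))
    (r1 : ∀ M, Tr M φ₁ → Tr M φ) (r2 : ∀ M, Tr M ψ₁ → Tr M ψ)
    (r3 : ∀ M, Tr M φ → Tr M φ₁ ∨ Tr M ψ₁) (r5 : ∀ M, Tr M φ₁ → ¬ Tr M ψ₁)
    (r4 : ∀ M, Tr M ψ → Tr M φ₁ ∨ Tr M ψ₁)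
    (uT : Up n T φ) (dT : Down n T ψ) (uα : Up n T α) (dα : Down n T α) :
    Up n T θ ∧ Down n T θ := by
  have top1 : ∀ M, ¬ Tr M θ → Tr M φ₁ → ∃ K, Sat T K ∧ Tr K θ ∧ Arr n M K := by
    intro M hM h1
    have hMα : ¬ Tr M α := fun h => hM ((e M).2 (Or.inl ⟨h1, Or.inl h⟩))
    obtain ⟨K, hK, h2, ha⟩ := uα M hMα
    exact ⟨K, hK, (e K).2 (Or.inl ⟨ha _ hφ₁ h1, Or.inl h2⟩), ha⟩
  refine ⟨?_, ?_⟩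
  · intro M hM
    by_cases h1 : Tr M φ₁
    · exact top1 M hM h1
    by_cases h2 : Tr M ψ₁
    · have hMφ : ¬ Tr M φ := fun h => hM ((e M).2 (Or.inr ⟨h2, Or.inr h⟩))
      obtain ⟨K, hK, h3, ha⟩ := uT M hMφ
      exact ⟨K, hK, (e K).2 (Or.inr ⟨ha _ hψ₁ h2, Or.inr h3⟩), ha⟩
    have hMφ : ¬ Tr M φ := fun h => (r3 M h).elim h1 h2
    obtain ⟨K, hK, h3, ha⟩ := uT M hMφ
    by_cases h4 : Tr K θ
    · exact ⟨K, hK, h4, ha⟩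
    rcases r3 K h3 with h5 | h5
    · obtain ⟨L, hL, h6, hb⟩ := top1 K h4 h5
      exact ⟨L, hL, h6, ha.trans hb⟩
    · exact absurd ((e K).2 (Or.inr ⟨h5, Or.inr h3⟩)) h4
  · intro M hM
    -- below M, outside ψ and outside α
    have both : ∀ M, (Tr M ψ ∨ Tr M α) → ∃ K, Sat T K ∧ ¬ Tr K ψ ∧ ¬ Tr K α ∧ Arr n K M := by
      intro M h
      rcases h with h | h
      · obtain ⟨K, hK, h1, ha⟩ := dT M h
        by_cases h2 : Tr K α
        · obtain ⟨L, hL, h3, hb⟩ := dα K h2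
          exact ⟨L, hL, fun h => h1 (hb _ hψ h), h3, hb.trans ha⟩
        · exact ⟨K, hK, h1, h2, ha⟩
      · obtain ⟨K, hK, h1, ha⟩ := dα M h
        by_cases h2 : Tr K ψ
        · obtain ⟨L, hL, h3, hb⟩ := dT K h2
          exact ⟨L, hL, h3, fun h => h1 (hb _ hα h), hb.trans ha⟩
        · exact ⟨K, hK, h2, h1, ha⟩
    have h : Tr M ψ ∨ Tr M α := by
      rcases (e M).1 hM with ⟨_, h | h⟩ | ⟨h, _⟩
      · exact Or.inr h
      · exact Or.inl h
      · exact Or.inl (r2 M h)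
    obtain ⟨K, hK, h1, h2, ha⟩ := both M h
    refine ⟨K, hK, fun h3 => ?_, ha⟩
    rcases (e K).1 h3 with ⟨_, h | h⟩ | ⟨h, _⟩
    · exact h2 h
    · exact h1 h
    · exact h1 (r2 K h)

theorem main_aux (T U : Thy) (hT : GoodThy T) (hU : GoodThy U) (n : ℕ) (hn : 1 ≤ n) :
    (∃ φ ∈ SigmaS n, HDCons n T φ ∧ HDCons n U φ) ↔
      (ThySPConsPA n T ∧ ThySPConsPA n U ∧
        (∃ φ ∈ SigmaS n, HConsIn (PiS n) T φ ∧ HConsIn (SigmaS n) U (∼φ)) ∧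
        (∃ ψ ∈ SigmaS n, HConsIn (PiS n) U ψ ∧ HConsIn (SigmaS n) T (∼ψ))) := by
  obtain ⟨cT, -, eT⟩ := hT
  obtain ⟨cU, -, eU⟩ := hU
  constructor
  · rintro ⟨φ, hφ, h1, h2⟩
    exact ⟨hd_sp eT h1, hd_sp eU h2, ⟨φ, hφ, fun V hV => (h1 V hV).1, fun V hV => (h2 V hV).2⟩,
      ⟨φ, hφ, fun V hV => (h2 V hV).1, fun V hV => (h1 V hV).2⟩⟩
  · rintro ⟨sT, sU, ⟨φ, hφ, h1, h2⟩, ψ, hψ, h3, h4⟩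
    obtain ⟨n, rfl⟩ : ∃ k, n = k + 1 := ⟨n - 1, by omega⟩
    obtain ⟨α, hα, uα, dα⟩ := single cT eT (sp_arr eT sT)
    obtain ⟨β, hβ, uβ, dβ⟩ := single cU eU (sp_arr eU sU)
    obtain ⟨φ₁, hφ₁, ψ₁, hψ₁, hr⟩ := reduce hφ hψ
    obtain ⟨x, hx, ex⟩ := sig_or hα hψ
    obtain ⟨x1, hx1, ex1⟩ := sig_and hφ₁ hx
    obtain ⟨y, hy, ey⟩ := sig_or hβ hφ
    obtain ⟨y1, hy1, ey1⟩ := sig_and hψ₁ hy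
    obtain ⟨θ, hθ, eθ⟩ := sig_or hx1 hy1
    have e : ∀ M, Tr M θ ↔ (Tr M φ₁ ∧ (Tr M α ∨ Tr M ψ)) ∨ (Tr M ψ₁ ∧ (Tr M β ∨ Tr M φ)) := by
      intro M; rw [eθ, ex1, ey1, ex, ey]
    have cmbT := comb hφ hψ hφ₁ hψ₁ hα hβ e (fun M => (hr M).1) (fun M => (hr M).2.1)
      (fun M => (hr M).2.2.1) (fun M a b => (hr M).2.2.2.2 ⟨a, b⟩) (fun M => (hr M).2.2.2.1)
      (h_up eT h1) (h_down eT h4) uα dα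
    have cmbU := comb hψ hφ hψ₁ hφ₁ hβ hα (fun M => (e M).trans or_comm) (fun M => (hr M).2.1)
      (fun M => (hr M).1) (fun M h => ((hr M).2.2.2.1 h).symm) (fun M a b => (hr M).2.2.2.2 ⟨b, a⟩)
      (fun M h => ((hr M).2.2.1 h).symm) (h_up eU h3) (h_down eU h2) uβ dβ
    exact ⟨θ, hθ, hd_of eT cmbT.1 cmbT.2, hd_of eU cmbU.1 cmbU.2⟩


/-- Theorem 5.7: characterization of the existence of a `Σ_n` sentence which is
simultaneously hereditarily doubly `Π_n`-conservative over `T` and `U`. -/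
theorem stmt_6 (T U : Thy) (hT : GoodThy T) (hU : GoodThy U) (n : ℕ) (hn : 1 ≤ n) :
    (∃ φ ∈ SigmaS n, HDCons n T φ ∧ HDCons n U φ) ↔
      (ThySPConsPA n T ∧ ThySPConsPA n U ∧
        (∃ φ ∈ SigmaS n, HConsIn (PiS n) T φ ∧ HConsIn (SigmaS n) U (∼φ)) ∧
        (∃ ψ ∈ SigmaS n, HConsIn (PiS n) U ψ ∧ HConsIn (SigmaS n) T (∼ψ))) := by
  exact main_aux T U hT hU n hn

end Guaspari
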